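/- Let P be a polygon with a side e contained in the real axis such that 0 lies in the relative interior of e and P lies locally in the open upper half-plane near 0, and let u be a Neumann eigenfunction on P. Suppose 0 is an isolated critical point of u and ind(u,0) is well defined with ind(u,0) = 0. Then there exist a real-analytic function c on a neighborhood of 0 in ℝ², a real-analytic function ρ on a neighborhood of 0 in ℝ, and an odd integer k ≥ 3, with c(0) ≠ 0 and ρ(0) ≠ 0, such that u(x + iy) = u(0) + c(x,y)·(y² − x^k·ρ(x)) for all x + iy in some neighborhood of 0 in cl(P). -/

import Mathlib

open Complex Filter Set
open scoped Classical

noncomputable section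

/-- The real inner product on `ℂ ≅ ℝ²`. -/
def rinner (z w : ℂ) : ℝ := z.re * w.re + z.im * w.im

/-- The Laplacian of `u : ℂ → ℝ`, via the second iterated Fréchet derivative. -/
def laplacian (u : ℂ → ℝ) (z : ℂ) : ℝ :=
  iteratedFDeriv ℝ 2 u z ![1, 1] + iteratedFDeriv ℝ 2 u z ![Complex.I, Complex.I]

/-- The vertices of a polygon with set of (oriented) sides `sides`:
the endpoints of the sides. -/
def polyVertices (sides : Set (ℂ × ℂ)) : Set ℂ :=
  {p | ∃ s ∈ sides, p = s.1 ∨ p = s.2}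

/-- `carrier` is a polygon with sides the segments `[s.1, s.2]`, `s ∈ sides`:
a bounded connected open set whose boundary is the union of finitely many closed
segments with pairwise disjoint relative interiors, each endpoint of a side being
an endpoint of exactly two sides. -/
structure IsPolygon (carrier : Set ℂ) (sides : Set (ℂ × ℂ)) : Prop where
  sides_finite : sides.Finite
  isOpen : IsOpen carrier
  bounded : Bornology.IsBounded carrier
  connected : IsConnected carrier
  nondeg : ∀ s ∈ sides, s.1 ≠ s.2
  frontier_eq : frontier carrier = ⋃ s ∈ sides, segment ℝ s.1 s.2
  relint_disjoint : ∀ s ∈ sides, ∀ t ∈ sides, s ≠ t →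
    openSegment ℝ s.1 s.2 ∩ openSegment ℝ t.1 t.2 = ∅
  endpoint_two : ∀ v ∈ polyVertices sides,
    {s | s ∈ sides ∧ (v = s.1 ∨ v = s.2)}.ncard = 2

/-- A Neumann eigenfunction on the polygon with carrier `carrier` and sides
`sides`, with eigenvalue `μ`: continuous on the closure, smooth up to the
boundary away from the vertices, `Δu = -μ·u` inside, and vanishing normal
derivative on the relative interior of each side. -/
structure IsNeumannEigenfunOn (carrier : Set ℂ) (sides : Set (ℂ × ℂ))
    (u : ℂ → ℝ) (μ : ℝ) : Prop where
  cont : ContinuousOn u (closure carrier)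
  smooth : ContDiffOn ℝ (⊤ : ℕ∞) u (closure carrier \ polyVertices sides)
  eigen : ∀ z ∈ carrier, laplacian u z = -μ * u z
  neumann : ∀ s ∈ sides, ∀ p ∈ openSegment ℝ s.1 s.2,
    fderivWithin ℝ u (closure carrier) p (Complex.I * (s.2 - s.1)) = 0

/-- A second Neumann eigenfunction: a nonconstant Neumann eigenfunction whose
eigenvalue `μ > 0` is minimal among eigenvalues of nonconstant Neumann
eigenfunctions. -/
def IsSecondNeumannOn (carrier : Set ℂ) (sides : Set (ℂ × ℂ))
    (u : ℂ → ℝ) (μ : ℝ) : Prop :=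
  IsNeumannEigenfunOn carrier sides u μ ∧ 0 < μ ∧
  (¬ ∃ c : ℝ, ∀ z ∈ closure carrier, u z = c) ∧
  ∀ w ν, IsNeumannEigenfunOn carrier sides w ν →
    (¬ ∃ c : ℝ, ∀ z ∈ closure carrier, w z = c) → μ ≤ ν

/-- The punctured local level set of `u` through `p` at scale `r`. -/
def levelNear (carrier : Set ℂ) (u : ℂ → ℝ) (p : ℂ) (r : ℝ) : Set ℂ :=
  {z | z ∈ closure carrier ∧ 0 < dist z p ∧ dist z p < r ∧ u z = u p}

/-- The connected components of the punctured local level set of `u` through `p`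
at scale `r` whose closure contains `p`. -/
def branchSet (carrier : Set ℂ) (u : ℂ → ℝ) (p : ℂ) (r : ℝ) : Set (Set ℂ) :=
  {C | (∃ z ∈ levelNear carrier u p r,
          C = connectedComponentIn (levelNear carrier u p r) z) ∧ p ∈ closure C}

/-- `ind(u, p) = ι` is well defined: for all sufficiently small `r > 0` the number
of components of the punctured local level set through `p` whose closure contains
`p` is the same finite number `n`, and `ι = 1 - n/2` for interior `p`,
`ι = 1 - n` for boundary `p`. -/
def HasIndex (carrier : Set ℂ) (u : ℂ → ℝ) (p : ℂ) (ι : ℚ) : Prop :=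
  ∃ r₀ > (0 : ℝ), ∃ n : ℕ,
    (∀ r : ℝ, 0 < r → r < r₀ →
      (branchSet carrier u p r).Finite ∧ (branchSet carrier u p r).ncard = n) ∧
    ι = if p ∈ carrier then 1 - (n : ℚ) / 2 else 1 - (n : ℚ)

/-- The open sector with vertex `v`, initial direction `θ₀` and opening angle `β`. -/
def openSectorAt (v : ℂ) (θ₀ β : ℝ) : Set ℂ :=
  {z | ∃ r : ℝ, 0 < r ∧ ∃ θ : ℝ, 0 < θ ∧ θ < β ∧
    z = v + (r : ℂ) * Complex.exp (Complex.I * ((θ₀ + θ : ℝ) : ℂ))}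

/-- `carrier` has interior angle `β ∈ (0, 2π)` at `v`: near `v`, `carrier`
coincides with an open sector of angle `β` with vertex `v`. -/
def HasAngleAt (carrier : Set ℂ) (v : ℂ) (β : ℝ) : Prop :=
  0 < β ∧ β < 2 * Real.pi ∧ ∃ θ₀ : ℝ, ∃ ε > (0 : ℝ),
    carrier ∩ Metric.ball v ε = openSectorAt v θ₀ β ∩ Metric.ball v ε

/-- The Bessel function of the first kind `J_ν`. -/
def besselJ (ν x : ℝ) : ℝ :=
  ∑' k : ℕ, (-1 : ℝ) ^ k * (x / 2) ^ (2 * (k : ℝ) + ν) /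
    ((Nat.factorial k : ℝ) * Real.Gamma ((k : ℝ) + ν + 1))

/-- `w` is the unit vector at `v` pointing along the side `s` (whose endpoint `v` is). -/
def sideDirAt (s : ℂ × ℂ) (v w : ℂ) : Prop :=
  (v = s.1 ∧ w = ‖s.2 - s.1‖⁻¹ • (s.2 - s.1)) ∨
  (v = s.2 ∧ w = ‖s.1 - s.2‖⁻¹ • (s.1 - s.2))

/-- The one-sided second derivative (Hessian entry) of `u` within `S` at `p`,
in directions `v, w`. -/
def hessWithin (S : Set ℂ) (u : ℂ → ℝ) (p : ℂ) (v w : ℂ) : ℝ :=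
  fderivWithin ℝ (fun z => fderivWithin ℝ u S z v) S p w

/-- The determinant of the one-sided Hessian of `u` within `S` at `p`. -/
def hessDet (S : Set ℂ) (u : ℂ → ℝ) (p : ℂ) : ℝ :=
  hessWithin S u p 1 1 * hessWithin S u p Complex.I Complex.I -
    hessWithin S u p 1 Complex.I * hessWithin S u p Complex.I 1


open scoped Topology

lemma second_deriv_nonneg_of_isLocalMin {f f' : ℝ → ℝ} {x c : ℝ} (h : IsLocalMin f x)
    (hf : ∀ᶠ t in 𝓝 x, HasDerivAt f (f' t) t) (hf' : HasDerivAt f' c x) : 0 ≤ c := by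
  by_contra! hc
  have hd : deriv f =ᶠ[𝓝 x] f' := hf.mono fun t ht => ht.deriv
  have h2 : deriv (deriv f) x = c := by rw [hd.deriv_eq, hf'.deriv]
  have hmax : IsLocalMax f x :=
    isLocalMax_of_deriv_deriv_neg (h2 ▸ hc) h.deriv_eq_zero hf.self_of_nhds.continuousAt
  have hconst : f =ᶠ[𝓝 x] fun _ => f x := by
    filter_upwards [h, hmax] with t h1 h2 using le_antisymm h2 h1
  have : deriv f =ᶠ[𝓝 x] fun _ => (0 : ℝ) := by
    have := hconst.deriv
    simpa using this
  rw [this.deriv_eq] at h2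
  simp at h2
  linarith

lemma right_deriv_nonneg_of_forall_le {f : ℝ → ℝ} {a b m : ℝ} (hab : a < b)
    (h : ∀ t ∈ Icc a b, f a ≤ f t) (hf : HasDerivWithinAt f m (Ici a) a) : 0 ≤ m := by
  have h1 := (hasDerivWithinAt_iff_tendsto_slope' (s := Ioi a) (by simp)).1
    (hf.mono Ioi_subset_Ici_self)
  refine ge_of_tendsto h1 ?_
  filter_upwards [Ioc_mem_nhdsGT hab] with t ht
  rw [slope_def_field]
  exact div_nonneg (sub_nonneg.2 (h t ⟨ht.1.le, ht.2⟩)) (sub_nonneg.2 ht.1.le)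

lemma nonneg_of_laplacian_neg {a b c d : ℝ} {g gx gxx gy gyy : ℝ → ℝ → ℝ}
    (hab : a < b) (hcd : c < d)
    (hc : ContinuousOn (fun p : ℝ × ℝ => g p.1 p.2) (Icc a b ×ˢ Icc c d))
    (hx : ∀ x ∈ Ioo a b, ∀ y ∈ Ioo c d, HasDerivAt (fun t => g t y) (gx x y) x)
    (hxx : ∀ x ∈ Ioo a b, ∀ y ∈ Ioo c d, HasDerivAt (fun t => gx t y) (gxx x y) x)
    (hy : ∀ x ∈ Ioo a b, ∀ y ∈ Ioo c d, HasDerivAt (fun t => g x t) (gy x y) y)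
    (hyy : ∀ x ∈ Ioo a b, ∀ y ∈ Ioo c d, HasDerivAt (fun t => gy x t) (gyy x y) y)
    (hlap : ∀ x ∈ Ioo a b, ∀ y ∈ Ioo c d, gxx x y + gyy x y < 0)
    (hl : ∀ y ∈ Icc c d, 0 ≤ g a y) (hr : ∀ y ∈ Icc c d, 0 ≤ g b y)
    (ht : ∀ x ∈ Icc a b, 0 ≤ g x d)
    (hb : ∀ x ∈ Ioo a b, 0 ≤ g x c ∨ ∃ m < 0, HasDerivWithinAt (fun t => g x t) m (Ici c) c) :
    ∀ x ∈ Icc a b, ∀ y ∈ Icc c d, 0 ≤ g x y := by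
  obtain ⟨⟨x₀, y₀⟩, ⟨hx₀, hy₀⟩, hmin⟩ := (isCompact_Icc.prod isCompact_Icc).exists_isMinOn
    ⟨(a, c), ⟨left_mem_Icc.2 hab.le, left_mem_Icc.2 hcd.le⟩⟩ hc
  simp only at hx₀ hy₀
  have hmin' : ∀ x ∈ Icc a b, ∀ y ∈ Icc c d, g x₀ y₀ ≤ g x y := fun x hx y hy =>
    hmin (show (x, y) ∈ Icc a b ×ˢ Icc c d from ⟨hx, hy⟩)
  suffices 0 ≤ g x₀ y₀ from fun x hx y hy => this.trans (hmin' x hx y hy)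
  rcases hx₀.1.eq_or_lt with rfl | hxa
  · exact hl _ hy₀
  rcases hx₀.2.eq_or_lt with rfl | hxb
  · exact hr _ hy₀
  rcases hy₀.2.eq_or_lt with rfl | hyd
  · exact ht _ hx₀
  rcases hy₀.1.eq_or_lt with rfl | hyc
  · rcases hb x₀ ⟨hxa, hxb⟩ with h | ⟨m, hm, h⟩
    · exact h
    · exact absurd (right_deriv_nonneg_of_forall_le hcd (fun t ht => hmin' x₀ hx₀ t ht) h)
        (not_le.2 hm)
  · exfalso
    have h1 : 0 ≤ gxx x₀ y₀ := second_deriv_nonneg_of_isLocalMin (f := fun t => g t y₀)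
      (f' := fun t => gx t y₀)
      (by filter_upwards [Icc_mem_nhds hxa hxb] with t ht using hmin' t ht y₀ hy₀)
      (by filter_upwards [Ioo_mem_nhds hxa hxb] with t ht using hx t ht y₀ ⟨hyc, hyd⟩)
      (hxx _ ⟨hxa, hxb⟩ _ ⟨hyc, hyd⟩)
    have h2 : 0 ≤ gyy x₀ y₀ := second_deriv_nonneg_of_isLocalMin (f := fun t => g x₀ t)
      (f' := fun t => gy x₀ t)
      (by filter_upwards [Icc_mem_nhds hyc hyd] with t ht using hmin' x₀ hx₀ t ht)
      (by filter_upwards [Ioo_mem_nhds hyc hyd] with t ht using hy x₀ ⟨hxa, hxb⟩ t ht)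
      (hyy _ ⟨hxa, hxb⟩ _ ⟨hyc, hyd⟩)
    linarith [hlap _ ⟨hxa, hxb⟩ _ ⟨hyc, hyd⟩]

/-- `w k` is the `k`-th derivative in `x` of a solution `w 0` of `Δw = -μ w` on the half square
`(-R, R) × [0, R)` with Neumann condition on the bottom edge; `v k` is the `y`-derivative
of `w k`. -/
structure NeumannJet (R μ : ℝ) (w v : ℕ → ℝ → ℝ → ℝ) : Prop where
  cont : ∀ k, ContinuousOn (fun p : ℝ × ℝ => w k p.1 p.2) (Ioo (-R) R ×ˢ Ico 0 R)
  dx : ∀ k, ∀ x ∈ Ioo (-R) R, ∀ y ∈ Ico 0 R, HasDerivAt (fun t => w k t y) (w (k + 1) x y) x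
  dy : ∀ k, ∀ x ∈ Ioo (-R) R, ∀ y ∈ Ico 0 R,
    HasDerivWithinAt (fun t => w k x t) (v k x y) (Ici 0) y
  dyy : ∀ k, ∀ x ∈ Ioo (-R) R, ∀ y ∈ Ico 0 R,
    HasDerivWithinAt (fun t => v k x t) (-w (k + 2) x y - μ * w k x y) (Ici 0) y
  neumann : ∀ k, ∀ x ∈ Ioo (-R) R, v k x 0 = 0

namespace NeumannJet

variable {R μ : ℝ} {w v : ℕ → ℝ → ℝ → ℝ}

lemma neg (h : NeumannJet R μ w v) :
    NeumannJet R μ (fun k x y => -w k x y) (fun k x y => -v k x y) where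
  cont k := (h.cont k).neg
  dx k x hx y hy := (h.dx k x hx y hy).neg
  dy k x hx y hy := (h.dy k x hx y hy).neg
  dyy k x hx y hy := ((h.dyy k x hx y hy).neg).congr_deriv (by ring)
  neumann k x hx := by simp [h.neumann k x hx]

lemma shift (h : NeumannJet R μ w v) :
    NeumannJet R μ (fun k => w (k + 1)) (fun k => v (k + 1)) where
  cont k := h.cont (k + 1)
  dx k := h.dx (k + 1)
  dy k := h.dy (k + 1)
  dyy k x hx y hy := (h.dyy (k + 1) x hx y hy)
  neumann k := h.neumann (k + 1)

lemma mono (h : NeumannJet R μ w v) {R' : ℝ} (hR : R' ≤ R) : NeumannJet R' μ w v where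
  cont k := (h.cont k).mono
    (prod_mono (Ioo_subset_Ioo (by linarith) hR) (Ico_subset_Ico_right hR))
  dx k x hx y hy := h.dx k x ⟨by linarith [hx.1], by linarith [hx.2]⟩ y ⟨hy.1, by linarith [hy.2]⟩
  dy k x hx y hy := h.dy k x ⟨by linarith [hx.1], by linarith [hx.2]⟩ y ⟨hy.1, by linarith [hy.2]⟩
  dyy k x hx y hy :=
    h.dyy k x ⟨by linarith [hx.1], by linarith [hx.2]⟩ y ⟨hy.1, by linarith [hy.2]⟩
  neumann k x hx := h.neumann k x ⟨by linarith [hx.1], by linarith [hx.2]⟩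

lemma deriv_le (h : NeumannJet R μ w v) {k : ℕ} {x₀ y₀ δ M : ℝ} (hδ : 0 < δ)
    (hx₁ : -R < x₀ - δ) (hx₂ : x₀ + δ < R) (hy₁ : 0 ≤ y₀) (hy₂ : y₀ + δ < R)
    (hM : ∀ x ∈ Icc (x₀ - δ) (x₀ + δ), ∀ y ∈ Icc 0 (y₀ + δ), |w k x y| ≤ M) :
    w (k + 1) x₀ y₀ ≤ 2 * M / δ + |μ| * M * δ / 2 := by
  have hM0 : 0 ≤ M := (abs_nonneg _).trans
    (hM x₀ ⟨by linarith, by linarith⟩ y₀ ⟨hy₁, by linarith⟩)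
  have hxp : ∀ ξ ∈ Icc 0 δ, x₀ + ξ ∈ Icc (x₀ - δ) (x₀ + δ) := fun ξ hξ =>
    ⟨by linarith [hξ.1], by linarith [hξ.2]⟩
  have hxm : ∀ ξ ∈ Icc 0 δ, x₀ - ξ ∈ Icc (x₀ - δ) (x₀ + δ) := fun ξ hξ =>
    ⟨by linarith [hξ.2], by linarith [hξ.1]⟩
  have hR : ∀ x ∈ Icc (x₀ - δ) (x₀ + δ), x ∈ Ioo (-R) R := fun x hx =>
    ⟨by linarith [hx.1], by linarith [hx.2]⟩
  set c := max 0 (y₀ - δ) with hc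
  have hc0 : 0 ≤ c := le_max_left _ _
  have hcy : c ≤ y₀ := max_le hy₁ (by linarith)
  have hyI : ∀ y ∈ Icc c (y₀ + δ), y ∈ Icc 0 (y₀ + δ) := fun y hy => ⟨hc0.trans hy.1, hy.2⟩
  have hyR : ∀ y ∈ Icc 0 (y₀ + δ), y ∈ Ico 0 R := fun y hy => ⟨hy.1, by linarith [hy.2]⟩
  have hdp : ∀ k, ∀ ξ ∈ Icc 0 δ, ∀ y ∈ Icc 0 (y₀ + δ),
      HasDerivAt (fun t => w k (x₀ + t) y) (w (k + 1) (x₀ + ξ) y) ξ := fun k ξ hξ y hy => by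
    simpa using (h.dx k _ (hR _ (hxp ξ hξ)) y (hyR y hy)).comp_const_add x₀ ξ
  have hdm : ∀ k, ∀ ξ ∈ Icc 0 δ, ∀ y ∈ Icc 0 (y₀ + δ),
      HasDerivAt (fun t => w k (x₀ - t) y) (-w (k + 1) (x₀ - ξ) y) ξ := fun k ξ hξ y hy => by
    simpa using (h.dx k _ (hR _ (hxm ξ hξ)) y (hyR y hy)).comp_const_sub x₀ ξ
  have key : ∀ ε > 0, ∀ ξ ∈ Icc 0 δ, ∀ y ∈ Icc c (y₀ + δ),
      0 ≤ M / δ ^ 2 * ((y - y₀) ^ 2 + ξ * (2 * δ - ξ)) + |μ| * M / 2 * (ξ * (δ - ξ))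
        + ε * (y₀ + δ + δ ^ 2 - y - ξ ^ 2) - (w k (x₀ + ξ) y - w k (x₀ - ξ) y) / 2 := by
    intro ε hε
    have hpos : ∀ ξ ∈ Icc 0 δ, ∀ y ∈ Icc c (y₀ + δ), 0 ≤ ε * (y₀ + δ + δ ^ 2 - y - ξ ^ 2) := by
      intro ξ hξ y hy
      apply mul_nonneg hε.le
      nlinarith [hξ.1, hξ.2, hy.2]
    have hw : ∀ ξ ∈ Icc 0 δ, ∀ y ∈ Icc c (y₀ + δ),
        |(w k (x₀ + ξ) y - w k (x₀ - ξ) y) / 2| ≤ M := by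
      intro ξ hξ y hy
      have h1 := abs_le.1 (hM _ (hxp ξ hξ) y (hyI y hy))
      have h2 := abs_le.1 (hM _ (hxm ξ hξ) y (hyI y hy))
      exact abs_le.2 ⟨by linarith, by linarith⟩
    have hq : ∀ ξ ∈ Icc 0 δ, 0 ≤ |μ| * M / 2 * (ξ * (δ - ξ)) := fun ξ hξ =>
      mul_nonneg (by positivity) (mul_nonneg hξ.1 (by linarith [hξ.2]))
    have hedge : ∀ ξ ∈ Icc 0 δ, ∀ y ∈ Icc c (y₀ + δ),
        δ ^ 2 ≤ (y - y₀) ^ 2 + ξ * (2 * δ - ξ) →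
        0 ≤ M / δ ^ 2 * ((y - y₀) ^ 2 + ξ * (2 * δ - ξ)) + |μ| * M / 2 * (ξ * (δ - ξ))
        + ε * (y₀ + δ + δ ^ 2 - y - ξ ^ 2) - (w k (x₀ + ξ) y - w k (x₀ - ξ) y) / 2 := by
      intro ξ hξ y hy hle
      have h1 : M ≤ M / δ ^ 2 * ((y - y₀) ^ 2 + ξ * (2 * δ - ξ)) := by
        calc M = M / δ ^ 2 * δ ^ 2 := by field_simp
          _ ≤ _ := by gcongr
      linarith [hpos ξ hξ y hy, hq ξ hξ, (abs_le.1 (hw ξ hξ y hy)).2]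
    refine nonneg_of_laplacian_neg
      (gx := fun ξ y => M / δ ^ 2 * (2 * δ - 2 * ξ) + |μ| * M / 2 * (δ - 2 * ξ) + ε * (-(2 * ξ))
        - (w (k + 1) (x₀ + ξ) y + w (k + 1) (x₀ - ξ) y) / 2)
      (gxx := fun ξ y => M / δ ^ 2 * (-2) + |μ| * M / 2 * (-2) + ε * (-2)
        - (w (k + 2) (x₀ + ξ) y - w (k + 2) (x₀ - ξ) y) / 2)
      (gy := fun ξ y => M / δ ^ 2 * (2 * (y - y₀)) + ε * (-1)
        - (v k (x₀ + ξ) y - v k (x₀ - ξ) y) / 2)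
      (gyy := fun ξ y => M / δ ^ 2 * 2
        - ((-w (k + 2) (x₀ + ξ) y - μ * w k (x₀ + ξ) y)
          - (-w (k + 2) (x₀ - ξ) y - μ * w k (x₀ - ξ) y)) / 2)
      hδ (by linarith) ?_ ?_ ?_ ?_ ?_ ?_ ?_ ?_ ?_ ?_
    · have h1 : ContinuousOn (fun p : ℝ × ℝ => w k (x₀ + p.1) p.2)
          (Icc 0 δ ×ˢ Icc c (y₀ + δ)) := by
        refine (h.cont k).comp (f := fun p : ℝ × ℝ => (x₀ + p.1, p.2)) (by fun_prop) ?_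
        exact fun p hp => ⟨hR _ (hxp _ hp.1), hyR _ (hyI _ hp.2)⟩
      have h2 : ContinuousOn (fun p : ℝ × ℝ => w k (x₀ - p.1) p.2)
          (Icc 0 δ ×ˢ Icc c (y₀ + δ)) := by
        refine (h.cont k).comp (f := fun p : ℝ × ℝ => (x₀ - p.1, p.2)) (by fun_prop) ?_
        exact fun p hp => ⟨hR _ (hxm _ hp.1), hyR _ (hyI _ hp.2)⟩
      exact ContinuousOn.sub (Continuous.continuousOn (by fun_prop)) ((h1.sub h2).div_const 2)
    · intro ξ hξ y hy
      have hi := hasDerivAt_id ξ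
      have hp := hdp k ξ (Ioo_subset_Icc_self hξ) y (hyI y (Ioo_subset_Icc_self hy))
      have hm := hdm k ξ (Ioo_subset_Icc_self hξ) y (hyI y (Ioo_subset_Icc_self hy))
      have := (((((hi.mul (hi.const_sub (2 * δ))).const_add ((y - y₀) ^ 2)).const_mul
        (M / δ ^ 2)).add ((hi.mul (hi.const_sub δ)).const_mul (|μ| * M / 2))).add
        (((hi.pow 2).const_sub (y₀ + δ + δ ^ 2 - y)).const_mul ε)).sub ((hp.sub hm).div_const 2)
      refine this.congr_deriv ?_
      simp only [id]; norm_num; ring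
    · intro ξ hξ y hy
      have hi := hasDerivAt_id ξ
      have hp := hdp (k + 1) ξ (Ioo_subset_Icc_self hξ) y (hyI y (Ioo_subset_Icc_self hy))
      have hm := hdm (k + 1) ξ (Ioo_subset_Icc_self hξ) y (hyI y (Ioo_subset_Icc_self hy))
      have := (((((hi.const_mul 2).const_sub (2 * δ)).const_mul
        (M / δ ^ 2)).add (((hi.const_mul 2).const_sub δ).const_mul (|μ| * M / 2))).add
        (((hi.const_mul 2).neg).const_mul ε)).sub ((hp.add hm).div_const 2)
      refine this.congr_deriv ?_
      ring
    · intro ξ hξ y hy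
      have hy' := hyI y (Ioo_subset_Icc_self hy)
      have hn : Ici (0 : ℝ) ∈ 𝓝 y := Ici_mem_nhds (hc0.trans_lt hy.1)
      have hi := hasDerivAt_id y
      have hp := (h.dy k _ (hR _ (hxp _ (Ioo_subset_Icc_self hξ))) y (hyR y hy')).hasDerivAt hn
      have hm := (h.dy k _ (hR _ (hxm _ (Ioo_subset_Icc_self hξ))) y (hyR y hy')).hasDerivAt hn
      have := ((((((hi.sub_const y₀).pow 2).add_const (ξ * (2 * δ - ξ))).const_mul
        (M / δ ^ 2)).add_const (|μ| * M / 2 * (ξ * (δ - ξ)))).add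
        (((hi.const_sub (y₀ + δ + δ ^ 2)).sub_const (ξ ^ 2)).const_mul ε)).sub
        ((hp.sub hm).div_const 2)
      refine this.congr_deriv ?_
      simp only [id]; norm_num
    · intro ξ hξ y hy
      have hy' := hyI y (Ioo_subset_Icc_self hy)
      have hn : Ici (0 : ℝ) ∈ 𝓝 y := Ici_mem_nhds (hc0.trans_lt hy.1)
      have hi := hasDerivAt_id y
      have hp := (h.dyy k _ (hR _ (hxp _ (Ioo_subset_Icc_self hξ))) y (hyR y hy')).hasDerivAt hn
      have hm := (h.dyy k _ (hR _ (hxm _ (Ioo_subset_Icc_self hξ))) y (hyR y hy')).hasDerivAt hn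
      have := (((((hi.sub_const y₀).const_mul 2)).const_mul
        (M / δ ^ 2)).add_const (ε * (-1))).sub ((hp.sub hm).div_const 2)
      refine this.congr_deriv ?_
      ring
    · intro ξ hξ y hy
      have h1 := hw ξ (Ioo_subset_Icc_self hξ) y (Ioo_subset_Icc_self hy)
      have h2 : |μ * ((w k (x₀ + ξ) y - w k (x₀ - ξ) y) / 2)| ≤ |μ| * M := by
        rw [abs_mul]; gcongr
      have h3 := (abs_le.1 h2).2
      nlinarith
    · intro y hy
      have := hpos 0 ⟨le_rfl, hδ.le⟩ y hy
      simp only [add_zero, sub_zero, sub_self, zero_mul, mul_zero, zero_div]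
      simp only [ne_eq, OfNat.ofNat_ne_zero, not_false_eq_true, zero_pow, sub_zero] at this ⊢
      have : 0 ≤ M / δ ^ 2 * (y - y₀) ^ 2 := by positivity
      linarith
    · intro y hy
      exact hedge δ ⟨hδ.le, le_rfl⟩ y hy (by nlinarith [sq_nonneg (y - y₀)])
    · intro ξ hξ
      refine hedge ξ hξ _ ⟨by linarith, le_rfl⟩ ?_
      nlinarith [mul_nonneg hξ.1 (by linarith [hξ.2] : 0 ≤ 2 * δ - ξ)]
    · intro ξ hξ
      have hξ' := Ioo_subset_Icc_self hξ
      rcases le_or_gt 0 (y₀ - δ) with h0 | h0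
      · left
        refine hedge ξ hξ' c ⟨le_rfl, by linarith⟩ ?_
        have : c = y₀ - δ := max_eq_right h0
        rw [this]
        nlinarith [mul_nonneg hξ'.1 (by linarith [hξ'.2] : 0 ≤ 2 * δ - ξ)]
      · right
        have hc' : c = 0 := max_eq_left h0.le
        rw [hc']
        have hi := (hasDerivAt_id (0 : ℝ)).hasDerivWithinAt (s := Ici 0)
        have h0' : (0 : ℝ) ∈ Ico 0 R := ⟨le_rfl, by linarith⟩
        have hp := h.dy k _ (hR _ (hxp _ hξ')) 0 h0'
        have hm := h.dy k _ (hR _ (hxm _ hξ')) 0 h0'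
        rw [h.neumann k _ (hR _ (hxp _ hξ'))] at hp
        rw [h.neumann k _ (hR _ (hxm _ hξ'))] at hm
        have := ((((((hi.sub_const y₀).pow 2).add_const (ξ * (2 * δ - ξ))).const_mul
          (M / δ ^ 2)).add_const (|μ| * M / 2 * (ξ * (δ - ξ)))).add
          (((hi.const_sub (y₀ + δ + δ ^ 2)).sub_const (ξ ^ 2)).const_mul ε)).sub
          ((hp.sub hm).div_const 2)
        refine ⟨_, ?_, this⟩
        have : 0 ≤ M / δ ^ 2 * (2 * y₀) := by positivity
        simp only [id]; norm_num
        nlinarith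
  have hfin : ∀ ξ ∈ Icc 0 δ, 0 ≤ M / δ ^ 2 * (ξ * (2 * δ - ξ)) + |μ| * M / 2 * (ξ * (δ - ξ))
      - (w k (x₀ + ξ) y₀ - w k (x₀ - ξ) y₀) / 2 := by
    intro ξ hξ
    have hlim : Tendsto (fun ε : ℝ => M / δ ^ 2 * ((y₀ - y₀) ^ 2 + ξ * (2 * δ - ξ))
        + |μ| * M / 2 * (ξ * (δ - ξ))
        + ε * (y₀ + δ + δ ^ 2 - y₀ - ξ ^ 2) - (w k (x₀ + ξ) y₀ - w k (x₀ - ξ) y₀) / 2) (𝓝[>] 0)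
        (𝓝 (M / δ ^ 2 * ((y₀ - y₀) ^ 2 + ξ * (2 * δ - ξ)) + |μ| * M / 2 * (ξ * (δ - ξ))
        + 0 * (y₀ + δ + δ ^ 2 - y₀ - ξ ^ 2) - (w k (x₀ + ξ) y₀ - w k (x₀ - ξ) y₀) / 2)) := by
      apply tendsto_nhdsWithin_of_tendsto_nhds
      apply Continuous.tendsto
        (f := fun ε : ℝ => M / δ ^ 2 * ((y₀ - y₀) ^ 2 + ξ * (2 * δ - ξ))
        + |μ| * M / 2 * (ξ * (δ - ξ))
        + ε * (y₀ + δ + δ ^ 2 - y₀ - ξ ^ 2) - (w k (x₀ + ξ) y₀ - w k (x₀ - ξ) y₀) / 2)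
      fun_prop
    have := ge_of_tendsto hlim (by
      filter_upwards [self_mem_nhdsWithin] with ε hε
      exact key ε hε ξ hξ y₀ ⟨hcy, by linarith⟩)
    simpa using this
  have h0 : (0 : ℝ) ∈ Icc 0 δ := ⟨le_rfl, hδ.le⟩
  have hy0 : y₀ ∈ Icc 0 (y₀ + δ) := ⟨hy₁, by linarith⟩
  have hi := hasDerivAt_id (0 : ℝ)
  have hD := ((((hi.mul (hi.const_sub (2 * δ))).const_mul
        (M / δ ^ 2)).add ((hi.mul (hi.const_sub δ)).const_mul (|μ| * M / 2)))).sub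
        (((hdp k 0 h0 y₀ hy0).sub (hdm k 0 h0 y₀ hy0)).div_const 2)
  have := right_deriv_nonneg_of_forall_le hδ (fun t ht => by
    simpa using hfin t ht) hD.hasDerivWithinAt
  simp only [id, add_zero, sub_zero] at this
  have e : M / δ ^ 2 * (2 * δ) = 2 * M / δ := by field_simp
  linarith

lemma abs_deriv_le (h : NeumannJet R μ w v) {k : ℕ} {x₀ y₀ δ M : ℝ} (hδ : 0 < δ)
    (hx₁ : -R < x₀ - δ) (hx₂ : x₀ + δ < R) (hy₁ : 0 ≤ y₀) (hy₂ : y₀ + δ < R)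
    (hM : ∀ x ∈ Icc (x₀ - δ) (x₀ + δ), ∀ y ∈ Icc 0 (y₀ + δ), |w k x y| ≤ M) :
    |w (k + 1) x₀ y₀| ≤ 2 * M / δ + |μ| * M * δ / 2 := by
  refine abs_le'.2 ⟨h.deriv_le hδ hx₁ hx₂ hy₁ hy₂ hM, ?_⟩
  exact h.neg.deriv_le hδ hx₁ hx₂ hy₁ hy₂ (fun x hx y hy => by simpa using hM x hx y hy)

lemma abs_le_mul_pow (h : NeumannJet R μ w v) {r δ M : ℝ} (hδ : 0 < δ) (hr : r < R)
    (hM : ∀ x ∈ Icc (-r) r, ∀ y ∈ Icc 0 r, |w 0 x y| ≤ M) (k : ℕ) (hk : k * δ ≤ r) :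
    ∀ x ∈ Icc (-(r - k * δ)) (r - k * δ), ∀ y ∈ Icc 0 (r - k * δ),
      |w k x y| ≤ M * (2 / δ + |μ| * δ / 2) ^ k := by
  induction k with
  | zero => simpa using hM
  | succ k ih =>
    intro x hx y hy
    push_cast at hk hx hy
    have hkδ : 0 ≤ k * δ := by positivity
    refine (h.abs_deriv_le hδ (M := M * (2 / δ + |μ| * δ / 2) ^ k)
      (by nlinarith [hx.1]) (by nlinarith [hx.2]) hy.1 (by nlinarith [hy.2]) ?_).trans_eq ?_
    · intro x' hx' y' hy'
      exact ih (by linarith) x' ⟨by linarith [hx.1, hx'.1], by linarith [hx.2, hx'.2]⟩ y'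
        ⟨hy'.1, by linarith [hy'.2, hy.2]⟩
    · ring

lemma exists_cauchy_bound (h : NeumannJet R μ w v) (hR : 0 < R) :
    ∃ r > 0, r < R ∧ ∃ M ≥ 0, ∃ A ≥ 1, ∀ k, ∀ x ∈ Icc (-r) r, ∀ y ∈ Icc 0 r,
      |w k x y| ≤ M * A ^ k * k.factorial := by
  obtain ⟨r, hr0, hrR, hr1⟩ : ∃ r > 0, r < R ∧ r ≤ 1 :=
    ⟨min (R / 2) 1, by positivity, (min_le_left _ _).trans_lt (by linarith), min_le_right _ _⟩
  obtain ⟨M, hM⟩ := (isCompact_Icc.prod isCompact_Icc :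
    IsCompact (Icc (-r) r ×ˢ Icc 0 r)).exists_bound_of_continuousOn ((h.cont 0).mono
      (prod_mono (Icc_subset_Ioo (by linarith) hrR) (Icc_subset_Ico_right hrR)))
  have hM' : ∀ x ∈ Icc (-r) r, ∀ y ∈ Icc 0 r, |w 0 x y| ≤ M := fun x hx y hy =>
    hM (x, y) ⟨hx, hy⟩
  have hM0 : 0 ≤ M := (abs_nonneg _).trans
    (hM' 0 ⟨by linarith, hr0.le⟩ 0 ⟨le_rfl, hr0.le⟩)
  have hμ := abs_nonneg μ
  have hA : 1 ≤ (4 + |μ|) / r := by rw [le_div_iff₀ hr0]; linarith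
  have he : 1 ≤ Real.exp 1 := Real.one_le_exp (by norm_num)
  refine ⟨r / 2, by positivity, by linarith, M, hM0, (4 + |μ|) / r * Real.exp 1,
    one_le_mul_of_one_le_of_one_le hA he, ?_⟩
  intro k x hx y hy
  rcases Nat.eq_zero_or_pos k with rfl | hk
  · simpa using hM' x ⟨by linarith [hx.1], by linarith [hx.2]⟩ y ⟨hy.1, by linarith [hy.2]⟩
  have hk1 : (1 : ℝ) ≤ k := by exact_mod_cast hk
  have hkδ : k * (r / (2 * k)) = r / 2 := by field_simp
  have := h.abs_le_mul_pow (r := r) (δ := r / (2 * k)) (by positivity) hrR hM' k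
    (by rw [hkδ]; linarith)
    x (by rw [hkδ]; constructor <;> linarith [hx.1, hx.2])
    y (by rw [hkδ]; constructor <;> linarith [hy.1, hy.2])
  refine this.trans ?_
  have h1 : 2 / (r / (2 * k)) + |μ| * (r / (2 * k)) / 2 ≤ (4 + |μ|) / r * k := by
    have e1 : 2 / (r / (2 * k)) = 4 / r * k := by field_simp; norm_num
    have e2 : |μ| * (r / (2 * k)) / 2 ≤ |μ| / r * k := by
      rw [show |μ| * (r / (2 * k)) / 2 = |μ| * (r / (4 * k)) by field_simp; norm_num,
        show |μ| / r * k = |μ| * (k / r) by ring]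
      refine mul_le_mul_of_nonneg_left ?_ hμ
      rw [div_le_div_iff₀ (by positivity) hr0]
      nlinarith
    rw [e1, add_div, add_mul]
    linarith
  calc M * (2 / (r / (2 * k)) + |μ| * (r / (2 * k)) / 2) ^ k
      ≤ M * ((4 + |μ|) / r * k) ^ k := by gcongr
    _ = M * ((4 + |μ|) / r) ^ k * (k : ℝ) ^ k := by rw [mul_pow]; ring
    _ ≤ M * ((4 + |μ|) / r) ^ k * (Real.exp 1 ^ k * k.factorial) := by
        gcongr
        have := Real.pow_div_factorial_le_exp (k : ℝ) (by positivity) k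
        rw [div_le_iff₀ (by positivity)] at this
        rwa [← Real.exp_nat_mul, mul_one]
    _ = _ := by rw [mul_pow]; ring

end NeumannJet

lemma abs_sub_taylor_le (N : ℕ) : ∀ {φ : ℕ → ℝ → ℝ} {B : ℝ},
    (∀ n, ContinuousOn (φ n) (Icc 0 1)) →
    (∀ n, ∀ t ∈ Ico (0 : ℝ) 1, HasDerivWithinAt (φ n) (φ (n + 1) t) (Ici t) t) →
    (∀ t ∈ Icc (0 : ℝ) 1, |φ N t| ≤ B) → ∀ t ∈ Icc (0 : ℝ) 1,
    |φ 0 t - ∑ n ∈ Finset.range N, φ n 0 / n.factorial * t ^ n| ≤ B * t ^ N / N.factorial := by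
  induction N with
  | zero => intro φ B _ _ hB t ht; simpa using hB t ht
  | succ N ih =>
    intro φ B hc hd hB
    have h1 := ih (φ := fun n => φ (n + 1)) (fun n => hc _) (fun n => hd _) hB
    have hder : ∀ t : ℝ, HasDerivAt
        (fun t => ∑ n ∈ Finset.range (N + 1), φ n 0 / n.factorial * t ^ n)
        (∑ n ∈ Finset.range N, φ (n + 1) 0 / n.factorial * t ^ n) t := by
      intro t
      have := HasDerivAt.fun_sum (u := Finset.range (N + 1)) fun n _ =>
        (hasDerivAt_pow n t).const_mul (φ n 0 / n.factorial)
      refine this.congr_deriv ?_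
      rw [Finset.sum_range_succ']
      simp only [CharP.cast_eq_zero, zero_mul, mul_zero, add_zero]
      refine Finset.sum_congr rfl fun n _ => ?_
      rw [Nat.factorial_succ]
      push_cast
      field_simp
    have hB' : ∀ t : ℝ, HasDerivAt (fun t => B * t ^ (N + 1) / (N + 1).factorial)
        (B * t ^ N / N.factorial) t := by
      intro t
      have := ((hasDerivAt_pow (N + 1) t).const_mul B).div_const ((N + 1).factorial : ℝ)
      refine this.congr_deriv ?_
      rw [Nat.factorial_succ]
      push_cast
      field_simp
    have := image_norm_le_of_norm_deriv_right_le_deriv_boundary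
      (f := fun t => φ 0 t - ∑ n ∈ Finset.range (N + 1), φ n 0 / n.factorial * t ^ n)
      (f' := fun t => φ 1 t - ∑ n ∈ Finset.range N, φ (n + 1) 0 / n.factorial * t ^ n)
      (a := 0) (b := 1)
      ((hc 0).sub fun t _ => (hder t).continuousAt.continuousWithinAt)
      (fun t ht => (hd 0 t ht).sub (hder t).hasDerivWithinAt)
      (B := fun t => B * t ^ (N + 1) / (N + 1).factorial)
      (by rw [Finset.sum_range_succ']; simp) hB'
      (fun t ht => h1 t (Ico_subset_Icc_self ht))
    exact this

lemma hasSum_taylor {φ : ℕ → ℝ → ℝ} {M q : ℝ} (hq0 : 0 ≤ q) (hq : q < 1)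
    (hc : ∀ n, ContinuousOn (φ n) (Icc 0 1))
    (hd : ∀ n, ∀ t ∈ Ico (0 : ℝ) 1, HasDerivWithinAt (φ n) (φ (n + 1) t) (Ici t) t)
    (h0 : ∀ n, |φ n 0| ≤ M * q ^ n * n.factorial)
    (hB : ∀ j, ∀ t ∈ Icc (0 : ℝ) 1, |φ (2 * j) t| ≤ M * q ^ (2 * j) * (2 * j).factorial) :
    HasSum (fun n => φ n 0 / n.factorial) (φ 0 1) := by
  have hs : Summable fun n => φ n 0 / (n.factorial : ℝ) := by
    refine Summable.of_norm_bounded ((summable_geometric_of_lt_one hq0 hq).mul_left M) fun n => ?_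
    rw [Real.norm_eq_abs, abs_div, Nat.abs_cast, div_le_iff₀ (by positivity)]
    exact h0 n
  have h1 := (hs.hasSum.tendsto_sum_nat).comp (tendsto_id.const_mul_atTop' (r := 2) two_pos)
  have h2 : Tendsto (fun j => ∑ n ∈ Finset.range (2 * j), φ n 0 / (n.factorial : ℝ)) atTop
      (𝓝 (φ 0 1)) := by
    rw [tendsto_iff_dist_tendsto_zero]
    have hz : Tendsto (fun j : ℕ => M * q ^ (2 * j)) atTop (𝓝 0) := by
      have := ((tendsto_pow_atTop_nhds_zero_of_lt_one hq0 hq).comp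
        (tendsto_id.const_mul_atTop' (r := 2) two_pos)).const_mul M
      simpa using this
    refine squeeze_zero (fun _ => dist_nonneg) (fun j => ?_) hz
    have := abs_sub_taylor_le (2 * j) hc hd (hB j) 1 (by simp)
    rw [dist_comm, Real.dist_eq]
    simp only [one_pow, mul_one] at this
    refine this.trans_eq ?_
    field_simp
  rw [tendsto_nhds_unique h2 h1]
  exact hs.hasSum

/-- The operator `(-∂ₓ² - μ)^j` applied to a jet. -/
def evenDeriv (μ : ℝ) (w : ℕ → ℝ → ℝ → ℝ) : ℕ → ℕ → ℝ → ℝ → ℝ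
  | 0 => w
  | j + 1 => fun k x y => -evenDeriv μ w j (k + 2) x y - μ * evenDeriv μ w j k x y

/-- The coefficient of `x ^ i * y ^ (2 * j)` in the Taylor series of a jet. -/
def jetCoeff (μ : ℝ) (w : ℕ → ℝ → ℝ → ℝ) (i j : ℕ) : ℝ :=
  evenDeriv μ w j i 0 0 / (i.factorial * (2 * j).factorial)

namespace NeumannJet

variable {R μ : ℝ} {w v : ℕ → ℝ → ℝ → ℝ}

lemma evenDeriv (h : NeumannJet R μ w v) (j : ℕ) :
    NeumannJet R μ (evenDeriv μ w j) (_root_.evenDeriv μ v j) := by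
  induction j with
  | zero => exact h
  | succ j ih =>
    constructor
    · exact fun k => ((ih.cont (k + 2)).neg).sub ((ih.cont k).const_smul μ)
    · exact fun k x hx y hy => ((ih.dx (k + 2) x hx y hy).neg).sub ((ih.dx k x hx y hy).const_mul μ)
    · exact fun k x hx y hy => ((ih.dy (k + 2) x hx y hy).neg).sub ((ih.dy k x hx y hy).const_mul μ)
    · intro k x hx y hy
      refine (((ih.dyy (k + 2) x hx y hy).neg).sub
        ((ih.dyy k x hx y hy).const_mul μ)).congr_deriv ?_
      simp only [_root_.evenDeriv]
    · intro k x hx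
      simp [_root_.evenDeriv, ih.neumann _ x hx]

lemma abs_evenDeriv_le {M A x y : ℝ} (hA : 1 ≤ A) (hM : 0 ≤ M)
    (hw : ∀ k, |w k x y| ≤ M * A ^ k * k.factorial) (j k : ℕ) :
    |_root_.evenDeriv μ w j k x y| ≤
      M * (1 + |μ|) ^ j * A ^ (2 * j + k) * (2 * j + k).factorial := by
  induction j generalizing k with
  | zero => simpa [_root_.evenDeriv] using hw k
  | succ j ih =>
    simp only [_root_.evenDeriv]
    have h1 := ih (k + 2)
    have h2 := ih k
    have h3 : M * (1 + |μ|) ^ j * A ^ (2 * j + k) * (2 * j + k).factorial ≤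
        M * (1 + |μ|) ^ j * A ^ (2 * j + (k + 2)) * (2 * j + (k + 2)).factorial := by
      gcongr <;> omega
    calc |-_root_.evenDeriv μ w j (k + 2) x y - μ * _root_.evenDeriv μ w j k x y|
        ≤ |_root_.evenDeriv μ w j (k + 2) x y| + |μ| * |_root_.evenDeriv μ w j k x y| := by
          rw [← abs_mul, ← abs_neg (_root_.evenDeriv μ w j (k + 2) x y)]
          exact abs_sub _ _
      _ ≤ (1 + |μ|) *
          (M * (1 + |μ|) ^ j * A ^ (2 * j + (k + 2)) * (2 * j + (k + 2)).factorial) := by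
          rw [add_mul, one_mul]
          gcongr
          exact h2.trans h3
      _ = _ := by
          rw [show 2 * (j + 1) + k = 2 * j + (k + 2) by ring]
          ring

lemma exists_evenDeriv_bound (h : NeumannJet R μ w v) (hR : 0 < R) :
    ∃ r > 0, r < R ∧ ∃ M ≥ 0, ∃ L ≥ 1, ∀ j k, ∀ x ∈ Icc (-r) r, ∀ y ∈ Icc 0 r,
      |_root_.evenDeriv μ w j k x y| ≤ M * L ^ (k + 2 * j) * (k.factorial * (2 * j).factorial) := by
  obtain ⟨r, hr, hrR, M, hM, A, hA, hb⟩ := h.exists_cauchy_bound hR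
  have hμ := abs_nonneg μ
  refine ⟨r, hr, hrR, M, hM, (1 + |μ|) * (A * 2), by nlinarith, fun j k x hx y hy => ?_⟩
  refine (abs_evenDeriv_le (μ := μ) hA hM (fun k => hb k x hx y hy) j k).trans ?_
  have h1 : ((2 * j + k).factorial : ℝ) ≤ 2 ^ (2 * j + k) * (k.factorial * (2 * j).factorial) := by
    have := Nat.add_choose_mul_factorial_mul_factorial (2 * j) k
    have h2 := Nat.choose_le_two_pow (2 * j + k) k
    have h3 : (2 * j + k).factorial ≤ 2 ^ (2 * j + k) * (k.factorial * (2 * j).factorial) := by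
      rw [← this, mul_comm k.factorial, mul_assoc]
      gcongr
    exact_mod_cast h3
  calc M * (1 + |μ|) ^ j * A ^ (2 * j + k) * (2 * j + k).factorial
      ≤ M * (1 + |μ|) ^ (k + 2 * j) * A ^ (2 * j + k) *
        (2 ^ (2 * j + k) * (k.factorial * (2 * j).factorial)) := by
        gcongr
        · linarith
        · omega
    _ = _ := by
        rw [mul_pow, mul_pow, add_comm k]
        ring

lemma exists_expansion (h : NeumannJet R μ w v) (hR : 0 < R) :
    ∃ r > 0, ∃ M ≥ 0, ∃ L ≥ 1, (∀ i j, |jetCoeff μ w i j| ≤ M * L ^ (i + 2 * j)) ∧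
      ∀ x y, |x| < r → 0 ≤ y → y < r → ∃ b : ℕ → ℝ,
        HasSum (fun j => b j * y ^ (2 * j)) (w 0 x y) ∧
        ∀ j, HasSum (fun i => jetCoeff μ w i j * x ^ i) (b j) := by
  obtain ⟨r, hr, hrR, M, hM, L, hL, hb⟩ := h.exists_evenDeriv_bound hR
  have hL0 : 0 < L := by linarith
  refine ⟨min r (1 / L), by positivity, M, hM, L, hL, fun i j => ?_, fun x y hx hy0 hy => ?_⟩
  · rw [jetCoeff, abs_div, div_le_iff₀ (by positivity), abs_of_pos
      (by positivity : (0 : ℝ) < i.factorial * (2 * j).factorial)]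
    exact hb j i 0 ⟨by linarith, hr.le⟩ 0 ⟨le_rfl, hr.le⟩
  obtain ⟨hx1, hx2⟩ := lt_min_iff.1 hx
  obtain ⟨hy1, hy2⟩ := lt_min_iff.1 hy
  rw [lt_div_iff₀ hL0] at hx2 hy2
  have hx1' := abs_lt.1 hx1
  have hxR : x ∈ Ioo (-R) R := ⟨by linarith, by linarith⟩
  refine ⟨fun j => _root_.evenDeriv μ w j 0 x 0 / (2 * j).factorial, ?_, fun j => ?_⟩
  · have hyt : ∀ t ∈ Icc (0 : ℝ) 1, t * y ∈ Icc 0 r := fun t ht =>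
      ⟨mul_nonneg ht.1 hy0, by nlinarith [ht.1, ht.2]⟩
    have hyR : ∀ t ∈ Icc (0 : ℝ) 1, t * y ∈ Ico 0 R := fun t ht =>
      ⟨(hyt t ht).1, (hyt t ht).2.trans_lt hrR⟩
    let ψ : ℕ → ℝ → ℝ := fun n s => if Even n then _root_.evenDeriv μ w (n / 2) 0 x s
      else _root_.evenDeriv μ v (n / 2) 0 x s
    have hψ : ∀ n, ∀ s ∈ Ico 0 R, HasDerivWithinAt (ψ n) (ψ (n + 1) s) (Ici 0) s := by
      intro n s hs
      rcases Nat.even_or_odd' n with ⟨m, rfl | rfl⟩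
      · have := (h.evenDeriv m).dy 0 x hxR s hs
        have e : (2 * m + 1) / 2 = m := by omega
        have e' : ¬ Even (2 * m + 1) := by simp
        simp only [ψ]
        simpa [e, e'] using this
      · have := (h.evenDeriv m).dyy 0 x hxR s hs
        have e : (2 * m + 1) / 2 = m := by omega
        have e' : ¬ Even (2 * m + 1) := by simp
        have e2 : (2 * m + 1 + 1) / 2 = m + 1 := by omega
        have e2' : Even (2 * m + 1 + 1) := ⟨m + 1, by ring⟩
        simp only [ψ, e, e', e2, e2', if_true, if_false]
        exact this
    have hφ : ∀ n, ∀ t ∈ Icc (0 : ℝ) 1, HasDerivWithinAt (fun t => y ^ n * ψ n (t * y))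
        (y ^ (n + 1) * ψ (n + 1) (t * y)) (Ici 0) t := by
      intro n t ht
      have h1 : HasDerivWithinAt (fun t : ℝ => t * y) y (Ici 0) t := by
        simpa using ((hasDerivAt_id t).mul_const y).hasDerivWithinAt
      have := ((hψ n (t * y) (hyR t ht)).comp t h1
        (fun s hs => mul_nonneg (mem_Ici.1 hs) hy0)).const_mul (y ^ n)
      refine this.congr_deriv ?_
      ring
    have hsum := hasSum_taylor (φ := fun n t => y ^ n * ψ n (t * y)) (M := M) (q := y * L)
      (by positivity) hy2
      (fun n t ht => ((hφ n t ht).continuousWithinAt).mono Icc_subset_Ici_self)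
      (fun n t ht => (hφ n t (Ico_subset_Icc_self ht)).mono (Ici_subset_Ici.2 ht.1)) ?_ ?_
    · rw [← Function.Injective.hasSum_iff (g := fun j : ℕ => 2 * j)
        (fun a b hab => by simpa using hab)] at hsum
      · simp only [one_mul, pow_zero] at hsum
        convert! hsum using 1
        ext j
        simp [ψ]
        ring
      · intro n hn
        have hn' : ¬ Even n := fun ⟨m, hm⟩ => hn ⟨m, by simp [hm, two_mul]⟩
        simp only [ψ, hn', if_false, zero_mul]
        rw [(h.evenDeriv (n / 2)).neumann 0 x hxR]
        simp
    · intro n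
      rcases Nat.even_or_odd' n with ⟨m, rfl | rfl⟩
      · have := hb m 0 x ⟨hx1'.1.le, hx1'.2.le⟩ 0 ⟨le_rfl, hr.le⟩
        simp only [zero_mul, ψ, even_two_mul, if_true, abs_mul, abs_pow, abs_of_nonneg hy0,
          Nat.mul_div_cancel_left m two_pos]
        simp only [zero_add, Nat.factorial_zero, Nat.cast_one, one_mul] at this
        calc _ ≤ y ^ (2 * m) * (M * L ^ (2 * m) * (2 * m).factorial) := by gcongr
          _ = _ := by rw [mul_pow]; ring
      · have e' : ¬ Even (2 * m + 1) := by simp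
        simp only [ψ, e', if_false, zero_mul]
        rw [(h.evenDeriv _).neumann 0 x hxR]
        simp only [mul_zero, abs_zero]
        positivity
    · intro m t ht
      have := hb m 0 x ⟨hx1'.1.le, hx1'.2.le⟩ (t * y) (hyt t ht)
      simp only [ψ, even_two_mul, if_true, abs_mul, abs_pow, abs_of_nonneg hy0,
          Nat.mul_div_cancel_left m two_pos]
      simp only [zero_add, Nat.factorial_zero, Nat.cast_one, one_mul] at this
      calc _ ≤ y ^ (2 * m) * (M * L ^ (2 * m) * (2 * m).factorial) := by gcongr
        _ = _ := by rw [mul_pow]; ring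
  · have hxt : ∀ t ∈ Icc (0 : ℝ) 1, t * x ∈ Icc (-r) r := fun t ht => by
      have : |t * x| ≤ r := by
        rw [abs_mul, abs_of_nonneg ht.1]
        nlinarith [ht.1, ht.2, abs_nonneg x]
      exact abs_le.1 this
    have hxtR : ∀ t ∈ Icc (0 : ℝ) 1, t * x ∈ Ioo (-R) R := fun t ht =>
      ⟨by linarith [(hxt t ht).1], by linarith [(hxt t ht).2]⟩
    have hφ : ∀ n, ∀ t ∈ Icc (0 : ℝ) 1,
        HasDerivAt (fun t => x ^ n * _root_.evenDeriv μ w j n (t * x) 0)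
        (x ^ (n + 1) * _root_.evenDeriv μ w j (n + 1) (t * x) 0) t := by
      intro n t ht
      have h1 : HasDerivAt (fun t : ℝ => t * x) x t := by
        simpa using (hasDerivAt_id t).mul_const x
      have := (((h.evenDeriv j).dx n (t * x) (hxtR t ht) 0 ⟨le_rfl, hR⟩).comp t h1).const_mul
        (x ^ n)
      refine this.congr_deriv ?_
      ring
    have hbd : ∀ n, ∀ t ∈ Icc (0 : ℝ) 1, |x ^ n * _root_.evenDeriv μ w j n (t * x) 0| ≤
        (M * L ^ (2 * j) * (2 * j).factorial) * (|x| * L) ^ n * n.factorial := by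
      intro n t ht
      have := hb j n (t * x) (hxt t ht) 0 ⟨le_rfl, hr.le⟩
      rw [abs_mul, abs_pow]
      calc _ ≤ |x| ^ n * (M * L ^ (n + 2 * j) * (n.factorial * (2 * j).factorial)) := by gcongr
        _ = _ := by rw [mul_pow, pow_add]; ring
    have hsum := hasSum_taylor
      (φ := fun n t => x ^ n * _root_.evenDeriv μ w j n (t * x) 0) (by positivity) hx2
      (fun n t ht => (hφ n t ht).continuousAt.continuousWithinAt)
      (fun n t ht => (hφ n t (Ico_subset_Icc_self ht)).hasDerivWithinAt)
      (fun n => hbd n 0 (by simp)) (fun m => hbd (2 * m))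
    have := hsum.div_const ((2 * j).factorial : ℝ)
    simp only [one_mul, zero_mul, pow_zero] at this
    convert! this using 1
    ext i
    simp only [jetCoeff]
    field_simp

end NeumannJet

/-- The rescaled composition operator `f ↦ K • (f ∘ τ)` on bounded functions on `ℕ × ℕ`. -/
def scaledComp (K : ℝ) (τ : ℕ × ℕ → ℕ × ℕ) :
    BoundedContinuousFunction (ℕ × ℕ) ℝ →L[ℝ] BoundedContinuousFunction (ℕ × ℕ) ℝ :=
  K • LinearMap.mkContinuous
    { toFun := fun f => f.compContinuous ⟨τ, continuous_of_discreteTopology⟩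
      map_add' := fun _ _ => rfl
      map_smul' := fun _ _ => rfl } 1
    fun f => by
      rw [one_mul]
      exact (BoundedContinuousFunction.norm_le (norm_nonneg f)).2 fun x => f.norm_coe_le_norm (τ x)

lemma scaledComp_pow_apply (K : ℝ) (τ : ℕ × ℕ → ℕ × ℕ) (n : ℕ)
    (f : BoundedContinuousFunction (ℕ × ℕ) ℝ) (p : ℕ × ℕ) :
    (scaledComp K τ ^ n) f p = K ^ n * f (τ^[n] p) := by
  induction n generalizing p with
  | zero => simp
  | succ n ih =>
    rw [pow_succ', Function.iterate_succ_apply]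
    change K * ((scaledComp K τ ^ n) f) (τ p) = _
    rw [ih]
    ring

lemma norm_scaledComp_le {K : ℝ} (hK : 0 ≤ K) (τ : ℕ × ℕ → ℕ × ℕ) : ‖scaledComp K τ‖ ≤ K := by
  refine ContinuousLinearMap.opNorm_le_bound _ hK fun f => ?_
  refine (BoundedContinuousFunction.norm_le (by positivity)).2 fun x => ?_
  change ‖K * f (τ x)‖ ≤ _
  rw [norm_mul, Real.norm_of_nonneg hK]
  gcongr
  exact f.norm_coe_le_norm _

lemma analyticAt_inverse_one_sub_smul {A V : Type*} [NormedRing A] [NormedAlgebra ℝ A]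
    [CompleteSpace A] [NormedAddCommGroup V] [NormedSpace ℝ V] (T : A) (g : V →L[ℝ] ℝ) :
    AnalyticAt ℝ (fun p : V => Ring.inverse (1 - g p • T)) 0 := by
  have h1 : AnalyticAt ℝ (fun p : V => 1 - g p • T) 0 :=
    analyticAt_const.sub ((g.analyticAt 0).smul analyticAt_const)
  have h2 : AnalyticAt ℝ (Ring.inverse : A → A) ((1 : Aˣ) : A) := analyticAt_inverse 1
  exact AnalyticAt.fun_comp (f := fun p : V => 1 - g p • T) (x := 0) (by simpa using h2) h1

lemma exists_analyticAt_of_resolvents {E : Type*} [NormedAddCommGroup E] [NormedSpace ℝ E]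
    [CompleteSpace E] {K : ℝ} (hK : 0 < K) {A B : E →L[ℝ] E} (hA : ‖A‖ ≤ K) (hB : ‖B‖ ≤ K)
    (e : E) (ev : E →L[ℝ] ℝ) {a : ℕ → ℕ → ℝ} (ha : ∀ i j, ev ((B ^ j) ((A ^ i) e)) = a i j) :
    ∃ F : ℝ × ℝ → ℝ, ∃ C : ℝ × ℝ × ℝ → ℝ, ∃ r > 0, AnalyticAt ℝ F 0 ∧ AnalyticAt ℝ C 0 ∧
      C 0 = a 0 1 ∧
      (∀ x s, |x| < r → |s| < r → ∀ b : ℕ → ℝ, (∀ j, HasSum (fun i => a i j * x ^ i) (b j)) →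
        HasSum (fun j => b j * s ^ j) (F (x, s))) ∧
      ∀ x s t, |x| < r → |s| < r → |t| < r → F (x, s) - F (x, t) = (s - t) * C (x, s, t) := by
  let Λ : (E →L[ℝ] E) →L[ℝ] ℝ := ev.comp (ContinuousLinearMap.apply ℝ _ e)
  have hΛ : ∀ T, Λ T = ev (T e) := fun _ => rfl
  have hlt : ∀ T : E →L[ℝ] E, ‖T‖ ≤ K → ∀ x : ℝ, |x| < 1 / K → ‖x • T‖ < 1 := by
    intro T hT x hx
    rw [lt_div_iff₀ hK] at hx
    rw [norm_smul, Real.norm_eq_abs]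
    nlinarith [abs_nonneg x]
  refine ⟨fun p => Λ (Ring.inverse (1 - p.2 • B) * Ring.inverse (1 - p.1 • A)),
    fun p => Λ (Ring.inverse (1 - p.2.1 • B) * B * Ring.inverse (1 - p.2.2 • B) *
      Ring.inverse (1 - p.1 • A)), 1 / K, by positivity, ?_, ?_, ?_, ?_, ?_⟩
  · refine (Λ.analyticAt _).fun_comp (AnalyticAt.mul ?_ ?_)
    · exact analyticAt_inverse_one_sub_smul B (ContinuousLinearMap.snd ℝ ℝ ℝ)
    · exact analyticAt_inverse_one_sub_smul A (ContinuousLinearMap.fst ℝ ℝ ℝ)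
  · refine (Λ.analyticAt _).fun_comp (AnalyticAt.mul (AnalyticAt.mul (AnalyticAt.mul ?_
      analyticAt_const) ?_) ?_)
    · exact analyticAt_inverse_one_sub_smul B
        ((ContinuousLinearMap.fst ℝ ℝ ℝ).comp (ContinuousLinearMap.snd ℝ ℝ (ℝ × ℝ)))
    · exact analyticAt_inverse_one_sub_smul B
        ((ContinuousLinearMap.snd ℝ ℝ ℝ).comp (ContinuousLinearMap.snd ℝ ℝ (ℝ × ℝ)))
    · exact analyticAt_inverse_one_sub_smul A (ContinuousLinearMap.fst ℝ ℝ (ℝ × ℝ))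
  · simp [hΛ, ← ha]
  · intro x s hx hs b hb
    have h1 : ∀ j, ev ((B ^ j) (Ring.inverse (1 - x • A) e)) = b j := by
      intro j
      have := ((ev.comp (B ^ j)).comp (ContinuousLinearMap.apply ℝ _ e)).hasSum
        (hasSum_geom_series_inverse _ (hlt A hA x hx))
      refine this.unique ?_
      convert! hb j using 1
      ext i
      simp [smul_pow, ← ha, mul_comm]
    have := (ev.comp (ContinuousLinearMap.apply ℝ _ (Ring.inverse (1 - x • A) e))).hasSum
        (hasSum_geom_series_inverse _ (hlt B hB s hs))
    convert! this using 1
    ext j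
    simp [smul_pow, ← h1, mul_comm]
  · intro x s t hx hs ht
    have us := isUnit_one_sub_of_norm_lt_one (hlt B hB s hs)
    have ut := isUnit_one_sub_of_norm_lt_one (hlt B hB t ht)
    have h1 : Ring.inverse (1 - s • B) - Ring.inverse (1 - t • B) =
        (s - t) • (Ring.inverse (1 - s • B) * B * Ring.inverse (1 - t • B)) := by
      have e1 : (s - t) • B = (1 - t • B) - (1 - s • B) := by rw [sub_smul]; abel
      rw [← smul_mul_assoc, ← mul_smul_comm, e1, mul_sub, sub_mul, mul_assoc,
        Ring.mul_inverse_cancel _ ut, Ring.inverse_mul_cancel _ us, mul_one, one_mul]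
    simp only
    rw [← map_sub, ← sub_mul, h1, smul_mul_assoc, map_smul, smul_eq_mul]

lemma exists_analyticAt_double_sum {a : ℕ → ℕ → ℝ} {M K : ℝ} (hK : 0 < K)
    (ha : ∀ i j, |a i j| ≤ M * K ^ (i + j)) :
    ∃ F : ℝ × ℝ → ℝ, ∃ C : ℝ × ℝ × ℝ → ℝ, ∃ r > 0, AnalyticAt ℝ F 0 ∧ AnalyticAt ℝ C 0 ∧
      C 0 = a 0 1 ∧
      (∀ x s, |x| < r → |s| < r → ∀ b : ℕ → ℝ, (∀ j, HasSum (fun i => a i j * x ^ i) (b j)) →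
        HasSum (fun j => b j * s ^ j) (F (x, s))) ∧
      ∀ x s t, |x| < r → |s| < r → |t| < r → F (x, s) - F (x, t) = (s - t) * C (x, s, t) := by
  have hM : ∀ p : ℕ × ℕ, ‖a p.1 p.2 / K ^ (p.1 + p.2)‖ ≤ M := fun p => by
    rw [Real.norm_eq_abs, abs_div, abs_of_pos (by positivity : 0 < K ^ (p.1 + p.2)),
      div_le_iff₀ (by positivity)]
    exact ha _ _
  have h1 : ∀ i, (fun p : ℕ × ℕ => (p.1 + 1, p.2))^[i] = fun p => (p.1 + i, p.2) := fun i => by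
    induction i with
    | zero => rfl
    | succ i ih => rw [Function.iterate_succ', ih]; rfl
  have h2 : ∀ i, (fun p : ℕ × ℕ => (p.1, p.2 + 1))^[i] = fun p => (p.1, p.2 + i) := fun i => by
    induction i with
    | zero => rfl
    | succ i ih => rw [Function.iterate_succ', ih]; rfl
  refine exists_analyticAt_of_resolvents hK
    (norm_scaledComp_le hK.le fun p => (p.1 + 1, p.2))
    (norm_scaledComp_le hK.le fun p => (p.1, p.2 + 1))
    (BoundedContinuousFunction.ofNormedAddCommGroupDiscrete
      (fun p : ℕ × ℕ => a p.1 p.2 / K ^ (p.1 + p.2)) M hM)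
    (BoundedContinuousFunction.evalCLM ℝ (0, 0)) fun i j => ?_
  rw [BoundedContinuousFunction.evalCLM_apply, scaledComp_pow_apply, scaledComp_pow_apply, h1, h2]
  change K ^ j * (K ^ i * (a (0 + i) (0 + j) / K ^ (0 + i + (0 + j)))) = _
  simp only [zero_add, pow_add]
  field_simp
lemma exists_analyticAt_implicit {F : ℝ × ℝ → ℝ} (hF : AnalyticAt ℝ F 0) {d : ℝ}
    (hd : HasDerivAt (fun y => F (0, y)) d 0) (hd0 : d ≠ 0) :
    ∃ h : ℝ → ℝ, AnalyticAt ℝ h 0 ∧ h 0 = 0 ∧ ∀ᶠ x in 𝓝 0, F (x, h x) = F 0 := by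
  have hc : ContDiffAt ℝ ⊤ F 0 := hF.contDiffAt
  have hne : (⊤ : WithTop ℕ∞) ≠ 0 := by simp
  have h1 : HasDerivAt (fun y => F (0, y)) (fderiv ℝ F 0 (0, 1)) 0 := by
    have e : HasDerivAt (fun y : ℝ => ((0 : ℝ), y)) (0, 1) 0 :=
      (hasDerivAt_const _ _).prodMk (hasDerivAt_id _)
    exact (hF.differentiableAt.hasFDerivAt (x := ((0 : ℝ), (0 : ℝ)))).comp_hasDerivAt (0 : ℝ) e
  have hd1 : fderiv ℝ F 0 (0, 1) = d := h1.unique hd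
  have hinv : (fderiv ℝ F 0 ∘L .inr ℝ ℝ ℝ).IsInvertible := by
    refine ⟨ContinuousLinearEquiv.unitsEquivAut ℝ (Units.mk0 d hd0), ?_⟩
    ext
    simp [hd1]
  refine ⟨hc.implicitFunction hne hinv, ?_, hc.implicitFunction_apply_self hne hinv,
    hc.eventually_apply_implicitFunction hne hinv⟩
  exact ContDiffAt.analyticAt (hc.contDiffAt_implicitFunction hne hinv)

lemma NeumannJet.exists_analyticAt {R μ : ℝ} {w v : ℕ → ℝ → ℝ → ℝ} (h : NeumannJet R μ w v)
    (hR : 0 < R) : ∃ F : ℝ × ℝ → ℝ, ∃ C : ℝ × ℝ × ℝ → ℝ, ∃ r > 0,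
      AnalyticAt ℝ F 0 ∧ AnalyticAt ℝ C 0 ∧ C 0 = (-w 2 0 0 - μ * w 0 0 0) / 2 ∧
      (∀ x y, |x| < r → 0 ≤ y → y < r → w 0 x y = F (x, y ^ 2)) ∧
      ∀ x s t, |x| < r → |s| < r → |t| < r → F (x, s) - F (x, t) = (s - t) * C (x, s, t) := by
  obtain ⟨r, hr, M, hM, L, hL, hb, hs⟩ := h.exists_expansion hR
  obtain ⟨F, C, r', hr', hF, hC, hC0, hsum, hdiff⟩ :=
    exists_analyticAt_double_sum (a := jetCoeff μ w) (M := M) (K := L ^ 2) (by positivity)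
      fun i j => (hb i j).trans (by
        rw [← pow_mul]
        gcongr
        omega)
  refine ⟨F, C, min (min r r') 1, by positivity, hF, hC, ?_, fun x y hx hy0 hy => ?_,
    fun x s t hx hs ht => ?_⟩
  · rw [hC0]
    simp [jetCoeff, _root_.evenDeriv]
  · simp only [lt_min_iff] at hx hy
    obtain ⟨b, hb1, hb2⟩ := hs x y hx.1.1 hy0 hy.1.1
    have hy2 : |y ^ 2| < r' := by
      rw [abs_of_nonneg (sq_nonneg y)]
      nlinarith
    have := hsum x (y ^ 2) hx.1.2 hy2 b hb2
    simp only [← pow_mul] at this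
    exact hb1.unique this
  · simp only [lt_min_iff] at hx hs ht
    exact hdiff x s t hx.1.2 hs.1.2 ht.1.2
lemma abs_double_sum_le {a : ℕ → ℕ → ℝ} {M L : ℝ} {m : ℕ} (hM : 0 ≤ M) (hL : 0 < L)
    (ha : ∀ i j, |a i j| ≤ M * L ^ (i + 2 * j)) (h0 : ∀ i j, i + 2 * j ≤ m → a i j = 0)
    {x y S : ℝ} {b : ℕ → ℝ} (hq : L * (|x| + |y|) ≤ 1 / 2)
    (hb : ∀ j, HasSum (fun i => a i j * x ^ i) (b j))
    (hS : HasSum (fun j => b j * y ^ (2 * j)) S) :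
    |S| ≤ M * (2 * (L * (|x| + |y|))) ^ (m + 1) * 2 * (1 - 1 / 4)⁻¹ := by
  have hq0 : 0 ≤ L * (|x| + |y|) := by positivity
  generalize hqdef : L * (|x| + |y|) = q at *
  have hterm : ∀ i j, |a i j * x ^ i * y ^ (2 * j)| ≤
      M * (2 * q) ^ (m + 1) * (1 / 4) ^ j * (1 / 2) ^ i := by
    intro i j
    by_cases hij : i + 2 * j ≤ m
    · rw [h0 i j hij]
      simp only [zero_mul, abs_zero]
      positivity
    obtain ⟨n, hn⟩ := Nat.exists_eq_add_of_lt (not_le.1 hij)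
    rw [abs_mul, abs_mul, abs_pow, abs_pow]
    calc |a i j| * |x| ^ i * |y| ^ (2 * j)
        ≤ M * L ^ (i + 2 * j) * (|x| + |y|) ^ i * (|x| + |y|) ^ (2 * j) := by
          gcongr
          · exact ha i j
          · linarith [abs_nonneg y]
          · linarith [abs_nonneg x]
      _ = M * q ^ (m + 1) * q ^ n := by
          rw [mul_assoc, ← pow_add, mul_assoc, ← mul_pow, hqdef, mul_assoc, ← pow_add, hn]
          congr 2
          ring
      _ ≤ M * q ^ (m + 1) * (1 / 2) ^ n := by gcongr
      _ = M * (2 * q) ^ (m + 1) * (1 / 2) ^ (i + 2 * j) := by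
          have : i + 2 * j = (m + 1) + n := by omega
          have h2 : (2 : ℝ) ^ (m + 1) * (1 / 2) ^ (m + 1) = 1 := by rw [← mul_pow]; norm_num
          rw [this, pow_add (1 / 2 : ℝ), mul_pow]
          linear_combination -M * q ^ (m + 1) * (1 / 2) ^ n * h2
      _ = _ := by
          rw [pow_add (1 / 2 : ℝ), pow_mul (1 / 2 : ℝ)]
          norm_num
          ring
  have h1 : ∀ j, ‖b j * y ^ (2 * j)‖ ≤ M * (2 * q) ^ (m + 1) * 2 * (1 / 4) ^ j := by
    intro j
    have hs := (hb j).mul_right (y ^ (2 * j))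
    rw [← hs.tsum_eq]
    refine tsum_of_norm_bounded (g := fun i => M * (2 * q) ^ (m + 1) * (1 / 4) ^ j * (1 / 2) ^ i)
      ?_ fun i => hterm i j
    convert! hasSum_geometric_two.mul_left (M * (2 * q) ^ (m + 1) * (1 / 4) ^ j) using 1
    ring
  rw [← hS.tsum_eq, ← Real.norm_eq_abs]
  exact tsum_of_norm_bounded
    ((hasSum_geometric_of_lt_one (by norm_num) (by norm_num)).mul_left _) h1

lemma evenDeriv_eq_of_eq {μ μ' : ℝ} {w w' : ℕ → ℝ → ℝ → ℝ} {m : ℕ} {x y : ℝ}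
    (hw : ∀ k ≤ m, w k x y = w' k x y)
    (hμ : ∀ k, k + 2 ≤ m → μ * w k x y = 0) (hμ' : ∀ k, k + 2 ≤ m → μ' * w' k x y = 0)
    (j k : ℕ) (hk : k + 2 * j ≤ m) :
    evenDeriv μ w j k x y = (-1) ^ j * w (k + 2 * j) x y ∧
    evenDeriv μ' w' j k x y = (-1) ^ j * w (k + 2 * j) x y := by
  induction j generalizing k with
  | zero => simp [evenDeriv, hw k (by omega)]
  | succ j ih =>
    simp only [evenDeriv]
    obtain ⟨h1, h2⟩ := ih (k + 2) (by omega)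
    obtain ⟨h3, h4⟩ := ih k (by omega)
    rw [h1, h2, h3, h4]
    have e : k + 2 + 2 * j = k + 2 * (j + 1) := by ring
    have e1 := hμ (k + 2 * j) (by omega)
    have e2 := hμ' (k + 2 * j) (by omega)
    rw [← hw _ (by omega)] at e2
    rw [e]
    constructor
    · linear_combination -(-1) ^ j * e1
    · linear_combination -(-1) ^ j * e2

lemma NeumannJet.exists_abs_sub_le {R R' μ μ' : ℝ} {w v w' v' : ℕ → ℝ → ℝ → ℝ}
    (h : NeumannJet R μ w v) (hR : 0 < R) (h' : NeumannJet R' μ' w' v') (hR' : 0 < R') (m : ℕ)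
    (hw : ∀ k ≤ m, w k 0 0 = w' k 0 0)
    (hμ : ∀ k, k + 2 ≤ m → μ * w k 0 0 = 0) (hμ' : ∀ k, k + 2 ≤ m → μ' * w' k 0 0 = 0) :
    ∃ r > 0, ∃ K ≥ 0, ∀ x y, |x| < r → 0 ≤ y → y < r →
      |w 0 x y - w' 0 x y| ≤ K * (|x| + |y|) ^ (m + 1) := by
  obtain ⟨r₁, hr₁, M₁, hM₁, L₁, hL₁, hb₁, hs₁⟩ := h.exists_expansion hR
  obtain ⟨r₂, hr₂, M₂, hM₂, L₂, hL₂, hb₂, hs₂⟩ := h'.exists_expansion hR'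
  let L := max L₁ L₂
  have hL : 1 ≤ L := hL₁.trans (le_max_left _ _)
  have hL0 : 0 < L := by linarith
  refine ⟨min (min r₁ r₂) (1 / (4 * L)), by positivity,
    (M₁ + M₂) * (2 * L) ^ (m + 1) * 2 * (1 - 1 / 4)⁻¹, by norm_num; positivity,
    fun x y hx hy0 hy => ?_⟩
  simp only [lt_min_iff] at hx hy
  obtain ⟨b₁, h1, h2⟩ := hs₁ x y hx.1.1 hy0 hy.1.1
  obtain ⟨b₂, h3, h4⟩ := hs₂ x y hx.1.2 hy0 hy.1.2
  have := abs_double_sum_le (a := fun i j => jetCoeff μ w i j - jetCoeff μ' w' i j) (M := M₁ + M₂)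
    (L := L) (m := m) (x := x) (y := y) (b := fun j => b₁ j - b₂ j) (S := w 0 x y - w' 0 x y)
    (by linarith) hL0 ?_ ?_ ?_ ?_ ?_
  · refine this.trans_eq ?_
    rw [← mul_assoc, mul_pow]
    ring
  · intro i j
    calc |jetCoeff μ w i j - jetCoeff μ' w' i j| ≤ |jetCoeff μ w i j| + |jetCoeff μ' w' i j| :=
          abs_sub _ _
      _ ≤ M₁ * L₁ ^ (i + 2 * j) + M₂ * L₂ ^ (i + 2 * j) := add_le_add (hb₁ i j) (hb₂ i j)
      _ ≤ M₁ * L ^ (i + 2 * j) + M₂ * L ^ (i + 2 * j) := by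
        gcongr
        · exact le_max_left _ _
        · exact le_max_right _ _
      _ = _ := by ring
  · intro i j hij
    obtain ⟨e1, e2⟩ := evenDeriv_eq_of_eq hw hμ hμ' j i hij
    simp only [jetCoeff, e1, e2, sub_self]
  · have hx1 := hx.2
    have hy1 := hy.2
    rw [lt_div_iff₀ (by positivity)] at hx1 hy1
    rw [abs_of_nonneg hy0]
    linarith
  · intro j
    simpa only [sub_mul] using (h2 j).sub (h4 j)
  · simpa only [sub_mul] using h1.sub h3

lemma neumannJet_re_pow (R κ c : ℝ) (m : ℕ) :
    NeumannJet R 0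
      (fun k x y => κ * (m.descFactorial k * (((x : ℂ) + y * I) ^ (m - k)).re) +
        if k = 0 then c else 0)
      (fun k x y => -(κ * (m.descFactorial (k + 1) * (((x : ℂ) + y * I) ^ (m - (k + 1))).im))) := by
  have hx : ∀ n : ℕ, ∀ x y : ℝ, HasDerivAt (fun x : ℝ => ((x : ℂ) + y * I) ^ n)
      (n * ((x : ℂ) + y * I) ^ (n - 1)) x := by
    intro n x y
    simpa using ((Complex.ofRealCLM.hasDerivAt (x := x)).add_const ((y : ℂ) * I)).fun_pow n
  have hy : ∀ n : ℕ, ∀ x y : ℝ, HasDerivAt (fun y : ℝ => ((x : ℂ) + y * I) ^ n)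
      (n * ((x : ℂ) + y * I) ^ (n - 1) * I) y := by
    intro n x y
    simpa using (((Complex.ofRealCLM.hasDerivAt (x := y)).mul_const I).const_add (x : ℂ)).fun_pow n
  have hdf : ∀ k, (m.descFactorial (k + 1) : ℝ) = m.descFactorial k * ((m - k : ℕ) : ℝ) :=
    fun k => by rw [Nat.descFactorial_succ]; push_cast; ring
  have hsub : ∀ k, m - (k + 1) = m - k - 1 := fun k => by omega
  constructor
  · intro k
    refine Continuous.continuousOn ?_
    fun_prop
  · intro k x _ y _
    have := ((Complex.reCLM.hasFDerivAt.comp_hasDerivAt x (hx (m - k) x y)).const_mul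
      (κ * m.descFactorial k)).add_const (if k = 0 then c else 0)
    simp only [Function.comp_def, Complex.reCLM_apply, mul_assoc] at this
    refine this.congr_deriv ?_
    rw [hdf, hsub, ← Complex.ofReal_natCast, Complex.re_ofReal_mul, if_neg k.succ_ne_zero]
    ring
  · intro k x _ y _
    have := ((Complex.reCLM.hasFDerivAt.comp_hasDerivAt y (hy (m - k) x y)).const_mul
      (κ * m.descFactorial k)).add_const (if k = 0 then c else 0)
    simp only [Function.comp_def, Complex.reCLM_apply, mul_assoc] at this
    refine this.hasDerivWithinAt.congr_deriv ?_
    rw [hdf, hsub, ← Complex.ofReal_natCast, Complex.re_ofReal_mul, Complex.mul_I_re]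
    ring
  · intro k x _ y _
    have := ((Complex.imCLM.hasFDerivAt.comp_hasDerivAt y (hy (m - (k + 1)) x y)).const_mul
      (κ * m.descFactorial (k + 1))).neg
    simp only [Function.comp_def, Complex.imCLM_apply, mul_assoc] at this
    refine this.hasDerivWithinAt.congr_deriv ?_
    rw [hdf (k + 1), show m - (k + 2) = m - (k + 1) - 1 by omega, ← Complex.ofReal_natCast,
      Complex.im_ofReal_mul, Complex.mul_I_im,
      if_neg (by omega)]
    ring
  · intro k x _
    simp [← Complex.ofReal_pow]
lemma exists_continuousOn_root {g : ℝ → ℝ → ℝ} {lo hi : ℝ → ℝ} {s : Set ℝ} (hs : IsOpen s)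
    (hlo : ContinuousOn lo s) (hhi : ContinuousOn hi s) (hlt : ∀ y ∈ s, lo y < hi y)
    (hx : ∀ y ∈ s, ContinuousOn (fun x => g x y) (Icc (lo y) (hi y)))
    (hy : ∀ y ∈ s, ∀ x ∈ Ioo (lo y) (hi y), ContinuousAt (g x) y)
    (hmono : ∀ y ∈ s, StrictMonoOn (fun x => g x y) (Icc (lo y) (hi y)))
    (hneg : ∀ y ∈ s, g (lo y) y < 0) (hpos : ∀ y ∈ s, 0 < g (hi y) y) :
    ∃ X : ℝ → ℝ, ContinuousOn X s ∧ ∀ y ∈ s, X y ∈ Ioo (lo y) (hi y) ∧ g (X y) y = 0 := by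
  have hex : ∀ y, ∃ x, y ∈ s → x ∈ Ioo (lo y) (hi y) ∧ g x y = 0 := by
    intro y
    by_cases h : y ∈ s
    · obtain ⟨x, hx1, hx2⟩ := intermediate_value_Ioo (hlt y h).le (hx y h) ⟨hneg y h, hpos y h⟩
      exact ⟨x, fun _ => ⟨hx1, hx2⟩⟩
    · exact ⟨0, fun h' => absurd h' h⟩
  choose X hX using hex
  refine ⟨X, fun y₀ hy₀ => ContinuousAt.continuousWithinAt ?_, hX⟩
  obtain ⟨⟨h1, h2⟩, h3⟩ := hX y₀ hy₀
  have hs' := hs.mem_nhds hy₀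
  refine tendsto_order.2 ⟨fun a ha => ?_, fun b hb => ?_⟩
  · obtain ⟨x, hxl, hxr⟩ := exists_between (max_lt ha h1)
    obtain ⟨hxa, hxlo⟩ := max_lt_iff.1 hxl
    have hxI : x ∈ Ioo (lo y₀) (hi y₀) := ⟨hxlo, hxr.trans h2⟩
    have hg : g x y₀ < 0 := by
      rw [← h3]
      exact hmono y₀ hy₀ (Ioo_subset_Icc_self hxI) ⟨h1.le, h2.le⟩ hxr
    filter_upwards [hs', (hy y₀ hy₀ x hxI).eventually_lt_const hg,
      (hlo.continuousAt hs').eventually_lt_const hxI.1,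
      (hhi.continuousAt hs').eventually_const_lt hxI.2] with y hys hgy hl hh
    refine hxa.trans (not_le.1 fun hle => ?_)
    obtain ⟨⟨k1, k2⟩, k3⟩ := hX y hys
    have := (hmono y hys).monotoneOn ⟨k1.le, k2.le⟩ ⟨hl.le, hh.le⟩ hle
    linarith
  · obtain ⟨x, hxl, hxr⟩ := exists_between (lt_min hb h2)
    obtain ⟨hxb, hxhi⟩ := lt_min_iff.1 hxr
    have hxI : x ∈ Ioo (lo y₀) (hi y₀) := ⟨h1.trans hxl, hxhi⟩
    have hg : 0 < g x y₀ := by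
      rw [← h3]
      exact hmono y₀ hy₀ ⟨h1.le, h2.le⟩ (Ioo_subset_Icc_self hxI) hxl
    filter_upwards [hs', (hy y₀ hy₀ x hxI).eventually_const_lt hg,
      (hlo.continuousAt hs').eventually_lt_const hxI.1,
      (hhi.continuousAt hs').eventually_const_lt hxI.2] with y hys hgy hl hh
    refine (not_le.1 fun hle => ?_ : X y < x).trans hxb
    obtain ⟨⟨k1, k2⟩, k3⟩ := hX y hys
    have := (hmono y hys).monotoneOn ⟨hl.le, hh.le⟩ ⟨k1.le, k2.le⟩ hle
    linarith

/-- The level set of `W` through the origin in the upper half-plane has no points other than the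
origin near the origin. -/
def HasNoBranch (W : ℝ → ℝ → ℝ) : Prop :=
  ∃ δ > 0, ∀ x y, |x| < δ → 0 ≤ y → y < δ → (x ≠ 0 ∨ y ≠ 0) → W x y ≠ W 0 0

/-- The level set of `W` through the origin in the upper half-plane contains two curves emanating
from the origin, separated in the punctured level set by the sign of a continuous function. -/
def HasTwoBranches (W : ℝ → ℝ → ℝ) : Prop :=
  ∃ δ > 0, ∃ η > 0, ∃ σ : ℝ → ℝ → ℝ, ∃ a b a' b' : ℝ → ℝ,
    ContinuousOn (fun p : ℝ × ℝ => σ p.1 p.2) (Ioo (-δ) δ ×ˢ Ico 0 δ) ∧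
    (∀ x y, |x| < δ → 0 ≤ y → y < δ → (x ≠ 0 ∨ y ≠ 0) → W x y = W 0 0 → σ x y ≠ 0) ∧
    (ContinuousOn a (Ioo 0 η) ∧ ContinuousOn b (Ioo 0 η) ∧
      ContinuousOn a' (Ioo 0 η) ∧ ContinuousOn b' (Ioo 0 η)) ∧
    (Tendsto a (𝓝[>] 0) (𝓝 0) ∧ Tendsto b (𝓝[>] 0) (𝓝 0) ∧
      Tendsto a' (𝓝[>] 0) (𝓝 0) ∧ Tendsto b' (𝓝[>] 0) (𝓝 0)) ∧
    (∀ t ∈ Ioo 0 η, 0 ≤ b t ∧ (a t ≠ 0 ∨ b t ≠ 0) ∧ W (a t) (b t) = W 0 0 ∧ 0 < σ (a t) (b t)) ∧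
    ∀ t ∈ Ioo 0 η, 0 ≤ b' t ∧ (a' t ≠ 0 ∨ b' t ≠ 0) ∧ W (a' t) (b' t) = W 0 0 ∧
      σ (a' t) (b' t) < 0

lemma HasNoBranch.of_neg {W : ℝ → ℝ → ℝ} (h : HasNoBranch fun x y => -W x y) : HasNoBranch W := by
  obtain ⟨δ, hδ, h⟩ := h
  exact ⟨δ, hδ, fun x y hx hy hy' hne he => h x y hx hy hy' hne (congrArg Neg.neg he)⟩

lemma HasTwoBranches.of_neg {W : ℝ → ℝ → ℝ} (h : HasTwoBranches fun x y => -W x y) :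
    HasTwoBranches W := by
  simpa only [HasTwoBranches, neg_inj] using h

lemma HasIndex.exists_ncard_eq_one {carrier : Set ℂ} {u : ℂ → ℝ} (h0 : (0 : ℂ) ∉ carrier)
    (hind : HasIndex carrier u 0 0) :
    ∃ r₀ > (0 : ℝ), ∀ r, 0 < r → r < r₀ → (branchSet carrier u 0 r).ncard = 1 := by
  obtain ⟨r₀, hr₀, n, hn, he⟩ := hind
  rw [if_neg h0] at he
  have : n = 1 := by
    have : (n : ℚ) = 1 := by linarith
    exact_mod_cast this
  exact ⟨r₀, hr₀, fun r h h' => by rw [(hn r h h').2, this]⟩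

lemma mem_branchSet_of_curve {carrier : Set ℂ} {u : ℂ → ℝ} {r η : ℝ} (hη : 0 < η) {γ : ℝ → ℂ}
    (hc : ContinuousOn γ (Ioo 0 η)) (ht : Tendsto γ (𝓝[>] 0) (𝓝 0))
    (hm : ∀ t ∈ Ioo 0 η, γ t ∈ levelNear carrier u 0 r) {t : ℝ} (htη : t ∈ Ioo 0 η) :
    connectedComponentIn (levelNear carrier u 0 r) (γ t) ∈ branchSet carrier u 0 r := by
  refine ⟨⟨γ t, hm t htη, rfl⟩, ?_⟩
  have hsub : γ '' Ioo 0 η ⊆ connectedComponentIn (levelNear carrier u 0 r) (γ t) :=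
    (isPreconnected_Ioo.image γ hc).subset_connectedComponentIn (mem_image_of_mem γ htη)
      (image_subset_iff.2 hm)
  refine mem_closure_of_tendsto ht ?_
  filter_upwards [Ioo_mem_nhdsGT hη] with s hs
  exact hsub (mem_image_of_mem γ hs)

lemma dist_zero_lt_of_abs_re_of_abs_im {z : ℂ} {r : ℝ} (h1 : |z.re| < r / 2)
    (h2 : |z.im| < r / 2) : dist z 0 < r := by
  rw [dist_zero_right]
  linarith [Complex.norm_le_abs_re_add_abs_im z]

lemma HasIndex.not_hasNoBranch {carrier : Set ℂ} {u : ℂ → ℝ} {W : ℝ → ℝ → ℝ} {r : ℝ} (hr : 0 < r)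
    (h0 : (0 : ℂ) ∉ carrier) (hind : HasIndex carrier u 0 0)
    (hcl : ∀ z : ℂ, dist z 0 < r → (z ∈ closure carrier ↔ 0 ≤ z.im))
    (hW : ∀ z : ℂ, dist z 0 < r → 0 ≤ z.im → u z = W z.re z.im) : ¬ HasNoBranch W := by
  rintro ⟨δ, hδ, h⟩
  obtain ⟨r₀, hr₀, hn⟩ := hind.exists_ncard_eq_one h0
  obtain ⟨s, hs0, hs⟩ := exists_between (lt_min (lt_min hr hδ) hr₀)
  simp only [lt_min_iff] at hs
  have h00 := hW 0 (by simpa using hr) le_rfl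
  have he : levelNear carrier u 0 s = ∅ := by
    refine eq_empty_of_forall_notMem fun z ⟨hz1, hz2, hz3, hz4⟩ => ?_
    have him := (hcl z (by linarith)).1 hz1
    rw [hW z (by linarith) him, h00] at hz4
    rw [dist_zero_right] at hz2 hz3
    refine h z.re z.im (by linarith [Complex.abs_re_le_norm z]) him
      (by linarith [Complex.abs_im_le_norm z, le_abs_self z.im]) ?_ hz4
    by_contra! hz
    exact norm_pos_iff.1 hz2 (Complex.ext hz.1 hz.2)
  have := hn s hs0 hs.2
  have hb : branchSet carrier u 0 s = ∅ :=
    eq_empty_of_forall_notMem fun C ⟨⟨z, hz, _⟩, _⟩ => by simp [he] at hz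
  simp [hb] at this

lemma HasIndex.not_hasTwoBranches {carrier : Set ℂ} {u : ℂ → ℝ} {W : ℝ → ℝ → ℝ} {r : ℝ}
    (hr : 0 < r) (h0 : (0 : ℂ) ∉ carrier) (hind : HasIndex carrier u 0 0)
    (hcl : ∀ z : ℂ, dist z 0 < r → (z ∈ closure carrier ↔ 0 ≤ z.im))
    (hW : ∀ z : ℂ, dist z 0 < r → 0 ≤ z.im → u z = W z.re z.im) : ¬ HasTwoBranches W := by
  rintro ⟨δ, hδ, η, hη, σ, a, b, a', b', hσ, hσ0, ⟨ca, cb, ca', cb'⟩, ⟨ta, tb, ta', tb'⟩, h, h'⟩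
  obtain ⟨r₀, hr₀, hn⟩ := hind.exists_ncard_eq_one h0
  obtain ⟨s, hs0, hs⟩ := exists_between (lt_min (lt_min hr hδ) hr₀)
  simp only [lt_min_iff] at hs
  have h00 := hW 0 (by simpa using hr) le_rfl
  have hcurve : ∀ a b : ℝ → ℝ, ContinuousOn a (Ioo 0 η) → ContinuousOn b (Ioo 0 η) →
      Tendsto a (𝓝[>] 0) (𝓝 0) → Tendsto b (𝓝[>] 0) (𝓝 0) →
      (∀ t ∈ Ioo 0 η, 0 ≤ b t ∧ (a t ≠ 0 ∨ b t ≠ 0) ∧ W (a t) (b t) = W 0 0) →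
      ∃ t ∈ Ioo 0 η, (⟨a t, b t⟩ : ℂ) ∈ levelNear carrier u 0 s ∧
        connectedComponentIn (levelNear carrier u 0 s) ⟨a t, b t⟩ ∈ branchSet carrier u 0 s := by
    intro a b ca cb ta tb hab
    have hsm : ∀ᶠ t in 𝓝[>] (0 : ℝ), |a t| < s / 2 ∧ |b t| < s / 2 := by
      have e1 := ta.abs.eventually_lt_const (u := s / 2) (by simpa using hs0)
      have e2 := tb.abs.eventually_lt_const (u := s / 2) (by simpa using hs0)
      exact e1.and e2
    obtain ⟨η', hη', hs'⟩ := mem_nhdsGT_iff_exists_Ioo_subset.1 hsm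
    have hη0 : 0 < min η η' := lt_min hη hη'
    have hm : ∀ t ∈ Ioo 0 (min η η'), (⟨a t, b t⟩ : ℂ) ∈ levelNear carrier u 0 s := by
      intro t ht
      obtain ⟨h1, h2⟩ := hs' ⟨ht.1, ht.2.trans_le (min_le_right _ _)⟩
      obtain ⟨k1, k2, k3⟩ := hab t ⟨ht.1, ht.2.trans_le (min_le_left _ _)⟩
      have hd : dist (⟨a t, b t⟩ : ℂ) 0 < s := dist_zero_lt_of_abs_re_of_abs_im h1 h2
      refine ⟨(hcl _ (by linarith)).2 k1, dist_pos.2 fun h => ?_, hd, ?_⟩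
      · have e1 := congrArg Complex.re h
        have e2 := congrArg Complex.im h
        exact k2.elim (fun k => k e1) fun k => k e2
      · rw [hW _ (by linarith) k1, h00]
        exact k3
    refine ⟨min η η' / 2, ⟨by linarith, ?_⟩, hm _ ⟨by linarith, by linarith⟩,
      mem_branchSet_of_curve (γ := fun t => ⟨a t, b t⟩) hη0 ?_ ?_ hm ⟨by linarith, by linarith⟩⟩
    · linarith [min_le_left η η']
    · have hsub : Ioo 0 (min η η') ⊆ Ioo 0 η := Ioo_subset_Ioo_right (min_le_left _ _)
      exact Complex.equivRealProdCLM.symm.continuous.comp_continuousOn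
        ((ca.mono hsub).prodMk (cb.mono hsub))
    · have := (Complex.equivRealProdCLM.symm.continuous.tendsto ((0 : ℝ), (0 : ℝ))).comp
        (ta.prodMk_nhds tb)
      rwa [show Complex.equivRealProdCLM.symm (0, 0) = 0 from Complex.ext (by simp) (by simp)]
        at this
  obtain ⟨t, ht, hlt, hbt⟩ := hcurve a b ca cb ta tb fun t ht =>
    ⟨(h t ht).1, (h t ht).2.1, (h t ht).2.2.1⟩
  obtain ⟨t', ht', hlt', hbt'⟩ := hcurve a' b' ca' cb' ta' tb' fun t ht =>
    ⟨(h' t ht).1, (h' t ht).2.1, (h' t ht).2.2.1⟩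
  obtain ⟨S, hS⟩ := ncard_eq_one.1 (hn s hs0 hs.2)
  rw [hS, mem_singleton_iff] at hbt hbt'
  have hmem : (⟨a t, b t⟩ : ℂ) ∈ S := hbt ▸ mem_connectedComponentIn hlt
  have hmem' : (⟨a' t', b' t'⟩ : ℂ) ∈ S := hbt' ▸ mem_connectedComponentIn hlt'
  have hpre : IsPreconnected S := hbt ▸ isPreconnected_connectedComponentIn
  have hsub : S ⊆ levelNear carrier u 0 s := hbt ▸ connectedComponentIn_subset _ _
  have hreg : ∀ z ∈ S, |z.re| < δ ∧ 0 ≤ z.im ∧ z.im < δ := fun z hz => by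
    obtain ⟨h1, h2, h3, -⟩ := hsub hz
    have him := (hcl z (by linarith)).1 h1
    rw [dist_zero_right] at h3
    exact ⟨by linarith [Complex.abs_re_le_norm z], him,
      by linarith [Complex.abs_im_le_norm z, le_abs_self z.im]⟩
  have hcont : ContinuousOn (fun z : ℂ => σ z.re z.im) S := by
    refine hσ.comp (f := fun z : ℂ => (z.re, z.im)) (by fun_prop) fun z hz => ?_
    obtain ⟨h1, h2, h3⟩ := hreg z hz
    exact ⟨abs_lt.1 h1, h2, h3⟩
  obtain ⟨z, hz, hz0⟩ := hpre.intermediate_value hmem' hmem hcont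
    ⟨(h' t' ht').2.2.2.le, (h t ht).2.2.2.le⟩
  obtain ⟨h1, h2, h3⟩ := hreg z hz
  obtain ⟨-, k2, k3, k4⟩ := hsub hz
  rw [hW z (by linarith) h2, h00] at k4
  refine hσ0 z.re z.im h1 h2 h3 ?_ k4 hz0
  by_contra! hz
  exact dist_pos.1 k2 (Complex.ext hz.1 hz.2)
namespace NeumannJet

variable {R μ : ℝ} {w v : ℕ → ℝ → ℝ → ℝ}

lemma exists_factorization (h : NeumannJet R μ w v) (hR : 0 < R)
    (hyy : -w 2 0 0 - μ * w 0 0 0 ≠ 0) :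
    ∃ C : ℝ × ℝ × ℝ → ℝ, ∃ φ : ℝ → ℝ, ∃ r > 0, AnalyticAt ℝ C 0 ∧ AnalyticAt ℝ φ 0 ∧ C 0 ≠ 0 ∧
      φ 0 = 0 ∧ ∀ x y, |x| < r → 0 ≤ y → y < r →
        w 0 x y = w 0 0 0 + C (x, y ^ 2, φ x) * (y ^ 2 - φ x) := by
  obtain ⟨F, C, r, hr, hF, hC, hC0, hwF, hdiff⟩ := h.exists_analyticAt hR
  have hC0' : C 0 ≠ 0 := by
    rw [hC0]
    exact div_ne_zero hyy two_ne_zero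
  have hder : HasDerivAt (fun s => F (0, s)) (C 0) 0 := by
    rw [hasDerivAt_iff_tendsto_slope]
    have h1 : Tendsto (fun s : ℝ => C (0, s, 0)) (𝓝[≠] 0) (𝓝 (C 0)) := by
      have : ContinuousAt (fun s : ℝ => C (0, s, 0)) 0 :=
        ContinuousAt.comp (g := C) (f := fun s : ℝ => ((0 : ℝ), s, (0 : ℝ))) hC.continuousAt
          (by fun_prop)
      exact this.tendsto.mono_left nhdsWithin_le_nhds
    refine h1.congr' ?_
    have hb : ∀ᶠ s : ℝ in 𝓝[≠] 0, |s| < r :=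
      nhdsWithin_le_nhds ((continuous_abs.tendsto 0).eventually_lt_const (by simpa using hr))
    filter_upwards [hb, self_mem_nhdsWithin] with s hs hs0
    have := hdiff 0 s 0 (by simpa using hr) hs (by simpa using hr)
    rw [slope_def_field, this, sub_zero, mul_comm, mul_div_assoc, div_self hs0, mul_one]
  obtain ⟨φ, hφ, hφ0, hFφ⟩ := exists_analyticAt_implicit hF hder hC0'
  have hsmall : ∀ᶠ x in 𝓝 (0 : ℝ), |φ x| < r :=
    hφ.continuousAt.abs.eventually_lt_const (by simpa [hφ0] using hr)
  obtain ⟨ε, hε, hball⟩ := Metric.eventually_nhds_iff.1 (hFφ.and hsmall)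
  have hF0 : F 0 = w 0 0 0 := by
    rw [hwF 0 0 (by simpa using hr) le_rfl hr]
    norm_num
    rfl
  refine ⟨C, φ, min (min ε r) 1, by positivity, hC, hφ, hC0', hφ0, fun x y hx hy0 hy => ?_⟩
  simp only [lt_min_iff] at hx hy
  obtain ⟨h1, h2⟩ := hball (y := x) (by simpa using hx.1.1)
  have hy2 : |y ^ 2| < r := by
    rw [abs_of_nonneg (sq_nonneg y)]
    nlinarith
  have := hdiff x (y ^ 2) (φ x) hx.1.2 hy2 h2
  rw [h1, hF0] at this
  rw [hwF x y hx.1.2 hy0 hy.1.2]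
  linarith

lemma exists_cusp (h : NeumannJet R μ w v) (hR : 0 < R) (hcrit : w 1 0 0 = 0)
    (hiso : ∃ ε > 0, ∀ x, x ≠ 0 → |x| < ε → w 1 x 0 ≠ 0)
    (hyy : -w 2 0 0 - μ * w 0 0 0 ≠ 0) (hno : ¬ HasNoBranch (w 0)) (htwo : ¬ HasTwoBranches (w 0)) :
    ∃ c : ℂ → ℝ, ∃ ρ : ℝ → ℝ, ∃ k : ℕ, AnalyticAt ℝ c 0 ∧ AnalyticAt ℝ ρ 0 ∧ Odd k ∧ 3 ≤ k ∧
      c 0 ≠ 0 ∧ ρ 0 ≠ 0 ∧ ∃ ε > 0, ∀ z : ℂ, |z.re| < ε → 0 ≤ z.im → z.im < ε →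
        w 0 z.re z.im = w 0 0 0 + c z * (z.im ^ 2 - z.re ^ k * ρ z.re) := by
  obtain ⟨C, φ, r, hr, hC, hφ, hC0, hφ0, hw⟩ := h.exists_factorization hR hyy
  have hd : ∀ x ∈ Ioo (-R) R, HasDerivAt (fun t => w 0 t 0) (w 1 x 0) x := fun x hx =>
    h.dx 0 x hx 0 ⟨le_rfl, hR⟩
  have hnz : ¬ ∀ᶠ x in 𝓝 0, φ x = 0 := by
    intro h0
    obtain ⟨ε, hε, hiso⟩ := hiso
    have hc : ∀ᶠ x in 𝓝 (0 : ℝ), w 0 x 0 = w 0 0 0 := by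
      filter_upwards [h0, (continuous_abs.tendsto (0 : ℝ)).eventually_lt_const (u := r)
        (by simpa using hr)] with x hx hxr
      rw [hw x 0 hxr le_rfl hr, hx]
      ring
    obtain ⟨δ, hδ, hball⟩ := Metric.eventually_nhds_iff.1 hc.eventually_nhds
    have hpos : 0 < min (min δ ε) R := by positivity
    obtain ⟨x, hx0, hx⟩ := exists_between hpos
    simp only [lt_min_iff] at hx
    refine hiso x hx0.ne' (by rw [abs_of_pos hx0]; exact hx.1.2) ?_
    have h1 := hball (y := x) (by rw [dist_zero_right, Real.norm_of_nonneg hx0.le]; exact hx.1.1)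
    exact (hd x ⟨by linarith, hx.2⟩).unique
      ((hasDerivAt_const x (w 0 0 0)).congr_of_eventuallyEq h1)
  obtain ⟨k, ρ, hρ, hρ0, hφρ⟩ := hφ.exists_eventuallyEq_pow_smul_nonzero_iff.2 hnz
  simp only [sub_zero, smul_eq_mul] at hφρ
  have e0 : ((0 : ℝ), (0 : ℝ) ^ 2, φ 0) = 0 := by
    rw [hφ0, zero_pow two_ne_zero]
    rfl
  have hk0 : k ≠ 0 := by
    rintro rfl
    have := hφρ.self_of_nhds
    rw [hφ0, pow_zero, one_mul] at this
    exact hρ0 this.symm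
  have hpair : ContinuousAt (fun p : ℝ × ℝ => C (p.1, p.2 ^ 2, φ p.1)) 0 := by
    have h1 : ContinuousAt (fun p : ℝ × ℝ => φ p.1) 0 :=
      ContinuousAt.comp (g := φ) (f := Prod.fst) hφ.continuousAt continuousAt_fst
    refine ContinuousAt.comp (g := C) (f := fun p : ℝ × ℝ => (p.1, p.2 ^ 2, φ p.1)) ?_ ?_
    · exact e0.symm ▸ hC.continuousAt
    · exact continuousAt_fst.prodMk
        ((by fun_prop : ContinuousAt (fun p : ℝ × ℝ => p.2 ^ 2) 0).prodMk
        h1)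
  have hpair0 : C ((0 : ℝ × ℝ).1, (0 : ℝ × ℝ).2 ^ 2, φ (0 : ℝ × ℝ).1) = C 0 :=
    congrArg C e0
  have hne : ∀ᶠ p : ℝ × ℝ in 𝓝 0, C (p.1, p.2 ^ 2, φ p.1) ≠ 0 :=
    hpair.eventually_ne (by rw [hpair0]; exact hC0)
  obtain ⟨δ₁, hδ₁, hball₁⟩ := Metric.eventually_nhds_iff.1 hne
  obtain ⟨δ₂, hδ₂, hball₂⟩ := Metric.eventually_nhds_iff.1 (hφρ.and hφ.eventually_continuousAt)
  have hmin : ∃ δ > 0, δ ≤ r ∧ δ ≤ δ₁ ∧ δ ≤ δ₂ := ⟨min (min r δ₁) δ₂, by positivity,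
    (min_le_left _ _).trans (min_le_left _ _), (min_le_left _ _).trans (min_le_right _ _),
    min_le_right _ _⟩
  obtain ⟨δ, hδ, hδr, hδ1, hδ2⟩ := hmin
  have hzero : ∀ x y, |x| < δ → 0 ≤ y → y < δ → (w 0 x y = w 0 0 0 ↔ y ^ 2 = φ x) := by
    intro x y hx hy0 hy
    rw [hw x y (by linarith) hy0 (by linarith)]
    have h1 := hball₁ (y := (x, y)) (by
      rw [dist_zero_right, Prod.norm_def, Real.norm_eq_abs, Real.norm_of_nonneg hy0]
      exact max_lt (by linarith) (by linarith))
    simp only [add_eq_left, mul_eq_zero, h1, false_or, sub_eq_zero]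
  rcases Nat.even_or_odd k with hk | hk
  · exfalso
    rcases hρ0.lt_or_gt with hneg | hpos
    · obtain ⟨δ₃, hδ₃, hball₃⟩ := Metric.eventually_nhds_iff.1
        (hρ.continuousAt.eventually_lt_const hneg)
      refine hno ⟨min δ δ₃, by positivity, fun x y hx hy0 hy hxy he => ?_⟩
      simp only [lt_min_iff] at hx hy
      rw [hzero x y hx.1 hy0 hy.1, (hball₂ (y := x) (by simpa using hx.1.trans_le hδ2)).1] at he
      have h3 := hball₃ (y := x) (by simpa using hx.2)
      have hxk : 0 ≤ x ^ k := hk.pow_nonneg x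
      have hx0 : x = 0 := by
        by_contra hx0
        nlinarith [hk.pow_pos hx0, sq_nonneg y]
      rw [hx0, zero_pow hk0, zero_mul] at he
      exact hxy.elim (fun k => k hx0) fun k => k (pow_eq_zero_iff two_ne_zero |>.1 he)
    · obtain ⟨δ₃, hδ₃, hball₃⟩ := Metric.eventually_nhds_iff.1
        (hρ.continuousAt.eventually_const_lt hpos)
      obtain ⟨δ₄, hδ₄, hball₄⟩ := Metric.eventually_nhds_iff.1
        (hφ.continuousAt.eventually_lt_const (u := δ ^ 2) (by rw [hφ0]; positivity))
      have hη : 0 < min (min δ δ₃) δ₄ := by positivity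
      have hφpos : ∀ x, x ≠ 0 → |x| < min (min δ δ₃) δ₄ → 0 < φ x ∧ φ x < δ ^ 2 ∧
          ContinuousAt φ x := by
        intro x hx0 hx
        simp only [lt_min_iff] at hx
        obtain ⟨h1, h2⟩ := hball₂ (y := x) (by simpa using hx.1.1.trans_le hδ2)
        refine ⟨?_, hball₄ (by simpa using hx.2), h2⟩
        rw [h1]
        exact mul_pos (hk.pow_pos hx0) (hball₃ (by simpa using hx.1.2))
      have hroot : ∀ x, x ≠ 0 → |x| < min (min δ δ₃) δ₄ → w 0 x (√(φ x)) = w 0 0 0 := by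
        intro x hx0 hx
        obtain ⟨h1, h2, -⟩ := hφpos x hx0 hx
        rw [hzero x _ (hx.trans_le ((min_le_left _ _).trans (min_le_left _ _))) (Real.sqrt_nonneg _)
          (by rw [← Real.sqrt_sq hδ.le]; exact Real.sqrt_lt_sqrt h1.le h2), Real.sq_sqrt h1.le]
      have habs : ∀ t ∈ Ioo 0 (min (min δ δ₃) δ₄), t ≠ 0 ∧ |t| < min (min δ δ₃) δ₄ ∧ -t ≠ 0 ∧
          |-t| < min (min δ δ₃) δ₄ := fun t ht => by
        rw [abs_neg, abs_of_pos ht.1]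
        exact ⟨ht.1.ne', ht.2, neg_ne_zero.2 ht.1.ne', ht.2⟩
      have hlim : Tendsto (fun t => √(φ t)) (𝓝 0) (𝓝 0) := by
        have := (Real.continuous_sqrt.tendsto (φ 0)).comp hφ.continuousAt.tendsto
        simpa [Function.comp_def, hφ0] using this
      refine htwo ⟨δ, hδ, _, hη, fun x _ => x, fun t => t, fun t => √(φ t), fun t => -t,
        fun t => √(φ (-t)), by fun_prop, ?_, ⟨by fun_prop, ?_, by fun_prop, ?_⟩, ⟨?_, ?_, ?_, ?_⟩,
        ?_, ?_⟩
      · rintro x y hx hy0 hy hxy he rfl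
        rw [hzero 0 y hx hy0 hy, hφ0, pow_eq_zero_iff two_ne_zero] at he
        exact hxy.elim (fun k => k rfl) fun k => k he
      · intro t ht
        obtain ⟨h1, h2, -, -⟩ := habs t ht
        exact (hφpos t h1 h2).2.2.sqrt.continuousWithinAt
      · intro t ht
        obtain ⟨-, -, h1, h2⟩ := habs t ht
        exact (ContinuousAt.comp (f := fun t => -t) (g := φ) (hφpos _ h1 h2).2.2
          continuousAt_neg).sqrt.continuousWithinAt
      · exact tendsto_id.mono_left nhdsWithin_le_nhds
      · exact hlim.mono_left nhdsWithin_le_nhds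
      · have : Tendsto (fun t : ℝ => -t) (𝓝 0) (𝓝 0) := by
          simpa using (continuous_neg.tendsto (0 : ℝ))
        exact this.mono_left nhdsWithin_le_nhds
      · have : Tendsto (fun t : ℝ => -t) (𝓝 0) (𝓝 0) := by
          simpa using (continuous_neg.tendsto (0 : ℝ))
        exact (hlim.comp this).mono_left nhdsWithin_le_nhds
      · intro t ht
        obtain ⟨h1, h2, -, -⟩ := habs t ht
        exact ⟨Real.sqrt_nonneg _, Or.inl h1, hroot t h1 h2, ht.1⟩
      · intro t ht
        obtain ⟨-, -, h1, h2⟩ := habs t ht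
        exact ⟨Real.sqrt_nonneg _, Or.inl h1, hroot _ h1 h2, neg_lt_zero.2 ht.1⟩
  · have hk1 : k ≠ 1 := by
      rintro rfl
      have h1 := hasDerivAt_iff_tendsto_slope.1 (hd 0 ⟨by linarith, hR⟩)
      have h2 : Tendsto (fun x : ℝ => -(C (x, 0 ^ 2, φ x) * ρ x)) (𝓝[≠] 0) (𝓝 (-(C 0 * ρ 0))) := by
        have e : ContinuousAt (fun x : ℝ => C (x, 0 ^ 2, φ x)) 0 :=
          ContinuousAt.comp (g := fun p : ℝ × ℝ => C (p.1, p.2 ^ 2, φ p.1))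
            (f := fun x : ℝ => (x, (0 : ℝ))) hpair (by fun_prop)
        have := (e.mul hρ.continuousAt).neg.tendsto
        simp only [Pi.neg_apply, Pi.mul_apply, e0] at this
        exact this.mono_left nhdsWithin_le_nhds
      have h3 : Tendsto (fun x : ℝ => -(C (x, 0 ^ 2, φ x) * ρ x)) (𝓝[≠] 0) (𝓝 (w 1 0 0)) := by
        refine h1.congr' ?_
        have hb : ∀ᶠ s : ℝ in 𝓝[≠] 0, |s| < r :=
          nhdsWithin_le_nhds ((continuous_abs.tendsto 0).eventually_lt_const (by simpa using hr))
        filter_upwards [hb, nhdsWithin_le_nhds hφρ, self_mem_nhdsWithin] with x hx hx' hx0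
        have hx0' : x ≠ 0 := hx0
        rw [slope_def_field, hw x 0 hx le_rfl hr]
        have e : (0 : ℝ) ^ 2 - φ x = -(x * ρ x) := by rw [hx']; ring
        rw [e]
        field_simp
        ring
      have := tendsto_nhds_unique h2 h3
      rw [hcrit, neg_eq_zero] at this
      exact mul_ne_zero hC0 hρ0 this
    have hk3 : 3 ≤ k := by
      obtain ⟨m, hm⟩ := hk
      omega
    refine ⟨fun z => C (z.re, z.im ^ 2, φ z.re), ρ, k, ?_, hρ, hk, hk3, ?_, hρ0, δ, hδ, ?_⟩
    · have hre : AnalyticAt ℝ (fun z : ℂ => z.re) 0 := Complex.reCLM.analyticAt 0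
      have him : AnalyticAt ℝ (fun z : ℂ => z.im) 0 := Complex.imCLM.analyticAt 0
      have hφre : AnalyticAt ℝ (fun z : ℂ => φ z.re) 0 :=
        AnalyticAt.fun_comp (g := φ) (f := fun z : ℂ => z.re) (by simpa using hφ) hre
      refine AnalyticAt.fun_comp (g := C) (f := fun z : ℂ => (z.re, z.im ^ 2, φ z.re)) ?_
        (hre.prod ((him.pow 2).prod hφre))
      exact e0.symm ▸ hC
    · exact (congrArg C e0).trans_ne hC0
    · intro z hz1 hz2 hz3
      rw [hw z.re z.im (by linarith) hz2 (by linarith)]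
      have := (hball₂ (y := z.re) (by simpa using hz1.trans_le hδ2)).1
      rw [← this]

end NeumannJet
lemma AnalyticAt.eventually_nhdsGT_sign {φ : ℝ → ℝ} (h : AnalyticAt ℝ φ 0) :
    (∀ᶠ t in 𝓝[>] 0, φ t = 0) ∨ (∀ᶠ t in 𝓝[>] 0, 0 < φ t) ∨ ∀ᶠ t in 𝓝[>] 0, φ t < 0 := by
  by_cases h0 : ∀ᶠ t in 𝓝 0, φ t = 0
  · exact Or.inl (nhdsWithin_le_nhds h0)
  right
  obtain ⟨n, ρ, hρ, hρ0, hφ⟩ := h.exists_eventuallyEq_pow_smul_nonzero_iff.2 h0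
  simp only [sub_zero, smul_eq_mul] at hφ
  rcases hρ0.lt_or_gt with hneg | hpos
  · right
    filter_upwards [nhdsWithin_le_nhds hφ, self_mem_nhdsWithin,
      nhdsWithin_le_nhds (hρ.continuousAt.eventually_lt_const hneg)] with t h1 h2 h3
    rw [h1]
    exact mul_neg_of_pos_of_neg (pow_pos h2 n) h3
  · left
    filter_upwards [nhdsWithin_le_nhds hφ, self_mem_nhdsWithin,
      nhdsWithin_le_nhds (hρ.continuousAt.eventually_const_lt hpos)] with t h1 h2 h3
    rw [h1]
    exact mul_pos (pow_pos h2 n) h3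

lemma exists_root_curve {W : ℝ → ℝ → ℝ} {lo : ℝ → ℝ} {c η : ℝ} (hc : 0 < c) (hη : 0 < η)
    (hlo : ContinuousOn lo (Ioo 0 η)) (hlo0 : Tendsto lo (𝓝[>] 0) (𝓝 0))
    (hloc : ∀ y ∈ Ioo 0 η, |lo y| < c)
    (hcont : ContinuousOn (fun p : ℝ × ℝ => W p.1 p.2) (Icc (-c) c ×ˢ Ico 0 η))
    (hmono : ∀ y ∈ Ioo 0 η, StrictMonoOn (fun x => W x y) (Icc (lo y) c))
    (hneg : ∀ y ∈ Ioo 0 η, W (lo y) y < W 0 0) (hpos : ∀ x ∈ Ioc 0 c, W 0 0 < W x 0) :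
    ∃ X : ℝ → ℝ, ∃ η' > 0, η' ≤ η ∧ ContinuousOn X (Ioo 0 η') ∧ Tendsto X (𝓝[>] 0) (𝓝 0) ∧
      ∀ y ∈ Ioo 0 η', lo y < X y ∧ X y < c ∧ W (X y) y = W 0 0 := by
  have hev : ∀ x ∈ Ioc 0 c, ∀ᶠ y in 𝓝[>] 0, W 0 0 < W x y := by
    intro x hx
    have h1 : ContinuousWithinAt (fun y => W x y) (Ico 0 η) 0 :=
      (hcont.comp (f := fun y : ℝ => (x, y)) (by fun_prop)
        fun y hy => ⟨⟨by linarith [hx.1], hx.2⟩, hy⟩) 0 ⟨le_rfl, hη⟩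
    have h2 := (h1.mono Ioo_subset_Ico_self).eventually_const_lt (hpos x hx)
    rwa [nhdsWithin_Ioo_eq_nhdsGT hη] at h2
  obtain ⟨η₁, hη₁, hsub⟩ := mem_nhdsGT_iff_exists_Ioo_subset.1 (hev c ⟨hc, le_rfl⟩)
  have hη' : 0 < min η η₁ := lt_min hη hη₁
  have hIoo : Ioo 0 (min η η₁) ⊆ Ioo 0 η := Ioo_subset_Ioo_right (min_le_left _ _)
  obtain ⟨X, hX, hX'⟩ := exists_continuousOn_root (g := fun x y => W x y - W 0 0) (lo := lo)
    (hi := fun _ => c) (s := Ioo 0 (min η η₁)) isOpen_Ioo (hlo.mono hIoo) continuousOn_const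
    (fun y hy => (abs_lt.1 (hloc y (hIoo hy))).2)
    (fun y hy => by
      refine ContinuousOn.sub ?_ continuousOn_const
      exact hcont.comp (f := fun x : ℝ => (x, y)) (by fun_prop) fun x hx =>
        ⟨⟨(abs_lt.1 (hloc y (hIoo hy))).1.le.trans hx.1, hx.2⟩, (hIoo hy).1.le, (hIoo hy).2⟩)
    (fun y hy x hx => by
      have hn : Icc (-c) c ×ˢ Ico 0 η ∈ 𝓝 (x, y) := prod_mem_nhds
        (Icc_mem_nhds ((abs_lt.1 (hloc y (hIoo hy))).1.trans hx.1) hx.2)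
        (Ico_mem_nhds (hIoo hy).1 (hIoo hy).2)
      exact (ContinuousAt.comp (g := fun p : ℝ × ℝ => W p.1 p.2) (f := fun y => (x, y))
        (hcont.continuousAt hn) (by fun_prop)).sub continuousAt_const)
    (fun y hy a ha b hb hab => sub_lt_sub_right (hmono y (hIoo hy) ha hb hab) _)
    (fun y hy => sub_neg.2 (hneg y (hIoo hy)))
    (fun y hy => sub_pos.2 (hsub ⟨hy.1, hy.2.trans_le (min_le_right _ _)⟩))
  refine ⟨X, _, hη', min_le_left _ _, hX, tendsto_order.2 ⟨fun a ha => ?_, fun b hb => ?_⟩,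
    fun y hy => ⟨(hX' y hy).1.1, (hX' y hy).1.2, sub_eq_zero.1 (hX' y hy).2⟩⟩
  · filter_upwards [hlo0.eventually_const_lt ha, Ioo_mem_nhdsGT hη'] with y h1 h2
    exact h1.trans (hX' y h2).1.1
  · have hbc : 0 < min b c := lt_min hb hc
    filter_upwards [hlo0.eventually_lt_const hbc, Ioo_mem_nhdsGT hη',
      hev _ ⟨hbc, min_le_right b c⟩] with y h1 h2 h3
    refine (not_le.1 fun hle => ?_ : X y < min b c).trans_le (min_le_left _ _)
    have := (hmono y (hIoo h2)).monotoneOn ⟨h1.le, min_le_right _ _⟩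
      ⟨(hX' y h2).1.1.le, (hX' y h2).1.2.le⟩ hle
    have h4 := (hX' y h2).2
    linarith

namespace NeumannJet

variable {R μ : ℝ} {w v : ℕ → ℝ → ℝ → ℝ}

lemma exists_valley (h : NeumannJet R μ w v) (hR : 0 < R) (hcrit : w 1 0 0 = 0)
    (hxx : 0 < w 2 0 0) :
    ∃ ψ Φ : ℝ → ℝ, ∃ c > 0, ∃ η > 0, AnalyticAt ℝ Φ 0 ∧ ContinuousOn ψ (Ioo (-η) η) ∧ ψ 0 = 0 ∧
      c < R ∧ η ≤ R ∧ ∀ y ∈ Ico 0 η, |ψ y| < c ∧ w 1 (ψ y) y = 0 ∧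
        w 0 (ψ y) y = w 0 0 0 + Φ (y ^ 2) ∧ StrictMonoOn (fun x => w 0 x y) (Icc (ψ y) c) ∧
        StrictAntiOn (fun x => w 0 x y) (Icc (-c) (ψ y)) := by
  obtain ⟨F, -, r, hr, hF, -, -, hwF, -⟩ := h.exists_analyticAt hR
  obtain ⟨F₁, -, r₁, hr₁, hF₁, -, -, hwF₁, -⟩ := h.shift.exists_analyticAt hR
  have hG : AnalyticAt ℝ (fun p : ℝ × ℝ => F₁ (p.2, p.1)) 0 :=
    AnalyticAt.fun_comp (g := F₁) (f := fun p : ℝ × ℝ => (p.2, p.1)) hF₁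
      (analyticAt_snd.prod analyticAt_fst)
  have hder : HasDerivAt (fun x => F₁ (x, 0)) (w 2 0 0) 0 := by
    refine (h.dx 1 0 ⟨by linarith, hR⟩ 0 ⟨le_rfl, hR⟩).congr_of_eventuallyEq ?_
    filter_upwards [(continuous_abs.tendsto (0 : ℝ)).eventually_lt_const (u := r₁)
        (by simpa using hr₁)] with x hx
    simpa using (hwF₁ x 0 hx le_rfl hr₁).symm
  obtain ⟨ξ, hξ, hξ0, hFξ⟩ := exists_analyticAt_implicit hG hder hxx.ne'
  have hF₁0 : F₁ (0, 0) = 0 := by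
    have := hwF₁ 0 0 (by simpa using hr₁) le_rfl hr₁
    simpa [hcrit] using this.symm
  have hsq0 : Tendsto (fun y : ℝ => y ^ 2) (𝓝 0) (𝓝 0) := by
    simpa using ((continuous_pow 2).tendsto (0 : ℝ))
  have hpos : ∀ᶠ p : ℝ × ℝ in 𝓝[Ioo (-R) R ×ˢ Ico 0 R] (0, 0), 0 < w 2 p.1 p.2 :=
    (h.cont 2 (0, 0) ⟨⟨by simpa using hR, hR⟩, le_rfl, hR⟩).eventually_const_lt hxx
  obtain ⟨δ, hδ, hball⟩ := Metric.mem_nhdsWithin_iff.1 hpos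
  obtain ⟨c, hc0, hc⟩ := exists_between
    (show 0 < min (min δ R) (min r r₁) by positivity)
  simp only [lt_min_iff] at hc
  obtain ⟨⟨hcδ, hcR⟩, hcr, hcr₁⟩ := hc
  have hev : ∀ᶠ y in 𝓝 (0 : ℝ), ContinuousAt ξ (y ^ 2) ∧ |ξ (y ^ 2)| < c ∧
      F₁ (ξ (y ^ 2), y ^ 2) = 0 := by
    refine hsq0.eventually (p := fun s => ContinuousAt ξ s ∧ |ξ s| < c ∧ F₁ (ξ s, s) = 0) ?_
    filter_upwards [hξ.eventually_continuousAt, hFξ,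
      hξ.continuousAt.abs.eventually_lt_const (u := c) (by simpa [hξ0] using hc0)] with s h1 h2 h3
    exact ⟨h1, h3, h2.trans hF₁0⟩
  obtain ⟨η, hη, hηb⟩ := Metric.eventually_nhds_iff.1 hev
  have hη' : 0 < min η c := lt_min hη hc0
  have hηb' : ∀ y, |y| < min η c → ContinuousAt ξ (y ^ 2) ∧ |ξ (y ^ 2)| < c ∧
      F₁ (ξ (y ^ 2), y ^ 2) = 0 :=
    fun y hy => hηb (by simpa using hy.trans_le (min_le_left _ _))
  refine ⟨fun y => ξ (y ^ 2), fun s => F (ξ s, s) - w 0 0 0, c, hc0, _, hη', ?_, ?_,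
    by simpa using hξ0,
    hcR, (min_le_right _ _).trans hcR.le, fun y hy => ?_⟩
  · refine AnalyticAt.sub (AnalyticAt.fun_comp (g := F) (f := fun s => (ξ s, s)) ?_
      (hξ.prod analyticAt_id)) analyticAt_const
    rw [hξ0]
    exact hF
  · exact fun y hy => (ContinuousAt.comp (g := ξ) (f := fun y => y ^ 2) (hηb' y (abs_lt.2 hy)).1
      (by fun_prop)).continuousWithinAt
  · obtain ⟨-, h2, h3⟩ := hηb' y (by rw [abs_of_nonneg hy.1]; exact hy.2)
    have hyc : y < c := hy.2.trans_le (min_le_right _ _)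
    have hyR : y ∈ Ico 0 R := ⟨hy.1, by linarith⟩
    have hw1 : w 1 (ξ (y ^ 2)) y = 0 := by
      rw [← h3]
      exact hwF₁ _ _ (by linarith) hy.1 (by linarith)
    have hI : ∀ x, -c ≤ x → x ≤ c → x ∈ Ioo (-R) R := fun x h1 h2 => ⟨by linarith, by linarith⟩
    have hd : ∀ k x, -c ≤ x → x ≤ c → HasDerivAt (fun t => w k t y) (w (k + 1) x y) x :=
      fun k x h1 h2 => h.dx k x (hI x h1 h2) y hyR
    have hmono1 : StrictMonoOn (fun x => w 1 x y) (Icc (-c) c) := by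
      refine strictMonoOn_of_deriv_pos (convex_Icc _ _)
        (fun x hx => (hd 1 x hx.1 hx.2).continuousAt.continuousWithinAt) fun x hx => ?_
      rw [interior_Icc] at hx
      rw [(hd 1 x hx.1.le hx.2.le).deriv]
      refine hball (show ((x, y) : ℝ × ℝ) ∈ _ from ⟨?_, hI x hx.1.le hx.2.le, hyR⟩)
      rw [mem_ball_iff_norm, Prod.mk_sub_mk, Prod.norm_def, sub_zero, sub_zero, Real.norm_eq_abs,
        Real.norm_of_nonneg hy.1]
      exact max_lt ((abs_lt.2 hx).trans hcδ) (by linarith)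
    obtain ⟨h21, h22⟩ := abs_lt.1 h2
    refine ⟨h2, hw1, ?_, ?_, ?_⟩
    · rw [hwF _ _ (by linarith) hy.1 (by linarith)]
      ring
    · refine strictMonoOn_of_deriv_pos (convex_Icc _ _)
        (fun x hx => (hd 0 x (h21.le.trans hx.1) hx.2).continuousAt.continuousWithinAt)
        fun x hx => ?_
      rw [interior_Icc] at hx
      rw [(hd 0 x (h21.trans hx.1).le hx.2.le).deriv, ← hw1]
      exact hmono1 ⟨h21.le, h22.le⟩ ⟨(h21.trans hx.1).le, hx.2.le⟩ hx.1
    · refine strictAntiOn_of_deriv_neg (convex_Icc _ _)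
        (fun x hx => (hd 0 x hx.1 (hx.2.trans h22.le)).continuousAt.continuousWithinAt)
        fun x hx => ?_
      rw [interior_Icc] at hx
      rw [(hd 0 x hx.1.le (hx.2.trans h22).le).deriv, ← hw1]
      exact hmono1 ⟨hx.1.le, (hx.2.trans h22).le⟩ ⟨h21.le, h22.le⟩ hx.2

lemma hasNoBranch_or_hasTwoBranches_of_pos (h : NeumannJet R μ w v) (hR : 0 < R)
    (hcrit : w 1 0 0 = 0) (hxx : 0 < w 2 0 0)
    (hiso : ∃ ε > 0, ∀ x y, |x| < ε → 0 < y → y < ε → ¬ (w 1 x y = 0 ∧ v 0 x y = 0)) :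
    HasNoBranch (w 0) ∨ HasTwoBranches (w 0) := by
  obtain ⟨ψ, Φ, c, hc, η, hη, hΦ, hψ, hψ0, hcR, hηR, H⟩ := h.exists_valley hR hcrit hxx
  have hψc : Tendsto ψ (𝓝 0) (𝓝 0) := by
    simpa only [hψ0] using (hψ.continuousAt (Ioo_mem_nhds (neg_lt_zero.2 hη) hη)).tendsto
  have hψc' : Tendsto ψ (𝓝[>] 0) (𝓝 0) := hψc.mono_left nhdsWithin_le_nhds
  have hge : ∀ y ∈ Ico 0 η, ∀ x, |x| ≤ c → w 0 (ψ y) y ≤ w 0 x y := by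
    intro y hy x hx
    obtain ⟨h1, -, -, h4, h5⟩ := H y hy
    obtain ⟨h11, h12⟩ := abs_lt.1 h1
    obtain ⟨hx1, hx2⟩ := abs_le.1 hx
    rcases le_total (ψ y) x with hle | hle
    · exact h4.monotoneOn ⟨le_rfl, h12.le⟩ ⟨hle, hx2⟩ hle
    · exact h5.antitoneOn ⟨hx1, hle⟩ ⟨h11.le, le_rfl⟩ hle
  have haxis : ∀ x, x ≠ 0 → |x| ≤ c → w 0 0 0 < w 0 x 0 := by
    intro x hx0 hx
    obtain ⟨-, -, -, h4, h5⟩ := H 0 ⟨le_rfl, hη⟩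
    rw [hψ0] at h4 h5
    obtain ⟨hx1, hx2⟩ := abs_le.1 hx
    rcases hx0.lt_or_gt with hlt | hlt
    · exact h5 ⟨hx1, hlt.le⟩ ⟨by linarith, le_rfl⟩ hlt
    · exact h4 ⟨le_rfl, hc.le⟩ ⟨hlt.le, hx2⟩ hlt
  have hsq : Tendsto (fun y : ℝ => y ^ 2) (𝓝[>] 0) (𝓝[>] 0) := by
    refine tendsto_nhdsWithin_iff.2 ⟨?_, ?_⟩
    · have : Tendsto (fun y : ℝ => y ^ 2) (𝓝 0) (𝓝 0) := by
        simpa using ((continuous_pow 2).tendsto (0 : ℝ))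
      exact this.mono_left nhdsWithin_le_nhds
    · filter_upwards [self_mem_nhdsWithin] with y hy
      exact pow_pos (mem_Ioi.1 hy) 2
  rcases hΦ.eventually_nhdsGT_sign with h0 | h0 | h0
  · exfalso
    obtain ⟨ε, hε, hiso⟩ := hiso
    obtain ⟨η₁, hη₁, hsub⟩ := mem_nhdsGT_iff_exists_Ioo_subset.1 (hsq.eventually h0)
    have hev : ∀ᶠ y in 𝓝[>] (0 : ℝ), |ψ y| < ε ∧ y < ε := by
      refine (hψc'.abs.eventually_lt_const (by simpa using hε)).and ?_
      filter_upwards [Ioo_mem_nhdsGT hε] with y hy using hy.2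
    obtain ⟨y, hy1, hy2⟩ := (hev.and (Ioo_mem_nhdsGT
      (show (0 : ℝ) < min η η₁ from lt_min hη hη₁))).exists
    have hy3 := hy2.2
    simp only [lt_min_iff] at hy3
    obtain ⟨h1, h2, h3, -, -⟩ := H y ⟨hy2.1.le, hy3.1⟩
    refine hiso (ψ y) y hy1.1 hy2.1 hy1.2 ⟨h2, ?_⟩
    have hmin : IsLocalMin (fun t => w 0 (ψ y) t) y := by
      filter_upwards [Ioo_mem_nhds hy2.1 hy2.2] with t ht
      have ht2 := ht.2
      simp only [lt_min_iff] at ht2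
      have e1 : Φ (t ^ 2) = 0 := hsub ⟨ht.1, ht2.2⟩
      have e2 : Φ (y ^ 2) = 0 := hsub ⟨hy2.1, hy3.2⟩
      have := hge t ⟨ht.1.le, ht2.1⟩ (ψ y) h1.le
      rw [(H t ⟨ht.1.le, ht2.1⟩).2.2.1, e1] at this
      rwa [h3, e2]
    obtain ⟨h11, h12⟩ := abs_lt.1 h1
    exact hmin.hasDerivAt_eq_zero ((h.dy 0 (ψ y) ⟨by linarith, by linarith⟩ y
      ⟨hy2.1.le, by linarith⟩).hasDerivAt (Ici_mem_nhds hy2.1))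
  · left
    obtain ⟨η₁, hη₁, hsub⟩ := mem_nhdsGT_iff_exists_Ioo_subset.1 (hsq.eventually h0)
    refine ⟨min c (min η η₁), by have := hη₁.out; positivity, fun x y hx hy0 hy hxy he => ?_⟩
    simp only [lt_min_iff] at hx hy
    rcases hy0.eq_or_lt with rfl | hy0
    · have := haxis x (by simpa using hxy) hx.1.le
      linarith
    · have h1 := hge y ⟨hy0.le, hy.2.1⟩ x hx.1.le
      have h2 : 0 < Φ (y ^ 2) := hsub ⟨hy0, hy.2.2⟩
      rw [(H y ⟨hy0.le, hy.2.1⟩).2.2.1] at h1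
      linarith
  · right
    obtain ⟨η₁, hη₁, hsub⟩ := mem_nhdsGT_iff_exists_Ioo_subset.1 (hsq.eventually h0)
    have hη₂ : 0 < min η η₁ := lt_min hη hη₁
    have hlow : ∀ y ∈ Ioo 0 (min η η₁), y ∈ Ico 0 η ∧ w 0 (ψ y) y < w 0 0 0 := by
      intro y hy
      have hy2 := hy.2
      simp only [lt_min_iff] at hy2
      have h2 : Φ (y ^ 2) < 0 := hsub ⟨hy.1, hy2.2⟩
      refine ⟨⟨hy.1.le, hy2.1⟩, ?_⟩
      rw [(H y ⟨hy.1.le, hy2.1⟩).2.2.1]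
      linarith
    have hψI : ContinuousOn ψ (Ioo 0 (min η η₁)) := hψ.mono fun y hy =>
      ⟨by linarith [hy.1], hy.2.trans_le (min_le_left _ _)⟩
    have hsubR : Icc (-c) c ×ˢ Ico 0 (min η η₁) ⊆ Ioo (-R) R ×ˢ Ico 0 R :=
      prod_mono (fun x hx => ⟨by linarith [hx.1], by linarith [hx.2]⟩)
        (Ico_subset_Ico_right ((min_le_left _ _).trans hηR))
    obtain ⟨X, ηX, hηX, hηX', hXc, hX0, hX⟩ :=
      exists_root_curve (W := w 0) (lo := ψ) hc hη₂ hψI hψc'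
      (fun y hy => (H y (hlow y hy).1).1) ((h.cont 0).mono hsubR)
      (fun y hy => (H y (hlow y hy).1).2.2.2.1) (fun y hy => (hlow y hy).2)
      (fun x hx => haxis x hx.1.ne' (by rw [abs_of_pos hx.1]; exact hx.2))
    obtain ⟨Y, ηY, hηY, hηY', hYc, hY0, hY⟩ := exists_root_curve (W := fun x y => w 0 (-x) y)
      (lo := fun y => -ψ y) hc hη₂ hψI.neg (by simpa using hψc'.neg)
      (fun y hy => by rw [abs_neg]; exact (H y (hlow y hy).1).1)
      (((h.cont 0).mono hsubR).comp (f := fun p : ℝ × ℝ => (-p.1, p.2)) (by fun_prop)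
        fun p hp => ⟨⟨by simpa using hp.1.2, by simpa [neg_le] using hp.1.1⟩, hp.2⟩)
      (fun y hy a ha b hb hab => (H y (hlow y hy).1).2.2.2.2
        ⟨by linarith [hb.2], by linarith [hb.1]⟩
        ⟨by linarith [ha.2], by linarith [ha.1]⟩ (neg_lt_neg hab))
      (fun y hy => by simpa using (hlow y hy).2)
      (fun x hx => by
        rw [neg_zero]
        exact haxis (-x) (neg_ne_zero.2 hx.1.ne') (by rw [abs_neg, abs_of_pos hx.1]; exact hx.2))
    refine ⟨min η η₁, hη₂, min ηX ηY, by positivity, fun x y => x - ψ y, X, fun t => t,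
      fun t => -Y t, fun t => t, ?_, ?_, ⟨hXc.mono (Ioo_subset_Ioo_right (min_le_left _ _)),
        continuousOn_id, hYc.neg.mono (Ioo_subset_Ioo_right (min_le_right _ _)), continuousOn_id⟩,
      ⟨hX0, tendsto_id.mono_left nhdsWithin_le_nhds, by simpa using hY0.neg,
        tendsto_id.mono_left nhdsWithin_le_nhds⟩, fun t ht => ?_, fun t ht => ?_⟩
    · refine continuousOn_fst.sub (hψ.comp continuousOn_snd fun p hp => ?_)
      exact ⟨by linarith [hp.2.1], hp.2.2.trans_le (min_le_left _ _)⟩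
    · intro x y hx hy0 hy hxy he hσ
      rw [sub_eq_zero] at hσ
      rcases hy0.eq_or_lt with rfl | hy0
      · rw [hψ0] at hσ
        simp [hσ] at hxy
      · have := (hlow y ⟨hy0, hy⟩).2
        rw [← hσ] at this
        linarith
    · obtain ⟨h1, -, h3⟩ := hX t ⟨ht.1, ht.2.trans_le (min_le_left _ _)⟩
      exact ⟨ht.1.le, Or.inr ht.1.ne', h3, sub_pos.2 h1⟩
    · obtain ⟨h1, -, h3⟩ := hY t ⟨ht.1, ht.2.trans_le (min_le_right _ _)⟩
      simp only [neg_zero] at h3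
      exact ⟨ht.1.le, Or.inr ht.1.ne', h3, by linarith⟩

lemma hasNoBranch_or_hasTwoBranches (h : NeumannJet R μ w v) (hR : 0 < R)
    (hcrit : w 1 0 0 = 0) (hxx : w 2 0 0 ≠ 0)
    (hiso : ∃ ε > 0, ∀ x y, |x| < ε → 0 < y → y < ε → ¬ (w 1 x y = 0 ∧ v 0 x y = 0)) :
    HasNoBranch (w 0) ∨ HasTwoBranches (w 0) := by
  rcases hxx.lt_or_gt with hneg | hpos
  · exact (h.neg.hasNoBranch_or_hasTwoBranches_of_pos hR (by simpa using hcrit)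
      (by simpa using hneg) (by simpa using hiso)).imp HasNoBranch.of_neg HasTwoBranches.of_neg
  · exact h.hasNoBranch_or_hasTwoBranches_of_pos hR hcrit hpos hiso

end NeumannJet
lemma exists_pos_of_abs_sub_re_pow_le {G : ℝ → ℝ → ℝ} {κ r K A d : ℝ} {n : ℕ} (hr : 0 < r)
    (hK : 0 ≤ K) (hG : ∀ x y : ℝ, |x| < r → 0 ≤ y → y < r →
      |G x y - κ * (((x : ℂ) + y * I) ^ n).re| ≤ K * (|x| + |y|) ^ (n + 1))
    {s : Set ℝ} (hA : 0 ≤ A) (hs : ∀ t ∈ s, |t| ≤ A) (hd : 0 < d)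
    (hsd : ∀ t ∈ s, d ≤ κ * (((t : ℂ) + I) ^ n).re) :
    ∃ η > 0, ∀ y, 0 < y → y < η → ∀ t ∈ s, |t * y| < r ∧ y < r ∧ 0 < G (t * y) y := by
  refine ⟨min (r / (A + 1)) (d / (K * (A + 1) ^ (n + 1) + 1)), by positivity,
    fun y hy0 hy t ht => ?_⟩
  simp only [lt_min_iff] at hy
  obtain ⟨hy1, hy2⟩ := hy
  rw [lt_div_iff₀ (by positivity)] at hy1 hy2
  have htA := hs t ht
  have hyr : y < r := by nlinarith
  have hty : |t * y| < r := by
    rw [abs_mul, abs_of_pos hy0]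
    nlinarith
  refine ⟨hty, hyr, ?_⟩
  have h1 := (abs_le.1 (hG (t * y) y hty hy0.le hyr)).1
  have e1 : (((t * y : ℝ) : ℂ) + y * I) ^ n = ((y ^ n : ℝ) : ℂ) * ((t : ℂ) + I) ^ n := by
    push_cast
    rw [← mul_pow]
    ring
  have e2 : |t * y| + |y| = (|t| + 1) * y := by
    rw [abs_mul, abs_of_pos hy0]
    ring
  rw [e1, Complex.re_ofReal_mul, e2, mul_pow, pow_succ y] at h1
  have h2 := hsd t ht
  have hyn : 0 < y ^ n := pow_pos hy0 n
  have h3 : (|t| + 1) ^ (n + 1) ≤ (A + 1) ^ (n + 1) := by gcongr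
  have h4 : K * ((|t| + 1) ^ (n + 1) * (y ^ n * y)) ≤ K * (A + 1) ^ (n + 1) * y * y ^ n := by
    calc _ ≤ K * ((A + 1) ^ (n + 1) * (y ^ n * y)) := by gcongr
      _ = _ := by ring
  have h5 : y ^ n * d ≤ y ^ n * (κ * (((t : ℂ) + I) ^ n).re) := by gcongr
  nlinarith

lemma cot_add_I_pow_re {θ : ℝ} (hθ : Real.sin θ ≠ 0) (n : ℕ) :
    ((((Real.cos θ / Real.sin θ : ℝ) : ℂ) + I) ^ n).re = Real.cos (n * θ) / Real.sin θ ^ n := by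
  have hs : (Complex.sin θ) ≠ 0 := by exact_mod_cast hθ
  have e : (((Real.cos θ / Real.sin θ : ℝ) : ℂ) + I) ^ n =
      ((Real.cos (n * θ) / Real.sin θ ^ n : ℝ) : ℂ) +
        ((Real.sin (n * θ) / Real.sin θ ^ n : ℝ) : ℂ) * I := by
    push_cast
    rw [div_mul_eq_mul_div, ← add_div, ← Complex.cos_add_sin_mul_I_pow n θ, ← div_pow]
    congr 1
    field_simp
  rw [e, Complex.add_re, Complex.ofReal_re, Complex.re_ofReal_mul, Complex.I_re]
  ring

lemma cot_lt_cot {α β : ℝ} (hα : 0 < Real.sin α) (hβ : 0 < Real.sin β)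
    (hαβ : 0 < Real.sin (β - α)) : Real.cos β / Real.sin β < Real.cos α / Real.sin α := by
  rw [div_lt_div_iff₀ hβ hα]
  rw [Real.sin_sub] at hαβ
  linarith

namespace NeumannJet

variable {R μ : ℝ} {w v : ℕ → ℝ → ℝ → ℝ}

lemma exists_ne_zero (h : NeumannJet R μ w v) (hR : 0 < R)
    (hiso : ∃ ε > 0, ∀ x, x ≠ 0 → |x| < ε → w 1 x 0 ≠ 0) : ∃ k, 1 ≤ k ∧ w k 0 0 ≠ 0 := by
  by_contra! hall
  obtain ⟨ε, hε, hiso⟩ := hiso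
  obtain ⟨r, hr, -, -, -, -, -, hexp⟩ := h.shift.exists_expansion hR
  obtain ⟨x, hx0, hx⟩ := exists_between (lt_min hε hr)
  simp only [lt_min_iff] at hx
  have hxa : |x| = x := abs_of_pos hx0
  refine hiso x hx0.ne' (by linarith) ?_
  obtain ⟨b, hb, hbj⟩ := hexp x 0 (by linarith) le_rfl hr
  have hb0 : b 0 = 0 := by
    refine (hbj 0).unique ?_
    convert hasSum_zero using 2 with i
    simp [jetCoeff, _root_.evenDeriv, hall (i + 1) (by omega)]
  refine hb.unique ?_
  convert hasSum_zero using 2 with j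
  rcases j.eq_zero_or_pos with rfl | hj
  · simp [hb0]
  · simp [hj.ne']

lemma exists_leading (h : NeumannJet R μ w v) (hR : 0 < R)
    (hiso : ∃ ε > 0, ∀ x, x ≠ 0 → |x| < ε → w 1 x 0 ≠ 0) (h1 : w 1 0 0 = 0) (h2 : w 2 0 0 = 0)
    (hμ : μ * w 0 0 0 = 0) :
    ∃ m : ℕ, 3 ≤ m ∧ ∃ κ : ℝ, κ ≠ 0 ∧ ∃ r > 0, ∃ K ≥ 0, ∀ x y : ℝ, |x| < r → 0 ≤ y → y < r →
      |w 0 x y - w 0 0 0 - κ * (((x : ℂ) + y * I) ^ m).re| ≤ K * (|x| + |y|) ^ (m + 1) ∧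
      |w 1 x y - κ * m * (((x : ℂ) + y * I) ^ (m - 1)).re| ≤ K * (|x| + |y|) ^ (m - 1 + 1) := by
  have hex := h.exists_ne_zero hR hiso
  obtain ⟨hm1, hm⟩ := Nat.find_spec hex
  have hmin : ∀ k, 1 ≤ k → k < Nat.find hex → w k 0 0 = 0 := fun k hk hlt => by
    have := Nat.find_min hex hlt
    simpa [hk] using this
  generalize Nat.find hex = m at hm1 hm hmin
  have hm3 : 3 ≤ m := by
    by_contra! hlt
    interval_cases m
    · exact hm h1
    · exact hm h2
  have hfac : ((m.factorial : ℕ) : ℝ) ≠ 0 := by positivity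
  have hmodel := neumannJet_re_pow R (w m 0 0 / m.factorial) (w 0 0 0) m
  have hval : ∀ k ≤ m, w k 0 0 = w m 0 0 / m.factorial * (m.descFactorial k *
      ((((0 : ℝ) : ℂ) + (0 : ℝ) * I) ^ (m - k)).re) + if k = 0 then w 0 0 0 else 0 := by
    intro k hk
    rcases k.eq_zero_or_pos with rfl | hk0
    · simp [show m ≠ 0 by omega]
    rcases hk.eq_or_lt with rfl | hlt
    · simp only [Nat.sub_self, pow_zero, Complex.one_re, Nat.descFactorial_self, hk0.ne', if_false]
      field_simp
      ring
    · simp [hmin k hk0 hlt, hk0.ne', show m - k ≠ 0 by omega]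
  have hμk : ∀ k, k + 2 ≤ m → μ * w k 0 0 = 0 := by
    intro k hk
    rcases k.eq_zero_or_pos with rfl | hk0
    · exact hμ
    · rw [hmin k hk0 (by omega), mul_zero]
  obtain ⟨r₁, hr₁, K₁, hK₁, hb₁⟩ := h.exists_abs_sub_le hR hmodel hR m hval hμk
    fun k _ => zero_mul _
  obtain ⟨r₂, hr₂, K₂, hK₂, hb₂⟩ := h.shift.exists_abs_sub_le hR hmodel.shift hR (m - 1)
    (fun k hk => hval (k + 1) (by omega))
    (fun k hk => by rw [hmin (k + 1) (by omega) (by omega), mul_zero]) fun k _ => zero_mul _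
  refine ⟨m, hm3, w m 0 0 / m.factorial, div_ne_zero hm hfac, min r₁ r₂, lt_min hr₁ hr₂,
    max K₁ K₂, le_max_of_le_left hK₁, fun x y hx hy0 hy => ?_⟩
  simp only [lt_min_iff] at hx hy
  constructor
  · have := hb₁ x y hx.1 hy0 hy.1
    simp only [Nat.descFactorial_zero, Nat.cast_one, one_mul, Nat.sub_zero, if_true] at this
    calc _ = _ := by congr 1; ring
      _ ≤ _ := this
      _ ≤ _ := by gcongr; exact le_max_left _ _
  · have := hb₂ x y hx.2 hy0 hy.2
    simp only [zero_add, Nat.descFactorial_one, one_ne_zero, if_false, add_zero] at this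
    calc _ = _ := by congr 1; ring
      _ ≤ _ := this
      _ ≤ _ := by gcongr; exact le_max_right _ _

lemma exists_ray_curve_of_pos (h : NeumannJet R μ w v) {m : ℕ} (hm : 1 ≤ m) {κ r K : ℝ}
    (hr : 0 < r) (hrR : r ≤ R) (hK : 0 ≤ K)
    (hw : ∀ x y : ℝ, |x| < r → 0 ≤ y → y < r →
      |w 0 x y - w 0 0 0 - κ * (((x : ℂ) + y * I) ^ m).re| ≤ K * (|x| + |y|) ^ (m + 1) ∧
      |w 1 x y - κ * m * (((x : ℂ) + y * I) ^ (m - 1)).re| ≤ K * (|x| + |y|) ^ (m - 1 + 1))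
    {t₀ ε : ℝ} (hε : 0 < ε) (ht₀ : (((t₀ : ℂ) + I) ^ m).re = 0)
    (hpos : 0 < κ * (((t₀ : ℂ) + I) ^ (m - 1)).re) :
    ∃ η > 0, ∃ S : ℝ → ℝ, ContinuousOn S (Ioo 0 η) ∧
      ∀ y ∈ Ioo 0 η, |S y - t₀| < ε ∧ w 0 (S y * y) y = w 0 0 0 := by
  have hm0 : (0 : ℝ) < m := by exact_mod_cast hm
  set D := κ * m * (((t₀ : ℂ) + I) ^ (m - 1)).re with hD
  have hD0 : 0 < D := by
    have : D = m * (κ * (((t₀ : ℂ) + I) ^ (m - 1)).re) := by rw [hD]; ring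
    rw [this]
    exact mul_pos hm0 hpos
  have hcont : Continuous fun t : ℝ => κ * m * (((t : ℂ) + I) ^ (m - 1)).re := by fun_prop
  obtain ⟨ε₁, hε₁, hball⟩ := Metric.eventually_nhds_iff.1
    (hcont.continuousAt.eventually_const_lt (show D / 2 < _ from half_lt_self hD0))
  obtain ⟨e, he0, he⟩ := exists_between (lt_min hε hε₁)
  simp only [lt_min_iff] at he
  have hder : ∀ t : ℝ, HasDerivAt (fun t : ℝ => κ * (((t : ℂ) + I) ^ m).re)
      (κ * m * (((t : ℂ) + I) ^ (m - 1)).re) t := by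
    intro t
    have h1 : HasDerivAt (fun t : ℝ => ((t : ℂ) + I) ^ m) (m * ((t : ℂ) + I) ^ (m - 1)) t := by
      simpa using ((Complex.ofRealCLM.hasDerivAt (x := t)).add_const I).fun_pow m
    refine ((Complex.reCLM.hasFDerivAt.comp_hasDerivAt t h1).const_mul κ).congr_deriv ?_
    rw [Complex.reCLM_apply, ← Complex.ofReal_natCast, Complex.re_ofReal_mul, mul_assoc]
  have hnear : ∀ t ∈ Icc (t₀ - e) (t₀ + e), D / 2 ≤ κ * m * (((t : ℂ) + I) ^ (m - 1)).re := by
    intro t ht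
    refine (hball ?_).le
    rw [Real.dist_eq]
    exact (abs_le.2 ⟨by linarith [ht.1], by linarith [ht.2]⟩).trans_lt he.2
  have hmono : StrictMonoOn (fun t : ℝ => κ * (((t : ℂ) + I) ^ m).re)
      (Icc (t₀ - e) (t₀ + e)) := by
    refine strictMonoOn_of_deriv_pos (convex_Icc _ _)
      (fun t _ => (hder t).continuousAt.continuousWithinAt) fun t ht => ?_
    rw [(hder t).deriv]
    linarith [hnear t (interior_subset ht)]
  have hlo : κ * ((((t₀ - e : ℝ) : ℂ) + I) ^ m).re < 0 := by
    have := hmono (left_mem_Icc.2 (by linarith)) ⟨by linarith, by linarith⟩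
      (show t₀ - e < t₀ by linarith)
    simp only [ht₀, mul_zero] at this
    exact this
  have hhi : 0 < κ * ((((t₀ + e : ℝ) : ℂ) + I) ^ m).re := by
    have := hmono ⟨by linarith, by linarith⟩ (right_mem_Icc.2 (by linarith))
      (show t₀ < t₀ + e by linarith)
    simp only [ht₀, mul_zero] at this
    exact this
  have hA : ∀ t ∈ Icc (t₀ - e) (t₀ + e), |t| ≤ |t₀| + e := fun t ht =>
    abs_le.2 ⟨by linarith [ht.1, neg_abs_le t₀], by linarith [ht.2, le_abs_self t₀]⟩
  have hA0 : 0 ≤ |t₀| + e := by positivity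
  obtain ⟨η₁, hη₁, H₁⟩ := exists_pos_of_abs_sub_re_pow_le (G := w 1) hr hK
    (fun x y hx hy0 hy => (hw x y hx hy0 hy).2) hA0 hA (half_pos hD0) hnear
  obtain ⟨η₂, hη₂, H₂⟩ := exists_pos_of_abs_sub_re_pow_le (G := fun x y => w 0 x y - w 0 0 0) hr hK
    (fun x y hx hy0 hy => (hw x y hx hy0 hy).1) (s := {t₀ + e}) hA0
    (by rintro t rfl; exact hA _ ⟨by linarith, le_rfl⟩) hhi (by rintro t rfl; exact le_rfl)
  obtain ⟨η₃, hη₃, H₃⟩ := exists_pos_of_abs_sub_re_pow_le (G := fun x y => -(w 0 x y - w 0 0 0))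
    (κ := -κ) hr hK
    (fun x y hx hy0 hy => by
      rw [neg_mul, ← neg_sub', abs_neg]
      exact (hw x y hx hy0 hy).1) (s := {t₀ - e}) hA0
    (by rintro t rfl; exact hA _ ⟨le_rfl, by linarith⟩) (neg_pos.2 hlo)
    (by rintro t rfl; rw [neg_mul])
  obtain ⟨S, hS, hS'⟩ := exists_continuousOn_root (g := fun t y => w 0 (t * y) y - w 0 0 0)
    (lo := fun _ => t₀ - e) (hi := fun _ => t₀ + e) (s := Ioo 0 (min η₁ (min η₂ η₃))) isOpen_Ioo
    continuousOn_const continuousOn_const (fun _ _ => by linarith)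
    (fun y hy t ht => by
      simp only [mem_Ioo, lt_min_iff] at hy
      obtain ⟨k1, k2, -⟩ := H₁ y hy.1 hy.2.1 t ht
      have := (h.dx 0 (t * y) (abs_lt.1 (k1.trans_le hrR)) y ⟨hy.1.le, by linarith⟩).continuousAt
      exact ((ContinuousAt.comp (g := fun x => w 0 x y) (f := fun t => t * y) this
        (by fun_prop)).sub continuousAt_const).continuousWithinAt)
    (fun y hy t ht => by
      simp only [mem_Ioo, lt_min_iff] at hy
      obtain ⟨k1, k2, -⟩ := H₁ y hy.1 hy.2.1 t (Ioo_subset_Icc_self ht)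
      obtain ⟨k11, k12⟩ := abs_lt.1 (k1.trans_le hrR)
      have hn : Ioo (-R) R ×ˢ Ico 0 R ∈ 𝓝 (t * y, y) := prod_mem_nhds (Ioo_mem_nhds k11 k12)
        (Ico_mem_nhds hy.1 (by linarith))
      exact (ContinuousAt.comp (g := fun p : ℝ × ℝ => w 0 p.1 p.2) (f := fun y => (t * y, y))
        ((h.cont 0).continuousAt hn) (by fun_prop)).sub continuousAt_const)
    (fun y hy => by
      simp only [mem_Ioo, lt_min_iff] at hy
      have hdt : ∀ t ∈ Icc (t₀ - e) (t₀ + e),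
          HasDerivAt (fun t => w 0 (t * y) y - w 0 0 0) (w 1 (t * y) y * y) t := by
        intro t ht
        obtain ⟨k1, k2, -⟩ := H₁ y hy.1 hy.2.1 t ht
        have := h.dx 0 (t * y) (abs_lt.1 (k1.trans_le hrR)) y ⟨hy.1.le, by linarith⟩
        have h2 := this.comp t (by simpa using (hasDerivAt_id t).mul_const y)
        exact h2.sub_const _
      refine strictMonoOn_of_deriv_pos (convex_Icc _ _)
        (fun t ht => (hdt t ht).continuousAt.continuousWithinAt) fun t ht => ?_
      rw [(hdt t (interior_subset ht)).deriv]
      exact mul_pos (H₁ y hy.1 hy.2.1 t (interior_subset ht)).2.2 hy.1)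
    (fun y hy => by
      simp only [mem_Ioo, lt_min_iff] at hy
      exact neg_pos.1 (H₃ y hy.1 hy.2.2.2 _ rfl).2.2)
    (fun y hy => by
      simp only [mem_Ioo, lt_min_iff] at hy
      exact (H₂ y hy.1 hy.2.2.1 _ rfl).2.2)
  refine ⟨_, by positivity, S, hS, fun y hy => ?_⟩
  obtain ⟨⟨k1, k2⟩, k3⟩ := hS' y hy
  exact ⟨abs_lt.2 ⟨by linarith, by linarith⟩, sub_eq_zero.1 k3⟩

lemma exists_ray_curve (h : NeumannJet R μ w v) {m : ℕ} (hm : 1 ≤ m) {κ r K : ℝ}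
    (hr : 0 < r) (hrR : r ≤ R) (hK : 0 ≤ K)
    (hw : ∀ x y : ℝ, |x| < r → 0 ≤ y → y < r →
      |w 0 x y - w 0 0 0 - κ * (((x : ℂ) + y * I) ^ m).re| ≤ K * (|x| + |y|) ^ (m + 1) ∧
      |w 1 x y - κ * m * (((x : ℂ) + y * I) ^ (m - 1)).re| ≤ K * (|x| + |y|) ^ (m - 1 + 1))
    {t₀ ε : ℝ} (hε : 0 < ε) (ht₀ : (((t₀ : ℂ) + I) ^ m).re = 0)
    (hne : κ * (((t₀ : ℂ) + I) ^ (m - 1)).re ≠ 0) :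
    ∃ η > 0, ∃ S : ℝ → ℝ, ContinuousOn S (Ioo 0 η) ∧
      ∀ y ∈ Ioo 0 η, |S y - t₀| < ε ∧ w 0 (S y * y) y = w 0 0 0 := by
  rcases hne.lt_or_gt with hlt | hlt
  · obtain ⟨η, hη, S, hS, H⟩ := h.neg.exists_ray_curve_of_pos (κ := -κ) hm hr hrR hK
      (fun x y hx hy0 hy => by
        obtain ⟨k1, k2⟩ := hw x y hx hy0 hy
        constructor
        · rw [← abs_neg]
          convert k1 using 2
          ring
        · rw [← abs_neg]
          convert k2 using 2
          ring) hε ht₀ (by rw [neg_mul]; exact neg_pos.2 hlt)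
    exact ⟨η, hη, S, hS, fun y hy => ⟨(H y hy).1, neg_injective (H y hy).2⟩⟩
  · exact h.exists_ray_curve_of_pos hm hr hrR hK hw hε ht₀ hlt

lemma hasTwoBranches_of_degenerate (h : NeumannJet R μ w v) (hR : 0 < R)
    (hiso : ∃ ε > 0, ∀ x, x ≠ 0 → |x| < ε → w 1 x 0 ≠ 0) (h1 : w 1 0 0 = 0) (h2 : w 2 0 0 = 0)
    (hμ : μ * w 0 0 0 = 0) : HasTwoBranches (w 0) := by
  obtain ⟨m, hm, κ, hκ, r', hr', K, hK, hw'⟩ := h.exists_leading hR hiso h1 h2 hμ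
  obtain ⟨r, hr, hrR, hw⟩ : ∃ r > 0, r ≤ R ∧ ∀ x y : ℝ, |x| < r → 0 ≤ y → y < r →
      |w 0 x y - w 0 0 0 - κ * (((x : ℂ) + y * I) ^ m).re| ≤ K * (|x| + |y|) ^ (m + 1) ∧
      |w 1 x y - κ * m * (((x : ℂ) + y * I) ^ (m - 1)).re| ≤ K * (|x| + |y|) ^ (m - 1 + 1) :=
    ⟨min r' R, by positivity, min_le_right _ _, fun x y hx hy0 hy =>
      hw' x y (hx.trans_le (min_le_left _ _)) hy0 (hy.trans_le (min_le_left _ _))⟩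
  have hm3 : (3 : ℝ) ≤ m := by exact_mod_cast hm
  have hmpos : (0 : ℝ) < m := by linarith
  have hpi := Real.pi_pos
  set θ := Real.pi / (2 * m) with hθ
  have hmθ : m * θ = Real.pi / 2 := by rw [hθ]; field_simp
  have hθ0 : 0 < θ := by positivity
  have hθ3 : 3 * θ ≤ Real.pi / 2 := by rw [← hmθ]; gcongr
  have hs1 : 0 < Real.sin θ := Real.sin_pos_of_pos_of_lt_pi hθ0 (by linarith)
  have hs2 : 0 < Real.sin (2 * θ) := Real.sin_pos_of_pos_of_lt_pi (by linarith) (by linarith)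
  have hs3 : 0 < Real.sin (3 * θ) := Real.sin_pos_of_pos_of_lt_pi (by linarith) (by linarith)
  have hcast : ((m - 1 : ℕ) : ℝ) = m - 1 := by push_cast [show 1 ≤ m by omega]; ring
  have hlt₁ : Real.cos (2 * θ) / Real.sin (2 * θ) < Real.cos θ / Real.sin θ :=
    cot_lt_cot hs1 hs2 (by convert hs1 using 2; ring)
  have hlt₃ : Real.cos (3 * θ) / Real.sin (3 * θ) < Real.cos (2 * θ) / Real.sin (2 * θ) :=
    cot_lt_cot hs2 hs3 (by convert hs1 using 2; ring)
  have hz₁ : ((((Real.cos θ / Real.sin θ : ℝ) : ℂ) + I) ^ m).re = 0 := by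
    rw [cot_add_I_pow_re hs1.ne', hmθ, Real.cos_pi_div_two, zero_div]
  have hz₃ : ((((Real.cos (3 * θ) / Real.sin (3 * θ) : ℝ) : ℂ) + I) ^ m).re = 0 := by
    rw [cot_add_I_pow_re hs3.ne', show (m : ℝ) * (3 * θ) = Real.pi / 2 + Real.pi by linarith,
      Real.cos_add_pi, Real.cos_pi_div_two, neg_zero, zero_div]
  have hd₁ : κ * ((((Real.cos θ / Real.sin θ : ℝ) : ℂ) + I) ^ (m - 1)).re ≠ 0 := by
    rw [cot_add_I_pow_re hs1.ne', hcast, show ((m : ℝ) - 1) * θ = Real.pi / 2 - θ by linarith,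
      Real.cos_pi_div_two_sub]
    positivity
  have hd₃ : κ * ((((Real.cos (3 * θ) / Real.sin (3 * θ) : ℝ) : ℂ) + I) ^ (m - 1)).re ≠ 0 := by
    rw [cot_add_I_pow_re hs3.ne', hcast,
      show ((m : ℝ) - 1) * (3 * θ) = Real.pi / 2 - 3 * θ + Real.pi by linarith,
      Real.cos_add_pi, Real.cos_pi_div_two_sub, neg_div]
    exact mul_ne_zero hκ (neg_ne_zero.2 (by positivity))
  have hτ : κ * ((((Real.cos (2 * θ) / Real.sin (2 * θ) : ℝ) : ℂ) + I) ^ m).re ≠ 0 := by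
    rw [cot_add_I_pow_re hs2.ne', show (m : ℝ) * (2 * θ) = Real.pi by linarith, Real.cos_pi]
    exact mul_ne_zero hκ (div_ne_zero (by norm_num) (by positivity))
  set t₁ := Real.cos θ / Real.sin θ
  set τ := Real.cos (2 * θ) / Real.sin (2 * θ)
  set t₃ := Real.cos (3 * θ) / Real.sin (3 * θ)
  have hsep : ∃ η > 0, ∀ y, 0 < y → y < η → w 0 (τ * y) y ≠ w 0 0 0 := by
    rcases hτ.lt_or_gt with hlt | hlt
    · obtain ⟨η, hη, H⟩ := exists_pos_of_abs_sub_re_pow_le (G := fun x y => -(w 0 x y - w 0 0 0))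
        (κ := -κ) hr hK
        (fun x y hx hy0 hy => by
          rw [neg_mul, ← neg_sub', abs_neg]
          exact (hw x y hx hy0 hy).1) (s := {τ}) (abs_nonneg τ)
        (by rintro t rfl; exact le_rfl) (neg_pos.2 hlt) (by rintro t rfl; rw [neg_mul])
      exact ⟨η, hη, fun y hy0 hy => (sub_neg.1 (neg_pos.1 (H y hy0 hy τ rfl).2.2)).ne⟩
    · obtain ⟨η, hη, H⟩ := exists_pos_of_abs_sub_re_pow_le (G := fun x y => w 0 x y - w 0 0 0) hr hK
        (fun x y hx hy0 hy => (hw x y hx hy0 hy).1) (s := {τ}) (abs_nonneg τ)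
        (by rintro t rfl; exact le_rfl) hlt (by rintro t rfl; exact le_rfl)
      exact ⟨η, hη, fun y hy0 hy => (sub_pos.1 (H y hy0 hy τ rfl).2.2).ne'⟩
  obtain ⟨η, hη, hsep⟩ := hsep
  obtain ⟨η₁, hη₁, S₁, hS₁, H₁⟩ :=
    h.exists_ray_curve (by omega) hr hrR hK hw (sub_pos.2 hlt₁) hz₁ hd₁
  obtain ⟨η₃, hη₃, S₃, hS₃, H₃⟩ :=
    h.exists_ray_curve (by omega) hr hrR hK hw (sub_pos.2 hlt₃) hz₃ hd₃
  have hlim : ∀ (S : ℝ → ℝ) (t₀ e : ℝ), (∀ᶠ y in 𝓝[>] 0, |S y - t₀| < e) →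
      Tendsto (fun y => S y * y) (𝓝[>] 0) (𝓝 0) := by
    intro S t₀ e hb
    have h1 : Tendsto (fun y : ℝ => (|t₀| + e) * y) (𝓝[>] 0) (𝓝 0) := by
      have : Tendsto (fun y : ℝ => (|t₀| + e) * y) (𝓝 0) (𝓝 ((|t₀| + e) * 0)) :=
        (continuous_const.mul continuous_id).tendsto 0
      rw [mul_zero] at this
      exact this.mono_left nhdsWithin_le_nhds
    refine squeeze_zero_norm' ?_ h1
    filter_upwards [hb, self_mem_nhdsWithin] with y hy hy0
    rw [norm_mul, Real.norm_eq_abs, Real.norm_of_nonneg (le_of_lt hy0)]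
    refine mul_le_mul_of_nonneg_right ?_ (le_of_lt hy0)
    have := abs_add_le (S y - t₀) t₀
    rw [sub_add_cancel] at this
    linarith
  refine ⟨η, hη, min η₁ η₃, lt_min hη₁ hη₃, fun x y => x - τ * y, fun y => S₁ y * y, fun y => y,
    fun y => S₃ y * y, fun y => y, by fun_prop, ?_,
    ⟨(hS₁.mono (Ioo_subset_Ioo_right (min_le_left _ _))).mul continuousOn_id, continuousOn_id,
      (hS₃.mono (Ioo_subset_Ioo_right (min_le_right _ _))).mul continuousOn_id, continuousOn_id⟩,
    ⟨hlim S₁ t₁ (t₁ - τ) ?_, tendsto_id.mono_left nhdsWithin_le_nhds, hlim S₃ t₃ (τ - t₃) ?_,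
      tendsto_id.mono_left nhdsWithin_le_nhds⟩, fun y hy => ?_, fun y hy => ?_⟩
  · intro x y _ hy0 hy hxy he hσ
    rw [sub_eq_zero] at hσ
    rcases hy0.eq_or_lt with rfl | hy0
    · simp [hσ] at hxy
    · exact hsep y hy0 hy (hσ ▸ he)
  · filter_upwards [Ioo_mem_nhdsGT hη₁] with y hy using (H₁ y hy).1
  · filter_upwards [Ioo_mem_nhdsGT hη₃] with y hy using (H₃ y hy).1
  · obtain ⟨k1, k2⟩ := H₁ y ⟨hy.1, hy.2.trans_le (min_le_left _ _)⟩
    have := (abs_lt.1 k1).1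
    exact ⟨hy.1.le, Or.inr hy.1.ne', k2, by nlinarith [hy.1]⟩
  · obtain ⟨k1, k2⟩ := H₃ y ⟨hy.1, hy.2.trans_le (min_le_right _ _)⟩
    have := (abs_lt.1 k1).2
    exact ⟨hy.1.le, Or.inr hy.1.ne', k2, by nlinarith [hy.1]⟩

end NeumannJet
/-- The derivative of `g` within `S` in the direction `e`. -/
def dirDerivWithin (S : Set ℂ) (e : ℂ) (g : ℂ → ℝ) (z : ℂ) : ℝ := fderivWithin ℝ g S z e

section dirDerivWithin

variable {S : Set ℂ} {g : ℂ → ℝ}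

lemma ContDiffOn.dirDerivWithin (hS : UniqueDiffOn ℝ S) (hg : ContDiffOn ℝ (⊤ : ℕ∞) g S) (e : ℂ) :
    ContDiffOn ℝ (⊤ : ℕ∞) (dirDerivWithin S e g) S :=
  (hg.fderivWithin hS (m := (⊤ : ℕ∞)) (by norm_cast)).clm_apply contDiffOn_const

lemma dirDerivWithin_dirDerivWithin (hS : UniqueDiffOn ℝ S) (hg : ContDiffOn ℝ (⊤ : ℕ∞) g S)
    {z : ℂ} (hz : z ∈ S) (e e' : ℂ) :
    dirDerivWithin S e' (dirDerivWithin S e g) z =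
      fderivWithin ℝ (fderivWithin ℝ g S) S z e' e := by
  have hd : DifferentiableWithinAt ℝ (fderivWithin ℝ g S) S z :=
    (hg.fderivWithin hS (m := (⊤ : ℕ∞)) (by norm_cast)).differentiableOn (by simp) z hz
  unfold dirDerivWithin
  rw [fderivWithin_clm_apply (hS z hz) hd (differentiableWithinAt_const e)]
  simp

lemma dirDerivWithin_comm (hS : UniqueDiffOn ℝ S) (hS' : S ⊆ closure (interior S))
    (hg : ContDiffOn ℝ (⊤ : ℕ∞) g S) {z : ℂ} (hz : z ∈ S) (e e' : ℂ) :
    dirDerivWithin S e' (dirDerivWithin S e g) z =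
      dirDerivWithin S e (dirDerivWithin S e' g) z := by
  rw [dirDerivWithin_dirDerivWithin hS hg hz, dirDerivWithin_dirDerivWithin hS hg hz]
  exact (hg z hz).isSymmSndFDerivWithinAt (by
    rw [minSmoothness_of_isRCLikeNormedField]
    exact WithTop.coe_le_coe.2 (le_top : (2 : ℕ∞) ≤ ⊤)) hS (hS' hz) hz e' e

lemma dirDerivWithin_congr {f : ℂ → ℝ} (h : EqOn f g S) (e : ℂ) :
    EqOn (dirDerivWithin S e f) (dirDerivWithin S e g) S := fun z hz => by
  unfold dirDerivWithin
  rw [fderivWithin_congr h (h hz)]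

lemma laplacian_eq_of_mem_nhds (hS : UniqueDiffOn ℝ S) (hg : ContDiffOn ℝ (⊤ : ℕ∞) g S) {z : ℂ}
    (hz : S ∈ 𝓝 z) : laplacian g z = dirDerivWithin S 1 (dirDerivWithin S 1 g) z +
      dirDerivWithin S I (dirDerivWithin S I g) z := by
  have hzS := mem_of_mem_nhds hz
  have hc : ContDiffAt ℝ ((2 : ℕ) : WithTop ℕ∞) g z :=
    (hg.contDiffAt hz).of_le (by norm_cast)
  unfold laplacian
  rw [← iteratedFDerivWithin_eq_iteratedFDeriv hS hc hzS,
    iteratedFDerivWithin_two_apply g hS hzS, iteratedFDerivWithin_two_apply g hS hzS,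
    dirDerivWithin_dirDerivWithin hS hg hzS, dirDerivWithin_dirDerivWithin hS hg hzS]
  rfl

end dirDerivWithin

/-- The closed upper half of the open disk of radius `r` about the origin. -/
def halfDisk (r : ℝ) : Set ℂ := {z | 0 ≤ z.im} ∩ Metric.ball 0 r

section halfDisk

variable {r : ℝ} {g : ℂ → ℝ}

lemma mem_nhds_halfDisk {z : ℂ} (hz : 0 < z.im) (hr : dist z 0 < r) : halfDisk r ∈ 𝓝 z := by
  refine inter_mem ?_ (Metric.isOpen_ball.mem_nhds hr)
  filter_upwards [Complex.continuous_im.continuousAt.eventually_const_lt hz] with w hw using hw.le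

lemma convex_halfDisk (r : ℝ) : Convex ℝ (halfDisk r) :=
  (convex_halfSpace_im_ge 0).inter (convex_ball 0 r)

lemma nonempty_interior_halfDisk (hr : 0 < r) : (interior (halfDisk r)).Nonempty := by
  refine ⟨((r / 2 : ℝ) : ℂ) * I, mem_interior_iff_mem_nhds.2 (mem_nhds_halfDisk ?_ ?_)⟩
  · simpa using hr
  · rw [dist_zero_right, norm_mul, Complex.norm_I, mul_one, Complex.norm_real,
      Real.norm_of_nonneg (by linarith)]
    linarith

lemma uniqueDiffOn_halfDisk (hr : 0 < r) : UniqueDiffOn ℝ (halfDisk r) :=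
  uniqueDiffOn_convex (convex_halfDisk r) (nonempty_interior_halfDisk hr)

lemma halfDisk_subset_closure_interior (hr : 0 < r) :
    halfDisk r ⊆ closure (interior (halfDisk r)) := by
  rw [(convex_halfDisk r).closure_interior_eq_closure_of_nonempty_interior
    (nonempty_interior_halfDisk hr)]
  exact subset_closure

lemma pos_im_of_mem_interior_halfDisk {z : ℂ} (hz : z ∈ interior (halfDisk r)) : 0 < z.im := by
  have : z ∈ interior {z : ℂ | 0 ≤ z.im} := interior_mono inter_subset_left hz
  rwa [Complex.interior_setOfPred_le_im] at this

lemma hasDerivAt_mk_left (x y : ℝ) : HasDerivAt (fun t : ℝ => (⟨t, y⟩ : ℂ)) 1 x := by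
  have := (Complex.ofRealCLM.hasDerivAt (x := x)).add_const ((y : ℂ) * I)
  simp only [Complex.ofRealCLM_apply, ← Complex.mk_eq_add_mul_I, Complex.ofReal_one] at this
  exact this

lemma hasDerivAt_mk_right (x y : ℝ) : HasDerivAt (fun t : ℝ => (⟨x, t⟩ : ℂ)) I y := by
  have := ((Complex.ofRealCLM.hasDerivAt (x := y)).mul_const I).const_add (x : ℂ)
  simp only [Complex.ofRealCLM_apply, ← Complex.mk_eq_add_mul_I, Complex.ofReal_one,
    one_mul] at this
  exact this

lemma hasDerivAt_dirDerivWithin_one (hg : ContDiffOn ℝ (⊤ : ℕ∞) g (halfDisk r)) {x y : ℝ}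
    (hz : (⟨x, y⟩ : ℂ) ∈ halfDisk r) :
    HasDerivAt (fun t => g ⟨t, y⟩) (dirDerivWithin (halfDisk r) 1 g ⟨x, y⟩) x := by
  have h1 := (hg.differentiableOn (by simp) _ hz).hasFDerivWithinAt
  refine h1.comp_hasDerivAt x (hasDerivAt_mk_left x y) ?_
  filter_upwards [(hasDerivAt_mk_left x y).continuousAt (Metric.isOpen_ball.mem_nhds hz.2)]
    with t ht
  exact ⟨hz.1, ht⟩

lemma hasDerivWithinAt_dirDerivWithin_I (hg : ContDiffOn ℝ (⊤ : ℕ∞) g (halfDisk r)) {x y : ℝ}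
    (hz : (⟨x, y⟩ : ℂ) ∈ halfDisk r) :
    HasDerivWithinAt (fun t => g ⟨x, t⟩) (dirDerivWithin (halfDisk r) I g ⟨x, y⟩) (Ici 0) y := by
  have h1 := (hg.differentiableOn (by simp) _ hz).hasFDerivWithinAt
  have hn : (fun t : ℝ => (⟨x, t⟩ : ℂ)) ⁻¹' Metric.ball 0 r ∈ 𝓝 y :=
    (hasDerivAt_mk_right x y).continuousAt (Metric.isOpen_ball.mem_nhds hz.2)
  have h2 : HasDerivWithinAt (fun t => g ⟨x, t⟩) (dirDerivWithin (halfDisk r) I g ⟨x, y⟩)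
      (Ici 0 ∩ (fun t : ℝ => (⟨x, t⟩ : ℂ)) ⁻¹' Metric.ball 0 r) y :=
    h1.comp_hasDerivWithinAt y (hasDerivAt_mk_right x y).hasDerivWithinAt fun t ht => ⟨ht.1, ht.2⟩
  exact (hasDerivWithinAt_inter hn).1 h2

lemma NeumannJet.of_halfDisk {u : ℂ → ℝ} {μ : ℝ} (hr : 0 < r)
    (hu : ContDiffOn ℝ (⊤ : ℕ∞) u (halfDisk r))
    (heig : ∀ z, 0 < z.im → dist z 0 < r → laplacian u z = -μ * u z)
    (hneu : ∀ x : ℝ, (x : ℂ) ∈ halfDisk r → dirDerivWithin (halfDisk r) I u x = 0) :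
    NeumannJet (r / 2) μ (fun k x y => (dirDerivWithin (halfDisk r) 1)^[k] u ⟨x, y⟩)
      (fun k x y =>
        dirDerivWithin (halfDisk r) I ((dirDerivWithin (halfDisk r) 1)^[k] u) ⟨x, y⟩) := by
  set S := halfDisk r with hSdef
  have hS : UniqueDiffOn ℝ S := uniqueDiffOn_halfDisk hr
  have hS' : S ⊆ closure (interior S) := halfDisk_subset_closure_interior hr
  have hsm : ∀ k, ContDiffOn ℝ (⊤ : ℕ∞) ((dirDerivWithin S 1)^[k] u) S := by
    intro k
    induction k with
    | zero => exact hu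
    | succ k ih =>
      rw [Function.iterate_succ_apply']
      exact ih.dirDerivWithin hS 1
  have hmem : ∀ x ∈ Ioo (-(r / 2)) (r / 2), ∀ y ∈ Ico 0 (r / 2), (⟨x, y⟩ : ℂ) ∈ S := by
    intro x hx y hy
    refine ⟨hy.1, dist_zero_lt_of_abs_re_of_abs_im (abs_lt.2 hx) ?_⟩
    rw [abs_of_nonneg hy.1]
    exact hy.2
  have heq : ∀ k, EqOn (dirDerivWithin S I (dirDerivWithin S I ((dirDerivWithin S 1)^[k] u)))
      (fun z => -(dirDerivWithin S 1)^[k + 2] u z - μ * (dirDerivWithin S 1)^[k] u z) S := by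
    intro k
    induction k with
    | zero =>
      refine EqOn.of_subset_closure (s := interior S) (fun z hz => ?_)
        (((hu.dirDerivWithin hS I).dirDerivWithin hS I).continuousOn)
        ((hsm 2).continuousOn.neg.sub (continuousOn_const.mul hu.continuousOn))
        interior_subset hS'
      have h1 := laplacian_eq_of_mem_nhds hS hu (mem_interior_iff_mem_nhds.1 hz)
      rw [heig z (pos_im_of_mem_interior_halfDisk hz) (interior_subset hz).2] at h1
      simp only [Function.iterate_succ, Function.iterate_zero, Function.comp_apply, id_eq]
      linarith
    | succ k ih =>
      intro z hz
      have e1 : dirDerivWithin S I (dirDerivWithin S I ((dirDerivWithin S 1)^[k + 1] u)) z =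
          dirDerivWithin S 1
            (dirDerivWithin S I (dirDerivWithin S I ((dirDerivWithin S 1)^[k] u))) z := by
        rw [Function.iterate_succ_apply',
          dirDerivWithin_congr (fun z hz => dirDerivWithin_comm hS hS' (hsm k) hz 1 I) I hz]
        exact dirDerivWithin_comm hS hS' ((hsm k).dirDerivWithin hS I) hz 1 I
      have hd : ∀ j, DifferentiableWithinAt ℝ ((dirDerivWithin S 1)^[j] u) S z := fun j =>
        (hsm j).differentiableOn (by simp) z hz
      rw [e1, dirDerivWithin_congr ih 1 hz, Function.iterate_succ_apply' _ (k + 2),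
        Function.iterate_succ_apply' _ k]
      unfold dirDerivWithin
      have e2 := ((hd (k + 2)).hasFDerivWithinAt.neg.sub
        ((hd k).hasFDerivWithinAt.const_mul μ)).fderivWithin (hS z hz)
      have e3 := DFunLike.congr_fun e2 1
      exact e3
  have haxis : ∀ k, ∀ x : ℝ, (x : ℂ) ∈ S →
      dirDerivWithin S I ((dirDerivWithin S 1)^[k] u) x = 0 := by
    intro k
    induction k with
    | zero => exact hneu
    | succ k ih =>
      intro x hx
      rw [Function.iterate_succ_apply', dirDerivWithin_comm hS hS' (hsm k) hx 1 I]
      have h1 := hasDerivAt_dirDerivWithin_one ((hsm k).dirDerivWithin hS I) (x := x) (y := 0) hx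
      refine h1.unique ((hasDerivAt_const x (0 : ℝ)).congr_of_eventuallyEq ?_)
      filter_upwards [(hasDerivAt_mk_left x 0).continuousAt (Metric.isOpen_ball.mem_nhds hx.2)]
        with t ht
      exact ih t ⟨(Complex.ofReal_im t).ge, ht⟩
  constructor
  · intro k
    refine (hsm k).continuousOn.comp (f := fun p : ℝ × ℝ => (⟨p.1, p.2⟩ : ℂ))
      Complex.equivRealProdCLM.symm.continuous.continuousOn fun p hp => hmem _ hp.1 _ hp.2
  · intro k x hx y hy
    simp only [Function.iterate_succ_apply']
    exact hasDerivAt_dirDerivWithin_one (hsm k) (hmem x hx y hy)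
  · intro k x hx y hy
    exact hasDerivWithinAt_dirDerivWithin_I (hsm k) (hmem x hx y hy)
  · intro k x hx y hy
    refine (hasDerivWithinAt_dirDerivWithin_I ((hsm k).dirDerivWithin hS I)
      (hmem x hx y hy)).congr_deriv ?_
    exact heq k (hmem x hx y hy)
  · intro k x hx
    exact haxis k x (hmem x hx 0 ⟨le_rfl, by linarith⟩)

end halfDisk

lemma exists_mem_openSegment_of_im_eq_zero {a b : ℂ} (hab : a ≠ b)
    (hreal : segment ℝ a b ⊆ {z : ℂ | z.im = 0}) (h0 : (0 : ℂ) ∈ openSegment ℝ a b) :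
    ∃ δ > (0 : ℝ), ∀ z : ℂ, dist z 0 < δ → z.im = 0 → z ∈ openSegment ℝ a b := by
  have ha : a.im = 0 := hreal (left_mem_segment ℝ a b)
  have hb : b.im = 0 := hreal (right_mem_segment ℝ a b)
  have hd : b.re - a.re ≠ 0 := fun h => hab (Complex.ext (by linarith) (by rw [ha, hb]))
  obtain ⟨s, t, hs, ht, hst, h0⟩ := h0
  have h0re : s * a.re + t * b.re = 0 := by simpa using congrArg Complex.re h0
  refine ⟨min s t * |b.re - a.re|, by positivity, fun z hz hzi => ?_⟩
  rw [dist_zero_right] at hz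
  have hη : |z.re / (b.re - a.re)| < min s t := by
    rw [abs_div, div_lt_iff₀ (abs_pos.2 hd)]
    exact (Complex.abs_re_le_norm z).trans_lt hz
  obtain ⟨h1, h2⟩ := lt_min_iff.1 hη
  refine ⟨s - z.re / (b.re - a.re), t + z.re / (b.re - a.re), ?_, ?_, by linarith, ?_⟩
  · linarith [(abs_lt.1 h1).2]
  · linarith [(abs_lt.1 h2).1]
  · apply Complex.ext
    · simp only [Complex.add_re, Complex.real_smul, Complex.re_ofReal_mul]
      have : z.re / (b.re - a.re) * (b.re - a.re) = z.re := div_mul_cancel₀ _ hd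
      linear_combination h0re + this
    · simp only [Complex.add_im, Complex.real_smul, Complex.im_ofReal_mul, ha, hb, hzi, mul_zero,
        add_zero]

section polygon

variable {carrier : Set ℂ} {sides : Set (ℂ × ℂ)}

lemma IsPolygon.finite_polyVertices (hP : IsPolygon carrier sides) :
    (polyVertices sides).Finite := by
  have : polyVertices sides = ⋃ s ∈ sides, {s.1, s.2} := by
    ext p
    simp [polyVertices]
  rw [this]
  exact hP.sides_finite.biUnion fun s _ => toFinite _

/-- Near a relative interior point of a side on the real axis which the polygon approaches from
above, the closed polygon is a half-disk. -/
lemma IsPolygon.exists_halfDisk (hP : IsPolygon carrier sides) {e : ℂ × ℂ} (he : e ∈ sides)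
    (heReal : segment ℝ e.1 e.2 ⊆ {z : ℂ | z.im = 0}) (h0mem : (0 : ℂ) ∈ openSegment ℝ e.1 e.2)
    (h0nv : (0 : ℂ) ∉ polyVertices sides)
    (hupper : ∃ ε > (0 : ℝ), carrier ∩ Metric.ball 0 ε ⊆ {z : ℂ | 0 < z.im}) :
    ∃ r > (0 : ℝ), (∀ z, dist z 0 < r → (z ∈ closure carrier ↔ 0 ≤ z.im)) ∧
      (∀ z, dist z 0 < r → 0 < z.im → z ∈ carrier) ∧
      (∀ z, dist z 0 < r → z.im = 0 → z ∈ openSegment ℝ e.1 e.2) ∧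
      ∀ z, dist z 0 < r → z ∉ polyVertices sides := by
  obtain ⟨ε, hε, hupper⟩ := hupper
  obtain ⟨δ, hδ, haxis⟩ := exists_mem_openSegment_of_im_eq_zero (hP.nondeg e he) heReal h0mem
  have hsegclosed : IsClosed (⋃ s ∈ sides \ {e}, segment ℝ s.1 s.2) :=
    hP.sides_finite.sdiff.isClosed_biUnion fun s _ => by
      rw [← convexHull_pair]
      exact (toFinite _).isClosed_convexHull ℝ
  have h0seg : (0 : ℂ) ∉ ⋃ s ∈ sides \ {e}, segment ℝ s.1 s.2 := by
    simp only [mem_iUnion, not_exists]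
    intro s hs h0s
    rw [← insert_endpoints_openSegment] at h0s
    rcases h0s with h | h | h
    · exact h0nv ⟨s, hs.1, Or.inl h⟩
    · exact h0nv ⟨s, hs.1, Or.inr h⟩
    · have := hP.relint_disjoint s hs.1 e he hs.2
      exact (this ▸ (⟨h, h0mem⟩ : (0 : ℂ) ∈ openSegment ℝ s.1 s.2 ∩ openSegment ℝ e.1 e.2) :
        (0 : ℂ) ∈ (∅ : Set ℂ))
  obtain ⟨r₁, hr₁, hseg⟩ := Metric.isOpen_iff.1 hsegclosed.isOpen_compl 0 h0seg
  obtain ⟨r₂, hr₂, hvert⟩ :=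
    Metric.isOpen_iff.1 hP.finite_polyVertices.isClosed.isOpen_compl 0 h0nv
  obtain ⟨r, hr, hrε, hrδ, hrr₁, hrr₂⟩ : ∃ r > 0, r ≤ ε ∧ r ≤ δ ∧ r ≤ r₁ ∧ r ≤ r₂ :=
    ⟨min (min ε δ) (min r₁ r₂), by positivity, by simp, by simp, by simp, by simp⟩
  have hpos : ∀ z ∈ carrier, dist z 0 < r → 0 < z.im := fun z hz hzr =>
    hupper ⟨hz, hzr.trans_le hrε⟩
  have hfront : ∀ z ∈ frontier carrier, dist z 0 < r → z.im = 0 := by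
    intro z hz hzr
    rw [hP.frontier_eq] at hz
    simp only [mem_iUnion] at hz
    obtain ⟨s, hs, hzs⟩ := hz
    by_cases hse : s = e
    · exact heReal (hse ▸ hzs)
    · exact absurd (mem_biUnion (show s ∈ sides \ {e} from ⟨hs, hse⟩) hzs)
        (hseg (Metric.mem_ball.2 (hzr.trans_le hrr₁)))
  have hcl : ∀ z, dist z 0 < r → z.im = 0 → z ∈ closure carrier := by
    intro z hzr hz
    apply frontier_subset_closure
    rw [hP.frontier_eq]
    exact mem_biUnion he (openSegment_subset_segment ℝ _ _ (haxis z (hzr.trans_le hrδ) hz))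
  have hsub : {z : ℂ | 0 < z.im} ∩ Metric.ball 0 r ⊆ carrier := by
    refine ((convex_halfSpace_im_gt 0).inter (convex_ball 0 r)).isPreconnected
      |>.subset_of_closure_inter_subset hP.isOpen ?_ ?_
    · obtain ⟨z, hz, hzr⟩ := Metric.mem_closure_iff.1
        (hcl 0 (by simpa using hr) Complex.zero_im) r hr
      rw [dist_comm] at hzr
      exact ⟨z, ⟨hpos z hz hzr, hzr⟩, hz⟩
    · rintro z ⟨hz, hzi, hzr⟩
      by_contra hzc
      rw [mem_ofPred_eq, hfront z (hP.isOpen.frontier_eq ▸ ⟨hz, hzc⟩) hzr] at hzi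
      exact hzi.false
  refine ⟨r, hr, fun z hzr => ⟨fun hz => ?_, fun hz => ?_⟩, fun z hzr hz => hsub ⟨hz, hzr⟩,
    fun z hzr hz => haxis z (hzr.trans_le hrδ) hz,
    fun z hzr => hvert (Metric.mem_ball.2 (hzr.trans_le hrr₂))⟩
  · by_cases hzc : z ∈ carrier
    · exact (hpos z hzc hzr).le
    · exact (hfront z (hP.isOpen.frontier_eq ▸ ⟨hz, hzc⟩) hzr).ge
  · rcases hz.lt_or_eq with h | h
    · exact subset_closure (hsub ⟨h, hzr⟩)
    · exact hcl z hzr h.symm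

end polygon

lemma fderivWithin_halfDisk_eq {carrier : Set ℂ} {u : ℂ → ℝ} {r : ℝ}
    (hcl : ∀ z, dist z 0 < r → (z ∈ closure carrier ↔ 0 ≤ z.im)) {z : ℂ} (hz : dist z 0 < r) :
    fderivWithin ℝ u (closure carrier) z = fderivWithin ℝ u (halfDisk r) z := by
  refine fderivWithin_congr_set ?_
  filter_upwards [Metric.isOpen_ball.mem_nhds (Metric.mem_ball.2 hz)] with w hw
  exact propext ((hcl w hw).trans ⟨fun h => ⟨h, hw⟩, fun h => h.1⟩)

lemma fderivWithin_eq_zero_of_dirDerivWithin {S : Set ℂ} {u : ℂ → ℝ} {z : ℂ}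
    (h1 : dirDerivWithin S 1 u z = 0) (hI : dirDerivWithin S I u z = 0) :
    fderivWithin ℝ u S z = 0 := by
  ext w
  rw [← Complex.re_add_im w, map_add, ← mul_one (w.re : ℂ), ← Complex.real_smul,
    ← Complex.real_smul, map_smul, map_smul]
  change w.re • dirDerivWithin S 1 u z + w.im • dirDerivWithin S I u z = 0
  rw [h1, hI, smul_zero, smul_zero, add_zero]
/-- local normal form (a tangential cusp) of a Neumann
eigenfunction near an index-zero isolated critical point `0` lying in the
relative interior of a side contained in the real axis. -/
theorem stmt13 (carrier : Set ℂ) (sides : Set (ℂ × ℂ))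
    (hP : IsPolygon carrier sides)
    (e : ℂ × ℂ) (he : e ∈ sides)
    (heReal : segment ℝ e.1 e.2 ⊆ {z : ℂ | z.im = 0})
    (h0mem : (0 : ℂ) ∈ openSegment ℝ e.1 e.2)
    (h0nv : (0 : ℂ) ∉ polyVertices sides)
    (hupper : ∃ ε > (0 : ℝ), carrier ∩ Metric.ball 0 ε ⊆ {z : ℂ | 0 < z.im})
    (u : ℂ → ℝ) (μ : ℝ) (hu : IsNeumannEigenfunOn carrier sides u μ)
    (hcrit : fderivWithin ℝ u (closure carrier) 0 = 0)
    (hisolated : ∃ ε > (0 : ℝ), ∀ q ∈ closure carrier, q ≠ 0 → dist q 0 < ε →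
      q ∉ polyVertices sides → fderivWithin ℝ u (closure carrier) q ≠ 0)
    (hind : HasIndex carrier u 0 0) :
    ∃ c : ℂ → ℝ, ∃ ρ : ℝ → ℝ, ∃ k : ℕ,
      AnalyticAt ℝ c 0 ∧ AnalyticAt ℝ ρ 0 ∧ Odd k ∧ 3 ≤ k ∧
      c 0 ≠ 0 ∧ ρ 0 ≠ 0 ∧
      ∃ ε > (0 : ℝ), ∀ z ∈ closure carrier ∩ Metric.ball 0 ε,
        u z = u 0 + c z * (z.im ^ 2 - z.re ^ k * ρ z.re) := by
  obtain ⟨r, hr, hcl, hcar, haxis, hvert⟩ := hP.exists_halfDisk he heReal h0mem h0nv hupper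
  have hfd : ∀ z, dist z 0 < r →
      fderivWithin ℝ u (closure carrier) z = fderivWithin ℝ u (halfDisk r) z := fun z hz =>
    fderivWithin_halfDisk_eq hcl hz
  have hsm : ContDiffOn ℝ (⊤ : ℕ∞) u (halfDisk r) :=
    hu.smooth.mono fun z hz => ⟨(hcl z hz.2).2 hz.1, hvert z hz.2⟩
  have hneu : ∀ x : ℝ, (x : ℂ) ∈ halfDisk r → dirDerivWithin (halfDisk r) I u x = 0 := by
    intro x hx
    have h1 := hu.neumann e he x (haxis x hx.2 (Complex.ofReal_im x))
    have ha : e.1.im = 0 := heReal (left_mem_segment ℝ e.1 e.2)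
    have hb : e.2.im = 0 := heReal (right_mem_segment ℝ e.1 e.2)
    have hd : e.2.re - e.1.re ≠ 0 := fun h =>
      hP.nondeg e he (Complex.ext (by linarith) (by rw [ha, hb]))
    have h2 : I * (e.2 - e.1) = (e.2.re - e.1.re) • I := by
      apply Complex.ext <;> simp [ha, hb]
    rw [hfd x hx.2, h2, map_smul, smul_eq_mul] at h1
    exact (mul_eq_zero.1 h1).resolve_left hd
  have hR : 0 < r / 2 := by positivity
  have h := NeumannJet.of_halfDisk hr hsm
    (fun z hz hzr => hu.eigen z (hcar z hzr hz)) hneu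
  have h0 : (0 : ℂ) ∉ carrier := by
    obtain ⟨ε, hε, hupper⟩ := hupper
    intro h0
    exact lt_irrefl (0 : ℝ) (hupper ⟨h0, Metric.mem_ball_self hε⟩)
  have hno := hind.not_hasNoBranch hr h0 hcl (W := fun x y => u ⟨x, y⟩) fun z _ _ => rfl
  have htwo := hind.not_hasTwoBranches hr h0 hcl (W := fun x y => u ⟨x, y⟩) fun z _ _ => rfl
  have hw1 : dirDerivWithin (halfDisk r) 1 u ⟨0, 0⟩ = 0 := by
    have := DFunLike.congr_fun ((hfd 0 (by simpa using hr)).symm.trans hcrit) 1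
    exact this
  obtain ⟨ε, hε, hiso⟩ := hisolated
  have hiso' : ∀ x y : ℝ, |x| < min (ε / 2) (r / 2) → 0 ≤ y → y < min (ε / 2) (r / 2) →
      (⟨x, y⟩ : ℂ) ≠ 0 → ¬(dirDerivWithin (halfDisk r) 1 u ⟨x, y⟩ = 0 ∧
        dirDerivWithin (halfDisk r) I u ⟨x, y⟩ = 0) := by
    rintro x y hx hy hyε hne ⟨h1, hI⟩
    obtain ⟨hx1, hx2⟩ := lt_min_iff.1 hx
    obtain ⟨hy1, hy2⟩ := lt_min_iff.1 hyε
    have hdr : dist (⟨x, y⟩ : ℂ) 0 < r :=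
      dist_zero_lt_of_abs_re_of_abs_im hx2 (by rwa [abs_of_nonneg hy])
    refine hiso _ ((hcl _ hdr).2 hy) hne
      (dist_zero_lt_of_abs_re_of_abs_im hx1 (by rwa [abs_of_nonneg hy])) (hvert _ hdr) ?_
    rw [hfd _ hdr]
    exact fderivWithin_eq_zero_of_dirDerivWithin h1 hI
  have hεr : 0 < min (ε / 2) (r / 2) := by positivity
  have hisoaxis : ∃ ε > (0 : ℝ), ∀ x : ℝ, x ≠ 0 → |x| < ε →
      dirDerivWithin (halfDisk r) 1 u ⟨x, 0⟩ ≠ 0 := by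
    refine ⟨_, hεr, fun x hx hxε h1 => hiso' x 0 hxε le_rfl hεr ?_ ⟨h1, ?_⟩⟩
    · exact fun h => hx (congrArg Complex.re h)
    · exact hneu x ⟨(Complex.ofReal_im x).ge, dist_zero_lt_of_abs_re_of_abs_im
        (lt_min_iff.1 hxε).2 (by simpa using hr)⟩
  by_cases hxx : (dirDerivWithin (halfDisk r) 1)^[2] u ⟨0, 0⟩ = 0
  · by_cases hμ : μ * u ⟨0, 0⟩ = 0
    · exact absurd (h.hasTwoBranches_of_degenerate hR hisoaxis hw1 hxx hμ) htwo
    · obtain ⟨c, ρ, k, hc, hρ, hk, hk3, hc0, hρ0, δ, hδ, hform⟩ :=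
        h.exists_cusp hR hw1 hisoaxis
          (by rw [hxx, neg_zero, zero_sub, neg_ne_zero]; exact hμ) hno htwo
      refine ⟨c, ρ, k, hc, hρ, hk, hk3, hc0, hρ0, min δ r, by positivity, fun z hz => ?_⟩
      obtain ⟨hzδ, hzr⟩ := lt_min_iff.1 (Metric.mem_ball.1 hz.2)
      rw [dist_zero_right] at hzδ
      exact hform z ((Complex.abs_re_le_norm z).trans_lt hzδ) ((hcl z hzr).1 hz.1)
        ((le_abs_self _).trans_lt ((Complex.abs_im_le_norm z).trans_lt hzδ))
  · rcases h.hasNoBranch_or_hasTwoBranches hR hw1 hxx ⟨_, hεr, fun x y hx hy hyε =>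
      hiso' x y hx hy.le hyε fun h => hy.ne' (congrArg Complex.im h)⟩ with h | h
    · exact absurd h hno
    · exact absurd h htwo

end
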